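/- arXiv:2104.04850 — 4 statements merged into one kernel-verified Lean document; each statement's English description precedes it below -/
import Mathlib

section
/- For every positive integer k, every p_0 < 1, and every ε > 0, there exists a constant L such that the following holds: if L·n^{−1/(k−1)} ≤ p ≤ p_0 and X denotes the number A_k([n]_p) of k-term arithmetic progressions contained in the binomial random subset [n]_p of {1,…,n}, then for every η ∈ [0,1], (1−ε)·Φ_{n,p}^k(η+ε) ≤ −log Pr(X ≤ η·E[X]) ≤ (1+ε)·Φ_{n,p}^k((1−ε)η). -/
open Classical

noncomputable section

/-- The probability of the subset `ω` of `{1,…,n}` under the product measure in which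
each `i ∈ {1,…,n}` is retained independently with probability `q i`: this is `[n]_q`. -/
def pwI (n : ℕ) (q : ℕ → ℝ) (ω : Finset ℕ) : ℝ :=
  (∏ i ∈ ω, q i) * ∏ i ∈ Finset.Icc 1 n \ ω, (1 - q i)

/-- The relative entropy `i_p(q) = D_KL(Ber(q) ‖ Ber(p))`.  (In Lean `Real.log 0 = 0`,
which implements the convention `0 · log 0 = 0`.) -/
def ip (p q : ℝ) : ℝ :=
  q * Real.log (q / p) + (1 - q) * Real.log ((1 - q) / (1 - p))

/-- `A_k(ω)`: the number of `k`-term arithmetic progressions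
`x, x+d, …, x+(k−1)d` (with `x, d ∈ {1,…,n}`) contained in `ω ⊆ {1,…,n}`. -/
def apCount (n k : ℕ) (ω : Finset ℕ) : ℕ :=
  ((Finset.Icc 1 n ×ˢ Finset.Icc 1 n).filter fun xd =>
    xd.1 + (k - 1) * xd.2 ≤ n ∧ ∀ i ∈ Finset.range k, xd.1 + i * xd.2 ∈ ω).card

/-- `E[A_k([n]_q)]`: the expected number of `k`-term arithmetic progressions in the
random set `[n]_q`. -/
def expAP (n k : ℕ) (q : ℕ → ℝ) : ℝ :=
  ∑ ω ∈ (Finset.Icc 1 n).powerset, pwI n q ω * (apCount n k ω : ℝ)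

/-- `Φ_{n,p}^k(η) = min { ∑_{i=1}^n i_p(q_i) : q ∈ [0,1]^n,
E[A_k([n]_q)] ≤ η E[A_k([n]_p)] }`. -/
def PhiAP (n k : ℕ) (p η : ℝ) : ℝ :=
  sInf {x | ∃ q : ℕ → ℝ, (∀ i ∈ Finset.Icc 1 n, q i ∈ Set.Icc (0 : ℝ) 1) ∧
    expAP n k q ≤ η * expAP n k (fun _ => p) ∧ x = ∑ i ∈ Finset.Icc 1 n, ip p (q i)}

/-- `Pr(X ≤ η E[X])` where `X = A_k([n]_p)`. -/
def PrAP (n k : ℕ) (p η : ℝ) : ℝ :=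
  ∑ ω ∈ (Finset.Icc 1 n).powerset,
    if (apCount n k ω : ℝ) ≤ η * expAP n k (fun _ => p) then pwI n (fun _ => p) ω else 0

/-- The product weight of `ω` as a subset of `V`, with marginals `q`. -/
def prodWeight (V : Finset ℕ) (q : ℕ → ℝ) (ω : Finset ℕ) : ℝ :=
  (∏ i ∈ ω, q i) * ∏ i ∈ V \ ω, (1 - q i)

theorem pwI_eq_prodWeight (n : ℕ) (q : ℕ → ℝ) : pwI n q = prodWeight (Finset.Icc 1 n) q := rfl

theorem prodWeight_nonneg {V : Finset ℕ} {q : ℕ → ℝ} (hq : ∀ i ∈ V, q i ∈ Set.Icc (0 : ℝ) 1)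
    {ω : Finset ℕ} (hω : ω ⊆ V) : 0 ≤ prodWeight V q ω := by
  refine mul_nonneg (Finset.prod_nonneg fun i hi => (hq i (hω hi)).1)
    (Finset.prod_nonneg fun i hi => ?_)
  have := (hq i (Finset.mem_sdiff.1 hi).1).2
  linarith

theorem sum_prodWeight_mul_prod (V : Finset ℕ) (q f g : ℕ → ℝ) :
    ∑ ω ∈ V.powerset, prodWeight V q ω * ((∏ i ∈ ω, f i) * ∏ i ∈ V \ ω, g i) =
      ∏ i ∈ V, (q i * f i + (1 - q i) * g i) := by
  rw [Finset.prod_add]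
  refine Finset.sum_congr rfl fun ω _ => ?_
  rw [prodWeight, Finset.prod_mul_distrib, Finset.prod_mul_distrib]
  ring

theorem sum_prodWeight (V : Finset ℕ) (q : ℕ → ℝ) :
    ∑ ω ∈ V.powerset, prodWeight V q ω = 1 := by
  have := sum_prodWeight_mul_prod V q (fun _ => 1) (fun _ => 1)
  simpa using this

theorem sum_prodWeight_subset_disjoint {V S T : Finset ℕ} (q : ℕ → ℝ) (hS : S ⊆ V) (hT : T ⊆ V)
    (hST : Disjoint S T) :
    ∑ ω ∈ V.powerset, prodWeight V q ω * (if S ⊆ ω ∧ Disjoint T ω then 1 else 0) =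
      (∏ i ∈ S, q i) * ∏ i ∈ T, (1 - q i) := by
  have key := sum_prodWeight_mul_prod V q (fun i => if i ∈ T then 0 else 1)
    (fun i => if i ∈ S then 0 else 1)
  have h1 : ∀ ω ∈ V.powerset, (∏ i ∈ ω, (if i ∈ T then (0 : ℝ) else 1)) *
      ∏ i ∈ V \ ω, (if i ∈ S then (0 : ℝ) else 1) =
      if S ⊆ ω ∧ Disjoint T ω then 1 else 0 := by
    intro ω hω
    split_ifs with h
    · rw [Finset.prod_eq_one, Finset.prod_eq_one, one_mul]
      · intro i hi
        rw [if_neg]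
        exact fun hiS => (Finset.mem_sdiff.1 hi).2 (h.1 hiS)
      · intro i hi
        rw [if_neg]
        exact fun hiT => Finset.disjoint_left.1 h.2 hiT hi
    · rw [not_and_or] at h
      rcases h with h | h
      · obtain ⟨i, hiS, hiω⟩ := Finset.not_subset.1 h
        rw [Finset.prod_eq_zero (s := V \ ω) (Finset.mem_sdiff.2 ⟨hS hiS, hiω⟩) (by simp [hiS]),
          mul_zero]
      · obtain ⟨i, hiT, hiω⟩ := Finset.not_disjoint_iff.1 h
        rw [Finset.prod_eq_zero (s := ω) hiω (by simp [hiT]), zero_mul]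
  rw [Finset.sum_congr rfl fun ω hω => congrArg (prodWeight V q ω * ·) (h1 ω hω)] at key
  rw [key]
  have h2 : ∀ i ∈ V, q i * (if i ∈ T then 0 else 1) + (1 - q i) * (if i ∈ S then 0 else 1) =
      (if i ∈ S then q i else 1) * (if i ∈ T then 1 - q i else 1) := by
    intro i _
    by_cases hiS : i ∈ S
    · have hiT : i ∉ T := Finset.disjoint_left.1 hST hiS
      simp [hiS, hiT]
    · by_cases hiT : i ∈ T <;> simp [hiS, hiT]
  rw [Finset.prod_congr rfl h2, Finset.prod_mul_distrib, ← Finset.prod_filter,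
    ← Finset.prod_filter, Finset.filter_mem_eq_inter, Finset.filter_mem_eq_inter,
    Finset.inter_eq_right.2 hS, Finset.inter_eq_right.2 hT]

theorem sum_prodWeight_subset {V S : Finset ℕ} (q : ℕ → ℝ) (hS : S ⊆ V) :
    ∑ ω ∈ V.powerset, prodWeight V q ω * (if S ⊆ ω then 1 else 0) = ∏ i ∈ S, q i := by
  have := sum_prodWeight_subset_disjoint q hS (Finset.empty_subset V) (Finset.disjoint_empty_right S)
  simpa using this

/-- Harris' inequality for a single vertex: under a product measure conditioned on a family which
is closed under removing `v`, the probability that `v` is present is at most `p`. -/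
theorem sum_prodWeight_mem_le {V : Finset ℕ} {p : ℝ} (hp0 : 0 ≤ p) (hp1 : p ≤ 1) {v : ℕ}
    (hv : v ∈ V) {g : Finset ℕ → ℝ} (hg : ∀ ω, g (insert v ω) ≤ g ω) :
    ∑ ω ∈ V.powerset, prodWeight V (fun _ => p) ω * g ω * (if v ∈ ω then 1 else 0) ≤
      p * ∑ ω ∈ V.powerset, prodWeight V (fun _ => p) ω * g ω := by
  obtain ⟨V', hvV', rfl⟩ : ∃ V', v ∉ V' ∧ V = insert v V' :=
    ⟨V.erase v, Finset.notMem_erase v V, (Finset.insert_erase hv).symm⟩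
  rw [Finset.sum_powerset_insert hvV', Finset.sum_powerset_insert hvV']
  have e1 : ∀ t ∈ V'.powerset, prodWeight (insert v V') (fun _ => p) t =
      (1 - p) * prodWeight V' (fun _ => p) t := by
    intro t ht
    have hvt : v ∉ t := fun h => hvV' (Finset.mem_powerset.1 ht h)
    rw [prodWeight, prodWeight, Finset.insert_sdiff_of_notMem _ hvt,
      Finset.prod_insert (fun h => hvV' (Finset.mem_sdiff.1 h).1)]
    ring
  have e2 : ∀ t ∈ V'.powerset, prodWeight (insert v V') (fun _ => p) (insert v t) =
      p * prodWeight V' (fun _ => p) t := by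
    intro t ht
    have hvt : v ∉ t := fun h => hvV' (Finset.mem_powerset.1 ht h)
    rw [prodWeight, prodWeight, Finset.prod_insert hvt, Finset.insert_sdiff_insert,
      Finset.sdiff_insert_of_notMem hvV']
    ring
  rw [← Finset.sum_add_distrib, ← Finset.sum_add_distrib, Finset.mul_sum]
  refine Finset.sum_le_sum fun t ht => ?_
  have hvt : v ∉ t := fun h => hvV' (Finset.mem_powerset.1 ht h)
  rw [e1 t ht, e2 t ht]
  simp only [hvt, if_false, Finset.mem_insert_self, if_true, mul_zero, mul_one, zero_add]
  have hw : 0 ≤ prodWeight V' (fun _ => p) t :=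
    prodWeight_nonneg (fun _ _ => ⟨hp0, hp1⟩) (Finset.mem_powerset.1 ht)
  have := mul_nonneg (mul_nonneg (mul_nonneg hp0 (sub_nonneg.2 hp1)) hw) (sub_nonneg.2 (hg t))
  nlinarith

theorem sum_prodWeight_subset_le {V : Finset ℕ} {p : ℝ} (hp0 : 0 ≤ p) (hp1 : p ≤ 1)
    {g : Finset ℕ → ℝ} (hg : ∀ v ω, g (insert v ω) ≤ g ω)
    {S : Finset ℕ} (hS : S ⊆ V) :
    ∑ ω ∈ V.powerset, prodWeight V (fun _ => p) ω * g ω * (if S ⊆ ω then 1 else 0) ≤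
      p ^ S.card * ∑ ω ∈ V.powerset, prodWeight V (fun _ => p) ω * g ω := by
  induction S using Finset.induction_on with
  | empty => simp
  | insert v S hvS ih =>
    have hvV := hS (Finset.mem_insert_self v S)
    have hSV := (Finset.subset_insert v S).trans hS
    have h := sum_prodWeight_mem_le hp0 hp1 hvV (g := fun ω => g ω * (if S ⊆ ω then 1 else 0))
      (fun ω => by
        simp only [Finset.subset_insert_iff_of_notMem hvS]
        exact mul_le_mul_of_nonneg_right (hg v ω) (by split_ifs <;> norm_num))
    rw [Finset.card_insert_of_notMem hvS, pow_succ]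
    calc _ = ∑ ω ∈ V.powerset, prodWeight V (fun _ => p) ω * (g ω * (if S ⊆ ω then 1 else 0)) *
          (if v ∈ ω then 1 else 0) := by
          refine Finset.sum_congr rfl fun ω _ => ?_
          by_cases h1 : v ∈ ω <;> by_cases h2 : S ⊆ ω <;> simp [Finset.insert_subset_iff, h1, h2]
      _ ≤ _ := h
      _ ≤ p * (p ^ S.card * ∑ ω ∈ V.powerset, prodWeight V (fun _ => p) ω * g ω) := by
          refine mul_le_mul_of_nonneg_left ?_ hp0
          simpa only [mul_assoc] using ih hSV
      _ = _ := by ring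

theorem sum_powerset_split {V W : Finset ℕ} (hW : W ⊆ V) (f : Finset ℕ → ℝ) :
    ∑ ω ∈ V.powerset, f ω = ∑ τ ∈ W.powerset, ∑ σ ∈ (V \ W).powerset, f (τ ∪ σ) := by
  rw [← Finset.sum_product']
  refine Finset.sum_nbij' (fun ω => (ω ∩ W, ω \ W)) (fun x => x.1 ∪ x.2) ?_ ?_ ?_ ?_ ?_
  · intro ω hω
    rw [Finset.mem_powerset] at hω
    simp only [Finset.mem_product, Finset.mem_powerset]
    exact ⟨Finset.inter_subset_right, Finset.sdiff_subset_sdiff hω le_rfl⟩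
  · intro x hx
    simp only [Finset.mem_product, Finset.mem_powerset] at hx ⊢
    exact Finset.union_subset (hx.1.trans hW) (hx.2.trans Finset.sdiff_subset)
  · intro ω _
    ext i
    simp only [Finset.mem_union, Finset.mem_inter, Finset.mem_sdiff]
    tauto
  · intro x hx
    simp only [Finset.mem_product, Finset.mem_powerset] at hx
    have h1 := hx.1
    have h2 := hx.2
    refine Prod.ext ?_ ?_
    · ext i
      have := @h1 i
      have := @h2 i
      simp only [Finset.mem_union, Finset.mem_inter, Finset.mem_sdiff] at *
      tauto
    · ext i
      have := @h1 i
      have := @h2 i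
      simp only [Finset.mem_union, Finset.mem_sdiff] at *
      tauto
  · intro ω _
    congr 1
    ext i
    simp only [Finset.mem_union, Finset.mem_inter, Finset.mem_sdiff]
    tauto

/-- The conditional expectation of `f` given the trace on `W`, for the weight `μ` on `Ω`. -/
def condExpInter (Ω : Finset (Finset ℕ)) (μ : Finset ℕ → ℝ) (W : Finset ℕ) (f : Finset ℕ → ℝ)
    (ω : Finset ℕ) : ℝ :=
  (∑ ω' ∈ Ω, if ω' ∩ W = ω ∩ W then μ ω' * f ω' else 0) /
    ∑ ω' ∈ Ω, if ω' ∩ W = ω ∩ W then μ ω' else 0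

/-- `h ω` depends only on `ω ∩ W`. -/
def DependsOnInter (W : Finset ℕ) (h : Finset ℕ → ℝ) : Prop :=
  ∀ ω ω', ω ∩ W = ω' ∩ W → h ω = h ω'

theorem dependsOnInter_condExpInter (Ω : Finset (Finset ℕ)) (μ : Finset ℕ → ℝ) (W : Finset ℕ)
    (f : Finset ℕ → ℝ) : DependsOnInter W (condExpInter Ω μ W f) := by
  intro ω ω' h
  rw [condExpInter, condExpInter, h]

theorem DependsOnInter.mono {W W' : Finset ℕ} (hW : W ⊆ W') {h : Finset ℕ → ℝ}
    (hh : DependsOnInter W h) : DependsOnInter W' h := by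
  intro ω ω' e
  apply hh
  have := congrArg (· ∩ W) e
  simpa [Finset.inter_assoc, Finset.inter_eq_right.2 hW] using this

theorem DependsOnInter.mul {W : Finset ℕ} {g h : Finset ℕ → ℝ} (hg : DependsOnInter W g)
    (hh : DependsOnInter W h) : DependsOnInter W (fun ω => g ω * h ω) := by
  intro ω ω' e
  simp only [hg ω ω' e, hh ω ω' e]

theorem DependsOnInter.comp {W : Finset ℕ} {h : Finset ℕ → ℝ} (hh : DependsOnInter W h)
    (φ : ℝ → ℝ) : DependsOnInter W (fun ω => φ (h ω)) := by
  intro ω ω' e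
  simp only [hh ω ω' e]

theorem DependsOnInter.prod {ι : Type*} {W : Finset ℕ} {s : Finset ι} {h : ι → Finset ℕ → ℝ}
    (hh : ∀ i ∈ s, DependsOnInter W (h i)) : DependsOnInter W (fun ω => ∏ i ∈ s, h i ω) := by
  intro ω ω' e
  exact Finset.prod_congr rfl fun i hi => hh i hi ω ω' e

theorem dependsOnInter_mem {W : Finset ℕ} {v : ℕ} (hv : v ∈ W) :
    DependsOnInter W (fun ω => if v ∈ ω then 1 else 0) := by
  intro ω ω' e
  have : v ∈ ω ↔ v ∈ ω' := by
    have := congrArg (v ∈ ·) e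
    simpa [hv] using this
  simp only [this]

theorem sum_condExpInter_mul {Ω : Finset (Finset ℕ)} {μ : Finset ℕ → ℝ}
    (hμ : ∀ ω ∈ Ω, 0 ≤ μ ω) (W : Finset ℕ) (f : Finset ℕ → ℝ) {h : Finset ℕ → ℝ}
    (hh : DependsOnInter W h) :
    ∑ ω ∈ Ω, μ ω * (condExpInter Ω μ W f ω * h ω) = ∑ ω ∈ Ω, μ ω * (f ω * h ω) := by
  set D : Finset ℕ → ℝ := fun ω => ∑ ω' ∈ Ω, if ω' ∩ W = ω ∩ W then μ ω' else 0 with hD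
  have e1 : ∀ ω ∈ Ω, μ ω * (condExpInter Ω μ W f ω * h ω) =
      ∑ ω' ∈ Ω, if ω' ∩ W = ω ∩ W then μ ω' * f ω' * h ω' * (μ ω / D ω') else 0 := by
    intro ω _
    rw [condExpInter, div_mul_eq_mul_div, mul_div_assoc', Finset.sum_mul, Finset.mul_sum,
      Finset.sum_div]
    refine Finset.sum_congr rfl fun ω' _ => ?_
    split_ifs with e
    · have : D ω' = D ω := by simp only [hD, e]
      rw [hh ω' ω e, this]
      simp only [hD]
      ring
    · simp
  rw [Finset.sum_congr rfl e1, Finset.sum_comm]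
  refine Finset.sum_congr rfl fun ω' hω' => ?_
  have e2 : ∑ ω ∈ Ω, (if ω' ∩ W = ω ∩ W then μ ω' * f ω' * h ω' * (μ ω / D ω') else 0) =
      μ ω' * f ω' * h ω' * (D ω' / D ω') := by
    rw [hD]
    simp only
    rw [Finset.sum_div, Finset.mul_sum]
    refine Finset.sum_congr rfl fun ω _ => ?_
    by_cases e : ω' ∩ W = ω ∩ W
    · rw [if_pos e, if_pos e.symm]
    · rw [if_neg e, if_neg (fun h => e h.symm)]
      simp
  rw [e2]
  by_cases h0 : D ω' = 0
  · have : μ ω' = 0 := by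
      have h1 := (Finset.sum_eq_zero_iff_of_nonneg (fun ω hω => by
        split_ifs
        · exact hμ ω hω
        · exact le_rfl)).1 h0 ω' hω'
      simpa using h1
    simp [this]
  · rw [div_self h0]
    ring

theorem condExpInter_nonneg {Ω : Finset (Finset ℕ)} {μ f : Finset ℕ → ℝ}
    (hμ : ∀ ω ∈ Ω, 0 ≤ μ ω) (hf : ∀ ω ∈ Ω, 0 ≤ f ω) (W ω : Finset ℕ) :
    0 ≤ condExpInter Ω μ W f ω := by
  refine div_nonneg (Finset.sum_nonneg fun ω' h => ?_) (Finset.sum_nonneg fun ω' h => ?_)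
  · split_ifs
    · exact mul_nonneg (hμ ω' h) (hf ω' h)
    · exact le_rfl
  · split_ifs
    · exact hμ ω' h
    · exact le_rfl

theorem condExpInter_pos {Ω : Finset (Finset ℕ)} {μ f : Finset ℕ → ℝ}
    (hμ : ∀ ω ∈ Ω, 0 ≤ μ ω) (hf : ∀ ω ∈ Ω, 0 ≤ f ω) (W : Finset ℕ) {ω : Finset ℕ}
    (hω : ω ∈ Ω) (hμω : 0 < μ ω) (hfω : 0 < f ω) : 0 < condExpInter Ω μ W f ω := by
  refine div_pos (Finset.sum_pos' (fun ω' h => ?_) ⟨ω, hω, ?_⟩)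
    (Finset.sum_pos' (fun ω' h => ?_) ⟨ω, hω, ?_⟩)
  · split_ifs
    · exact mul_nonneg (hμ ω' h) (hf ω' h)
    · exact le_rfl
  · simpa using mul_pos hμω hfω
  · split_ifs
    · exact hμ ω' h
    · exact le_rfl
  · simpa using hμω

theorem sum_sq_sub_condExpInter {Ω : Finset (Finset ℕ)} {μ : Finset ℕ → ℝ}
    (hμ : ∀ ω ∈ Ω, 0 ≤ μ ω) {W W' : Finset ℕ} (hW : W ⊆ W') (f : Finset ℕ → ℝ) :
    ∑ ω ∈ Ω, μ ω * (condExpInter Ω μ W' f ω - condExpInter Ω μ W f ω) ^ 2 =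
      ∑ ω ∈ Ω, μ ω * condExpInter Ω μ W' f ω ^ 2 - ∑ ω ∈ Ω, μ ω * condExpInter Ω μ W f ω ^ 2 := by
  have hd := dependsOnInter_condExpInter Ω μ W f
  have h1 := sum_condExpInter_mul hμ W' f (hd.mono hW)
  have h2 := sum_condExpInter_mul hμ W f hd
  have : ∑ ω ∈ Ω, μ ω * (condExpInter Ω μ W' f ω - condExpInter Ω μ W f ω) ^ 2 =
      ∑ ω ∈ Ω, μ ω * condExpInter Ω μ W' f ω ^ 2
        - 2 * ∑ ω ∈ Ω, μ ω * (condExpInter Ω μ W' f ω * condExpInter Ω μ W f ω)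
        + ∑ ω ∈ Ω, μ ω * (condExpInter Ω μ W f ω * condExpInter Ω μ W f ω) := by
    rw [Finset.mul_sum, ← Finset.sum_sub_distrib, ← Finset.sum_add_distrib]
    exact Finset.sum_congr rfl fun ω _ => by ring
  rw [this, h1, ← h2]
  have e : ∑ ω ∈ Ω, μ ω * condExpInter Ω μ W f ω ^ 2 =
      ∑ ω ∈ Ω, μ ω * (condExpInter Ω μ W f ω * condExpInter Ω μ W f ω) :=
    Finset.sum_congr rfl fun ω _ => by ring
  rw [e]
  ring

/-- A family of subsets of `V` closed under taking subsets, weighted by the product measure. -/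
def restrictedWeight (V : Finset ℕ) (p : ℝ) (E : Finset ℕ → Prop) (ω : Finset ℕ) : ℝ :=
  prodWeight V (fun _ => p) ω * (if E ω then 1 else 0)

/-- The conditional probability, given the trace on `W`, that `v` is present. -/
def condMarginal (V : Finset ℕ) (p : ℝ) (E : Finset ℕ → Prop) (W : Finset ℕ) (v : ℕ) :
    Finset ℕ → ℝ :=
  condExpInter V.powerset (restrictedWeight V p E) W (fun ω => if v ∈ ω then 1 else 0)

section
variable {V : Finset ℕ} {p : ℝ} {E : Finset ℕ → Prop}

theorem restrictedWeight_nonneg (hp0 : 0 ≤ p) (hp1 : p ≤ 1) :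
    ∀ ω ∈ V.powerset, 0 ≤ restrictedWeight V p E ω := by
  intro ω hω
  refine mul_nonneg (prodWeight_nonneg (fun _ _ => ⟨hp0, hp1⟩) (Finset.mem_powerset.1 hω)) ?_
  split_ifs <;> norm_num

theorem condMarginal_nonneg (hp0 : 0 ≤ p) (hp1 : p ≤ 1) (W : Finset ℕ) (v : ℕ) (ω : Finset ℕ) :
    0 ≤ condMarginal V p E W v ω :=
  condExpInter_nonneg (restrictedWeight_nonneg hp0 hp1)
    (fun ω _ => by split_ifs <;> norm_num) W ω

theorem condMarginal_le (hp0 : 0 ≤ p) (hp1 : p ≤ 1) (hE : ∀ ω ω', ω ⊆ ω' → E ω' → E ω)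
    {W : Finset ℕ} {v : ℕ} (hv : v ∈ V) (hvW : v ∉ W) (ω : Finset ℕ) :
    condMarginal V p E W v ω ≤ p := by
  refine div_le_of_le_mul₀ (Finset.sum_nonneg fun ω' h => ?_) hp0 ?_
  · split_ifs
    · exact restrictedWeight_nonneg hp0 hp1 ω' h
    · exact le_rfl
  have key := sum_prodWeight_mem_le hp0 hp1 hv
    (g := fun ω' => (if E ω' then 1 else 0) * (if ω' ∩ W = ω ∩ W then 1 else 0))
    (fun ω' => by
      rw [Finset.insert_inter_of_notMem hvW]
      refine mul_le_mul_of_nonneg_right ?_ (by split_ifs <;> norm_num)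
      by_cases h : E (insert v ω')
      · rw [if_pos h, if_pos (hE _ _ (Finset.subset_insert v ω') h)]
      · rw [if_neg h]
        split_ifs <;> norm_num)
  refine le_trans (le_of_eq ?_) (key.trans (le_of_eq ?_))
  · refine Finset.sum_congr rfl fun ω' _ => ?_
    rw [restrictedWeight]
    by_cases h1 : ω' ∩ W = ω ∩ W <;> by_cases h2 : v ∈ ω' <;> simp [h1, h2]
  · congr 1
    refine Finset.sum_congr rfl fun ω' _ => ?_
    rw [restrictedWeight]
    split_ifs <;> ring

theorem sum_restrictedWeight_subset_le (hp0 : 0 ≤ p) (hp1 : p ≤ 1)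
    (hE : ∀ ω ω', ω ⊆ ω' → E ω' → E ω) {S : Finset ℕ} (hS : S ⊆ V) :
    ∑ ω ∈ V.powerset, restrictedWeight V p E ω * (if S ⊆ ω then 1 else 0) ≤
      p ^ S.card * ∑ ω ∈ V.powerset, restrictedWeight V p E ω :=
  sum_prodWeight_subset_le hp0 hp1 (g := fun ω => if E ω then 1 else 0)
    (fun v ω => by
      by_cases h : E (insert v ω)
      · rw [if_pos h, if_pos (hE _ _ (Finset.subset_insert v ω) h)]
      · rw [if_neg h]
        split_ifs <;> norm_num) hS

/-- Superadditivity of the relative entropy, given the trace on `W`. -/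
theorem sum_ip_condMarginal_le (hp0 : 0 < p) (hp1 : p < 1) (hE : ∀ ω ω', ω ⊆ ω' → E ω' → E ω)
    {W : Finset ℕ} (hW : W ⊆ V) (hZ : 0 < ∑ ω ∈ V.powerset, restrictedWeight V p E ω) :
    ∑ ω ∈ V.powerset, restrictedWeight V p E ω *
        ∑ v ∈ V \ W, ip p (condMarginal V p E W v ω) ≤
      (∑ ω ∈ V.powerset, restrictedWeight V p E ω) *
        (- Real.log (∑ ω ∈ V.powerset, restrictedWeight V p E ω)) := by
  set μ := restrictedWeight V p E with hμdef
  set Z := ∑ ω ∈ V.powerset, μ ω with hZdef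
  set q := condMarginal V p E W with hq
  have hμ0 : ∀ ω ∈ V.powerset, 0 ≤ μ ω := restrictedWeight_nonneg hp0.le hp1.le
  have hq0 : ∀ v ω, 0 ≤ q v ω := fun v ω => condMarginal_nonneg hp0.le hp1.le W v ω
  have hqp : ∀ v ∈ V \ W, ∀ ω, q v ω ≤ p := fun v hv ω =>
    condMarginal_le hp0.le hp1.le hE (Finset.mem_sdiff.1 hv).1 (Finset.mem_sdiff.1 hv).2 ω
  have hqdep : ∀ v, DependsOnInter W (q v) := fun v => dependsOnInter_condExpInter _ _ _ _
  set r : ℕ → Finset ℕ → ℝ := fun v ω => if v ∈ ω then q v ω / p else (1 - q v ω) / (1 - p)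
    with hr
  set R : Finset ℕ → ℝ := fun ω => ∏ v ∈ V \ W, r v ω with hR
  have hr0 : ∀ v ∈ V \ W, ∀ ω, 0 ≤ r v ω := by
    intro v hv ω
    simp only [hr]
    have := hqp v hv ω
    split_ifs
    · exact div_nonneg (hq0 v ω) hp0.le
    · exact div_nonneg (by linarith) (by linarith)
  have hrpos : ∀ ω ∈ V.powerset, 0 < μ ω → ∀ v ∈ V \ W, 0 < r v ω := by
    intro ω hω hμω v hv
    simp only [hr]
    have := hqp v hv ω
    split_ifs with h
    · refine div_pos (condExpInter_pos hμ0 (fun ω _ => by split_ifs <;> norm_num) W hω hμω ?_) hp0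
      simp [h]
    · exact div_pos (by linarith) (by linarith)
  have hR1 : ∑ ω ∈ V.powerset, prodWeight V (fun _ => p) ω * R ω = 1 := by
    rw [sum_powerset_split hW]
    have inner : ∀ τ ∈ W.powerset, ∑ σ ∈ (V \ W).powerset,
        prodWeight V (fun _ => p) (τ ∪ σ) * R (τ ∪ σ) = prodWeight W (fun _ => p) τ := by
      intro τ hτ
      rw [Finset.mem_powerset] at hτ
      have e : ∀ σ ∈ (V \ W).powerset, prodWeight V (fun _ => p) (τ ∪ σ) * R (τ ∪ σ) =
          prodWeight W (fun _ => p) τ * (prodWeight (V \ W) (fun _ => p) σ *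
            ((∏ i ∈ σ, q i τ / p) * ∏ i ∈ (V \ W) \ σ, (1 - q i τ) / (1 - p))) := by
        intro σ hσ
        rw [Finset.mem_powerset] at hσ
        have hdisj : Disjoint τ σ := by
          rw [Finset.disjoint_left]
          intro i h1 h2
          exact (Finset.mem_sdiff.1 (hσ h2)).2 (hτ h1)
        have e1 : V \ (τ ∪ σ) = (W \ τ) ∪ ((V \ W) \ σ) := by
          ext i
          have h1 := @hτ i
          have h2 := @hσ i
          have h3 := @hW i
          simp only [Finset.mem_sdiff, Finset.mem_union] at *
          tauto
        have e2 : Disjoint (W \ τ) ((V \ W) \ σ) := by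
          rw [Finset.disjoint_left]
          intro i h1 h2
          simp only [Finset.mem_sdiff] at h1 h2
          tauto
        have e3 : prodWeight V (fun _ => p) (τ ∪ σ) =
            prodWeight W (fun _ => p) τ * prodWeight (V \ W) (fun _ => p) σ := by
          rw [prodWeight, prodWeight, prodWeight, e1, Finset.prod_union hdisj,
            Finset.prod_union e2]
          ring
        have e4 : R (τ ∪ σ) = (∏ i ∈ σ, q i τ / p) * ∏ i ∈ (V \ W) \ σ, (1 - q i τ) / (1 - p) := by
          have hq' : ∀ i, q i (τ ∪ σ) = q i τ := by
            intro i
            apply hqdep i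
            ext x
            have h1 := @hτ x
            have h2 := @hσ x
            simp only [Finset.mem_sdiff, Finset.mem_union, Finset.mem_inter] at *
            tauto
          simp only [hR]
          rw [← Finset.prod_sdiff hσ, mul_comm]
          congr 1
          · refine Finset.prod_congr rfl fun i hi => ?_
            simp [hr, hi, hq']
          · refine Finset.prod_congr rfl fun i hi => ?_
            have h1 := (Finset.mem_sdiff.1 hi).2
            have h2 : i ∉ τ := fun h => (Finset.mem_sdiff.1 (Finset.mem_sdiff.1 hi).1).2 (hτ h)
            simp [hr, h1, h2, hq']
        rw [e3, e4]
        ring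
      rw [Finset.sum_congr rfl e, ← Finset.mul_sum, sum_prodWeight_mul_prod,
        Finset.prod_eq_one, mul_one]
      intro i _
      have : 1 - p ≠ 0 := by linarith
      field_simp
      ring
    rw [Finset.sum_congr rfl inner, sum_prodWeight]
  have hμR : ∑ ω ∈ V.powerset, μ ω * R ω ≤ 1 := by
    rw [← hR1]
    refine Finset.sum_le_sum fun ω hω => ?_
    refine mul_le_mul_of_nonneg_right ?_ (Finset.prod_nonneg fun v hv => hr0 v hv ω)
    rw [hμdef, restrictedWeight]
    refine mul_le_of_le_one_right (prodWeight_nonneg (fun _ _ => ⟨hp0.le, hp1.le⟩)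
      (Finset.mem_powerset.1 hω)) ?_
    split_ifs <;> norm_num
  have hlog : ∀ ω ∈ V.powerset, μ ω * (∑ v ∈ V \ W, Real.log (r v ω) + Real.log Z) ≤
      μ ω * (R ω * Z - 1) := by
    intro ω hω
    rcases (hμ0 ω hω).eq_or_lt with h | h
    · rw [← h]; simp
    · have hRpos : 0 < R ω := Finset.prod_pos fun v hv => hrpos ω hω h v hv
      rw [← Real.log_prod (fun v hv => (hrpos ω hω h v hv).ne'), ← Real.log_mul hRpos.ne' hZ.ne']
      exact mul_le_mul_of_nonneg_left (Real.log_le_sub_one_of_pos (mul_pos hRpos hZ)) h.le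
  have hsum := Finset.sum_le_sum hlog
  have hrw : ∑ ω ∈ V.powerset, μ ω * ∑ v ∈ V \ W, ip p (q v ω) =
      ∑ ω ∈ V.powerset, μ ω * ∑ v ∈ V \ W, Real.log (r v ω) := by
    simp only [Finset.mul_sum]
    rw [Finset.sum_comm, Finset.sum_comm (s := V.powerset)]
    refine Finset.sum_congr rfl fun v hv => ?_
    have c1 := sum_condExpInter_mul hμ0 W (fun ω => if v ∈ ω then (1 : ℝ) else 0)
      (h := fun ω => Real.log (q v ω / p) - Real.log ((1 - q v ω) / (1 - p)))
      ((hqdep v).comp fun x => Real.log (x / p) - Real.log ((1 - x) / (1 - p)))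
    have s1 : ∀ ω ∈ V.powerset, μ ω * ip p (q v ω) = μ ω * (q v ω *
        (Real.log (q v ω / p) - Real.log ((1 - q v ω) / (1 - p)))) +
        μ ω * Real.log ((1 - q v ω) / (1 - p)) := by
      intro ω _
      rw [ip]
      ring
    have s2 : ∀ ω ∈ V.powerset, μ ω * Real.log (r v ω) = μ ω * ((if v ∈ ω then 1 else 0) *
        (Real.log (q v ω / p) - Real.log ((1 - q v ω) / (1 - p)))) +
        μ ω * Real.log ((1 - q v ω) / (1 - p)) := by
      intro ω _
      simp only [hr]
      split_ifs <;> ring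
    rw [Finset.sum_congr rfl s1, Finset.sum_congr rfl s2, Finset.sum_add_distrib,
      Finset.sum_add_distrib]
    congr 1
  rw [hrw]
  have a1 : ∑ ω ∈ V.powerset, μ ω * (∑ v ∈ V \ W, Real.log (r v ω) + Real.log Z) =
      ∑ ω ∈ V.powerset, μ ω * ∑ v ∈ V \ W, Real.log (r v ω) + Z * Real.log Z := by
    rw [hZdef, Finset.sum_mul, ← Finset.sum_add_distrib]
    exact Finset.sum_congr rfl fun ω _ => by ring
  have a2 : ∑ ω ∈ V.powerset, μ ω * (R ω * Z - 1) = (∑ ω ∈ V.powerset, μ ω * R ω) * Z - Z := by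
    conv_rhs => rw [Finset.sum_mul]
    nth_rw 3 [hZdef]
    rw [← Finset.sum_sub_distrib]
    exact Finset.sum_congr rfl fun ω _ => by ring
  rw [a1, a2] at hsum
  have := mul_le_mul_of_nonneg_right hμR hZ.le
  linarith

end

/-- The increments of the conditional marginals can be made small by conditioning on a small set. -/
theorem exists_small_increment {V : Finset ℕ} {p lam : ℝ} {E : Finset ℕ → Prop} (hp0 : 0 < p)
    (hp1 : p ≤ 1) (hlam : 0 ≤ lam) (hE : ∀ ω ω', ω ⊆ ω' → E ω' → E ω)
    (hZ : 0 < ∑ ω ∈ V.powerset, restrictedWeight V p E ω) :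
    ∃ W ⊆ V, lam * W.card ≤ V.card ∧ ∀ U ⊆ V,
      ∑ v ∈ V \ (W ∪ U), ∑ ω ∈ V.powerset, restrictedWeight V p E ω *
        (condMarginal V p E (W ∪ U) v ω - condMarginal V p E W v ω) ^ 2 ≤
      (1 + lam) * p ^ 2 * (∑ ω ∈ V.powerset, restrictedWeight V p E ω) * U.card := by
  set μ := restrictedWeight V p E with hμ
  set Z := ∑ ω ∈ V.powerset, μ ω with hZd
  have hμ0 : ∀ ω ∈ V.powerset, 0 ≤ μ ω := restrictedWeight_nonneg hp0.le hp1
  set e : Finset ℕ → ℕ → ℝ := fun W v => ∑ ω ∈ V.powerset, μ ω * condMarginal V p E W v ω ^ 2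
    with he
  have he0 : ∀ W v, 0 ≤ e W v := fun W v =>
    Finset.sum_nonneg fun ω hω => mul_nonneg (hμ0 ω hω) (sq_nonneg _)
  have hep : ∀ W, ∀ v ∈ V \ W, e W v ≤ p ^ 2 * Z := by
    intro W v hv
    rw [hZd, Finset.mul_sum]
    refine Finset.sum_le_sum fun ω hω => ?_
    rw [mul_comm (p ^ 2)]
    refine mul_le_mul_of_nonneg_left ?_ (hμ0 ω hω)
    exact pow_le_pow_left₀ (condMarginal_nonneg hp0.le hp1 W v ω)
      (condMarginal_le hp0.le hp1 hE (Finset.mem_sdiff.1 hv).1 (Finset.mem_sdiff.1 hv).2 ω) 2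
  set F : Finset ℕ → ℝ := fun W => ∑ v ∈ V \ W, e W v - lam * (p ^ 2 * Z) * W.card with hF
  have hc : 0 < p ^ 2 * Z := mul_pos (pow_pos hp0 2) hZ
  obtain ⟨W, hW, hmax⟩ := Finset.exists_max_image V.powerset F ⟨∅, Finset.empty_mem_powerset V⟩
  rw [Finset.mem_powerset] at hW
  refine ⟨W, hW, ?_, fun U hU => ?_⟩
  · have h1 := hmax ∅ (Finset.empty_mem_powerset V)
    have h2 : 0 ≤ F ∅ := by
      simp only [hF, Finset.card_empty, Nat.cast_zero, mul_zero, sub_zero]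
      exact Finset.sum_nonneg fun v _ => he0 ∅ v
    have h3 : ∑ v ∈ V \ W, e W v ≤ V.card * (p ^ 2 * Z) := by
      refine (Finset.sum_le_card_nsmul _ _ _ (hep W)).trans ?_
      rw [nsmul_eq_mul]
      refine mul_le_mul_of_nonneg_right ?_ hc.le
      exact_mod_cast Finset.card_le_card Finset.sdiff_subset
    have h4 : lam * (p ^ 2 * Z) * W.card ≤ V.card * (p ^ 2 * Z) := by
      simp only [hF] at h1 h2
      linarith
    refine le_of_mul_le_mul_right ?_ hc
    linarith
  · have h1 := hmax (W ∪ U) (Finset.mem_powerset.2 (Finset.union_subset hW hU))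
    have h2 : ∑ v ∈ V \ W, e W v ≤ ∑ v ∈ V \ (W ∪ U), e W v + U.card * (p ^ 2 * Z) := by
      have hsub : V \ (W ∪ U) ⊆ V \ W := Finset.sdiff_subset_sdiff le_rfl Finset.subset_union_left
      rw [← Finset.sum_sdiff hsub, add_comm]
      gcongr
      refine (Finset.sum_le_card_nsmul _ _ _ fun v hv => hep W v (Finset.mem_sdiff.1 hv).1).trans ?_
      rw [nsmul_eq_mul]
      refine mul_le_mul_of_nonneg_right ?_ hc.le
      have : (V \ W) \ (V \ (W ∪ U)) ⊆ U := by
        intro i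
        simp only [Finset.mem_sdiff, Finset.mem_union]
        tauto
      exact_mod_cast Finset.card_le_card this
    have h3 : ((W ∪ U).card : ℝ) ≤ W.card + U.card := by exact_mod_cast Finset.card_union_le W U
    have h4 := mul_le_mul_of_nonneg_left h3 (mul_nonneg hlam hc.le)
    have h5 : ∑ v ∈ V \ (W ∪ U), ∑ ω ∈ V.powerset, μ ω *
        (condMarginal V p E (W ∪ U) v ω - condMarginal V p E W v ω) ^ 2 =
        ∑ v ∈ V \ (W ∪ U), e (W ∪ U) v - ∑ v ∈ V \ (W ∪ U), e W v := by
      rw [← Finset.sum_sub_distrib]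
      exact Finset.sum_congr rfl fun v _ =>
        sum_sq_sub_condExpInter hμ0 Finset.subset_union_left _
    rw [h5]
    simp only [hF] at h1
    linarith

/-- The pairs (first term, common difference) of the `k`-term progressions in `{1,…,n}`. -/
def apSet (n k : ℕ) : Finset (ℕ × ℕ) :=
  (Finset.Icc 1 n ×ˢ Finset.Icc 1 n).filter fun a => a.1 + (k - 1) * a.2 ≤ n

/-- The `i`-th term of a progression. -/
def apTerm (a : ℕ × ℕ) (i : ℕ) : ℕ := a.1 + i * a.2

/-- The first `j` terms of a progression. -/
def apInit (a : ℕ × ℕ) (j : ℕ) : Finset ℕ := (Finset.range j).image (apTerm a)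

section
variable {n k : ℕ} {a : ℕ × ℕ}

theorem mem_apSet : a ∈ apSet n k ↔ (1 ≤ a.1 ∧ a.1 ≤ n) ∧ (1 ≤ a.2 ∧ a.2 ≤ n) ∧
    a.1 + (k - 1) * a.2 ≤ n := by
  simp [apSet, and_assoc]

theorem apTerm_mem (ha : a ∈ apSet n k) {i : ℕ} (hi : i < k) : apTerm a i ∈ Finset.Icc 1 n := by
  rw [mem_apSet] at ha
  rw [Finset.mem_Icc, apTerm]
  have : i * a.2 ≤ (k - 1) * a.2 := Nat.mul_le_mul_right _ (by omega)
  omega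

theorem apTerm_injective (ha : a ∈ apSet n k) : Function.Injective (apTerm a) := by
  intro i j h
  rw [mem_apSet] at ha
  rw [apTerm, apTerm, Nat.add_left_cancel_iff] at h
  exact Nat.eq_of_mul_eq_mul_right (by omega) h

theorem card_apInit (ha : a ∈ apSet n k) (j : ℕ) : (apInit a j).card = j := by
  rw [apInit, Finset.card_image_of_injective _ (apTerm_injective ha), Finset.card_range]

theorem apInit_subset_iff {j : ℕ} {ω : Finset ℕ} :
    apInit a j ⊆ ω ↔ ∀ i ∈ Finset.range j, apTerm a i ∈ ω := Finset.image_subset_iff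

theorem apInit_subset (ha : a ∈ apSet n k) {j : ℕ} (hj : j ≤ k) :
    apInit a j ⊆ Finset.Icc 1 n :=
  apInit_subset_iff.2 fun _ hi => apTerm_mem ha ((Finset.mem_range.1 hi).trans_le hj)

theorem prod_apInit (ha : a ∈ apSet n k) (j : ℕ) (f : ℕ → ℝ) :
    ∏ v ∈ apInit a j, f v = ∏ i ∈ Finset.range j, f (apTerm a i) :=
  Finset.prod_image (apTerm_injective ha).injOn

theorem card_apSet_term_le (n k j v : ℕ) :
    ((apSet n k).filter fun a => apTerm a j = v).card ≤ n := by
  calc _ ≤ (Finset.Icc 1 n).card := by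
        refine Finset.card_le_card_of_injOn Prod.snd ?_ ?_
        · intro a ha
          have := mem_apSet.1 (Finset.mem_filter.1 ha).1
          simp only [Finset.coe_Icc, Set.mem_Icc]
          omega
        · intro a ha b hb h
          have ha' := (Finset.mem_filter.1 ha).2
          have hb' := (Finset.mem_filter.1 hb).2
          rw [apTerm] at ha' hb'
          rw [h] at ha'
          exact Prod.ext (by omega) h
    _ = n := by simp

theorem card_apSet_two_terms_le (n k : ℕ) {i j : ℕ} (hij : i ≠ j) (v w : ℕ) :
    ((apSet n k).filter fun a => apTerm a j = v ∧ apTerm a i = w).card ≤ 1 := by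
  rw [Finset.card_le_one]
  intro a ha b hb
  obtain ⟨_, ha1, ha2⟩ := Finset.mem_filter.1 ha
  obtain ⟨_, hb1, hb2⟩ := Finset.mem_filter.1 hb
  simp only [apTerm] at ha1 ha2 hb1 hb2
  have h2 : a.2 = b.2 := by
    have hij' : ((i : ℤ) - j) ≠ 0 := by
      rw [sub_ne_zero]
      exact_mod_cast hij
    zify at ha1 ha2 hb1 hb2 ⊢
    refine mul_left_cancel₀ hij' ?_
    linear_combination ha2 - ha1 - hb2 + hb1
  rw [h2] at ha1
  exact Prod.ext (by omega) h2

theorem apCount_eq_sum (n k : ℕ) (ω : Finset ℕ) :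
    (apCount n k ω : ℝ) = ∑ a ∈ apSet n k, if apInit a k ⊆ ω then (1 : ℝ) else 0 := by
  rw [Finset.sum_boole, apCount, apSet, Finset.filter_filter]
  congr 2
  ext a
  simp only [Finset.mem_filter, apInit_subset_iff, apTerm]

theorem expAP_eq_sum (n k : ℕ) (q : ℕ → ℝ) :
    expAP n k q = ∑ a ∈ apSet n k, ∏ i ∈ Finset.range k, q (apTerm a i) := by
  simp only [expAP, apCount_eq_sum, Finset.mul_sum]
  rw [Finset.sum_comm]
  refine Finset.sum_congr rfl fun a ha => ?_
  rw [pwI_eq_prodWeight, sum_prodWeight_subset q (apInit_subset ha le_rfl), prod_apInit ha]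

theorem expAP_const (n k : ℕ) (p : ℝ) : expAP n k (fun _ => p) = (apSet n k).card * p ^ k := by
  rw [expAP_eq_sum]
  simp

theorem le_card_apSet (hk : 1 ≤ k) (hn : 2 * k ≤ n) :
    (n : ℝ) ^ 2 / (16 * k) ≤ (apSet n k).card := by
  have h1 : Finset.Icc 1 (n / 2) ×ˢ Finset.Icc 1 (n / (2 * k)) ⊆ apSet n k := by
    intro a ha
    simp only [Finset.mem_product, Finset.mem_Icc] at ha
    obtain ⟨⟨h1, h2⟩, h3, h4⟩ := ha
    have h5 : n / (2 * k) ≤ n := Nat.div_le_self _ _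
    have h6 : (k - 1) * a.2 ≤ n / 2 := by
      rw [Nat.le_div_iff_mul_le (by omega)] at h4 ⊢
      have : (k - 1) * a.2 * 2 ≤ k * a.2 * 2 := by gcongr; omega
      linarith
    rw [mem_apSet]
    omega
  have h2 := Finset.card_le_card h1
  rw [Finset.card_product, Nat.card_Icc, Nat.card_Icc] at h2
  simp only [Nat.add_sub_cancel] at h2
  have half : ∀ m : ℕ, 1 ≤ m → m ≤ n → (n : ℝ) / (2 * m) ≤ ((n / m : ℕ) : ℝ) := by
    intro m hm hmn
    have hm0 : (0 : ℝ) < m := by exact_mod_cast hm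
    rw [div_le_iff₀ (by positivity)]
    have hq : 1 ≤ n / m := (Nat.one_le_div_iff hm).2 hmn
    have hr := Nat.div_add_mod n m
    have hlt := Nat.mod_lt n hm
    have : n ≤ n / m * (2 * m) := by nlinarith
    exact_mod_cast this
  have e1 := half 2 (by norm_num) (by omega)
  have e2 := half (2 * k) (by omega) hn
  have hk0 : (0 : ℝ) < k := by exact_mod_cast hk
  calc (n : ℝ) ^ 2 / (16 * k) = (n / (2 * (2 : ℕ))) * (n / (2 * (2 * k : ℕ))) := by
        push_cast
        field_simp
        norm_num
    _ ≤ ((n / 2 : ℕ) : ℝ) * ((n / (2 * k) : ℕ) : ℝ) := by gcongr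
    _ ≤ (apSet n k).card := by exact_mod_cast h2

theorem card_apSet_not_disjoint_le (n k : ℕ) (W : Finset ℕ) :
    ((apSet n k).filter fun a => ¬ Disjoint (apInit a k) W).card ≤ W.card * k * n := by
  have h1 : ((apSet n k).filter fun a => ¬ Disjoint (apInit a k) W) ⊆
      (W ×ˢ Finset.range k).biUnion fun x => (apSet n k).filter fun a => apTerm a x.2 = x.1 := by
    intro a ha
    obtain ⟨ha1, ha2⟩ := Finset.mem_filter.1 ha
    obtain ⟨v, hv1, hv2⟩ := Finset.not_disjoint_iff.1 ha2
    obtain ⟨i, hi, hiv⟩ := Finset.mem_image.1 hv1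
    rw [Finset.mem_biUnion]
    exact ⟨(v, i), Finset.mem_product.2 ⟨hv2, hi⟩, Finset.mem_filter.2 ⟨ha1, hiv⟩⟩
  refine (Finset.card_le_card h1).trans (Finset.card_biUnion_le.trans ?_)
  refine (Finset.sum_le_card_nsmul _ _ n fun x _ => card_apSet_term_le n k x.2 x.1).trans ?_
  rw [Finset.card_product, Finset.card_range, smul_eq_mul]

theorem sum_pow_card_union_apInit_le {j v : ℕ} {r : ℝ} (hr0 : 0 ≤ r) (hr1 : r ≤ 1) (hj : j < k)
    (hnr : 1 ≤ n * r ^ j) :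
    ∑ a ∈ (apSet n k).filter (fun a => apTerm a j = v),
      ∑ b ∈ (apSet n k).filter (fun a => apTerm a j = v), r ^ (apInit a j ∪ apInit b j).card ≤
      (1 + (k : ℝ) ^ 2) * (n * r ^ j) ^ 2 := by
  set A := (apSet n k).filter (fun a => apTerm a j = v) with hA
  have hAn : (A.card : ℝ) ≤ n := by exact_mod_cast card_apSet_term_le n k j v
  have inner : ∀ a ∈ A, ∑ b ∈ A, r ^ (apInit a j ∪ apInit b j).card ≤
      n * r ^ (2 * j) + (k : ℝ) ^ 2 * r ^ j := by
    intro a ha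
    have haS := (Finset.mem_filter.1 ha).1
    have pt : ∀ b ∈ A, r ^ (apInit a j ∪ apInit b j).card ≤
        r ^ (2 * j) + (if ¬ Disjoint (apInit a j) (apInit b j) then 1 else 0) * r ^ j := by
      intro b hb
      have hbS := (Finset.mem_filter.1 hb).1
      by_cases h : Disjoint (apInit a j) (apInit b j)
      · rw [Finset.card_union_of_disjoint h, card_apInit haS, card_apInit hbS]
        simp [h, two_mul]
      · have h1 : j ≤ (apInit a j ∪ apInit b j).card := by
          conv_lhs => rw [← card_apInit haS j]
          exact Finset.card_le_card Finset.subset_union_left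
        have h2 := pow_le_pow_of_le_one hr0 hr1 h1
        simp only [h, not_false_eq_true, if_true, one_mul]
        have := pow_nonneg hr0 (2 * j)
        linarith
    have hcount : ((A.filter fun b => ¬ Disjoint (apInit a j) (apInit b j)).card : ℝ) ≤
        (k : ℝ) ^ 2 := by
      have h1 : (A.filter fun b => ¬ Disjoint (apInit a j) (apInit b j)) ⊆
          (Finset.range j ×ˢ Finset.range j).biUnion fun x =>
            (apSet n k).filter fun b => apTerm b j = v ∧ apTerm b x.2 = apTerm a x.1 := by
        intro b hb
        obtain ⟨hb1, hb2⟩ := Finset.mem_filter.1 hb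
        obtain ⟨w, hw1, hw2⟩ := Finset.not_disjoint_iff.1 hb2
        obtain ⟨i, hi, hiw⟩ := Finset.mem_image.1 hw1
        obtain ⟨i', hi', hiw'⟩ := Finset.mem_image.1 hw2
        rw [Finset.mem_biUnion]
        exact ⟨(i, i'), Finset.mem_product.2 ⟨hi, hi'⟩, Finset.mem_filter.2
          ⟨(Finset.mem_filter.1 hb1).1, (Finset.mem_filter.1 hb1).2, hiw'.trans hiw.symm⟩⟩
      have h2 := (Finset.card_le_card h1).trans (Finset.card_biUnion_le.trans
        (Finset.sum_le_card_nsmul _ _ 1 fun x hx => card_apSet_two_terms_le n k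
          (Finset.mem_range.1 (Finset.mem_product.1 hx).2).ne v (apTerm a x.1)))
      rw [Finset.card_product, Finset.card_range, smul_eq_mul, mul_one] at h2
      have h3 : j * j ≤ k ^ 2 := by nlinarith
      exact_mod_cast h2.trans h3
    refine (Finset.sum_le_sum pt).trans ?_
    rw [Finset.sum_add_distrib, Finset.sum_const, nsmul_eq_mul, ← Finset.sum_mul,
      Finset.sum_boole]
    have := pow_nonneg hr0 (2 * j)
    have := pow_nonneg hr0 j
    gcongr
  refine (Finset.sum_le_card_nsmul _ _ _ inner).trans ?_
  rw [nsmul_eq_mul]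
  have h0 : 0 ≤ r ^ j := pow_nonneg hr0 j
  have h1 : 0 ≤ n * r ^ (2 * j) + (k : ℝ) ^ 2 * r ^ j := by positivity
  calc (A.card : ℝ) * (n * r ^ (2 * j) + (k : ℝ) ^ 2 * r ^ j)
      ≤ n * (n * r ^ (2 * j) + (k : ℝ) ^ 2 * r ^ j) := mul_le_mul_of_nonneg_right hAn h1
    _ = (n * r ^ j) ^ 2 + (k : ℝ) ^ 2 * (n * r ^ j * 1) := by ring
    _ ≤ (n * r ^ j) ^ 2 + (k : ℝ) ^ 2 * (n * r ^ j * (n * r ^ j)) := by gcongr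
    _ = _ := by ring

end

theorem prod_range_sub_prod_range (f g : ℕ → ℝ) (k : ℕ) :
    ∏ i ∈ Finset.range k, f i - ∏ i ∈ Finset.range k, g i =
      ∑ j ∈ Finset.range k, (∏ i ∈ Finset.range j, f i) * (f j - g j) *
        ∏ i ∈ Finset.Ico (j + 1) k, g i := by
  induction k with
  | zero => simp
  | succ k ih =>
    have h : ∀ j ∈ Finset.range k, (∏ i ∈ Finset.range j, f i) * (f j - g j) *
        ∏ i ∈ Finset.Ico (j + 1) (k + 1), g i = ((∏ i ∈ Finset.range j, f i) * (f j - g j) *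
        ∏ i ∈ Finset.Ico (j + 1) k, g i) * g k := by
      intro j hj
      rw [Finset.prod_Ico_succ_top (by have := Finset.mem_range.1 hj; omega)]
      ring
    rw [Finset.sum_range_succ, Finset.sum_congr rfl h, ← Finset.sum_mul, ← ih,
      Finset.prod_range_succ, Finset.prod_range_succ, Finset.Ico_self, Finset.prod_empty]
    ring

theorem weighted_cauchy_schwarz {ι : Type*} (s : Finset ι) {c : ι → ℝ} (hc : ∀ i ∈ s, 0 ≤ c i)
    (f g : ι → ℝ) :
    (∑ i ∈ s, c i * (f i * g i)) ^ 2 ≤ (∑ i ∈ s, c i * f i ^ 2) * ∑ i ∈ s, c i * g i ^ 2 := by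
  have h := Finset.sum_mul_sq_le_sq_mul_sq s (fun i => √(c i) * f i) (fun i => √(c i) * g i)
  have e1 : ∑ i ∈ s, √(c i) * f i * (√(c i) * g i) = ∑ i ∈ s, c i * (f i * g i) :=
    Finset.sum_congr rfl fun i hi => by
      conv_rhs => rw [← Real.mul_self_sqrt (hc i hi)]
      ring
  have e2 : ∀ f : ι → ℝ, ∑ i ∈ s, (√(c i) * f i) ^ 2 = ∑ i ∈ s, c i * f i ^ 2 := fun f =>
    Finset.sum_congr rfl fun i hi => by rw [mul_pow, Real.sq_sqrt (hc i hi)]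
  rwa [e1, e2, e2] at h

theorem sum_sum_comm_sum_sum {α β γ δ : Type*} (s : Finset α) (t : Finset β) (u : Finset γ)
    (w : Finset δ) (f : α → β → γ → δ → ℝ) :
    ∑ x ∈ s, ∑ y ∈ t, ∑ a ∈ u, ∑ b ∈ w, f x y a b =
      ∑ a ∈ u, ∑ b ∈ w, ∑ x ∈ s, ∑ y ∈ t, f x y a b := by
  rw [Finset.sum_congr rfl fun x _ => Finset.sum_comm, Finset.sum_comm]
  refine Finset.sum_congr rfl fun a _ => ?_
  rw [Finset.sum_congr rfl fun x _ => Finset.sum_comm, Finset.sum_comm]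

section
variable {n k : ℕ} {p : ℝ} {E : Finset ℕ → Prop} {W : Finset ℕ}

/-- The weighted correlation between the event that the first `j` terms of `a` are present and
the deviation of its `j`-th term from its conditional marginal. -/
def apCorrelation (n k : ℕ) (p : ℝ) (E : Finset ℕ → Prop) (W : Finset ℕ) (h : Finset ℕ → ℝ)
    (j : ℕ) (a : ℕ × ℕ) : ℝ :=
  ∑ ω ∈ (Finset.Icc 1 n).powerset, restrictedWeight (Finset.Icc 1 n) p E ω *
    (h ω * ((∏ i ∈ Finset.range j, if apTerm a i ∈ ω then (1 : ℝ) else 0) *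
      ((if apTerm a j ∈ ω then (1 : ℝ) else 0) -
        condMarginal (Finset.Icc 1 n) p E W (apTerm a j) ω) *
      ∏ i ∈ Finset.Ico (j + 1) k, condMarginal (Finset.Icc 1 n) p E W (apTerm a i) ω))

theorem prod_ite_apTerm_mem (a : ℕ × ℕ) (j : ℕ) (ω : Finset ℕ) :
    (∏ i ∈ Finset.range j, if apTerm a i ∈ ω then (1 : ℝ) else 0) =
      if apInit a j ⊆ ω then 1 else 0 := by
  split_ifs with h
  · exact Finset.prod_eq_one fun i hi => by rw [if_pos (apInit_subset_iff.1 h i hi)]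
  · rw [apInit_subset_iff] at h
    push Not at h
    obtain ⟨i, hi, hi'⟩ := h
    exact Finset.prod_eq_zero hi (by rw [if_neg hi'])

theorem abs_apCorrelation_le (hp0 : 0 ≤ p) (hp1 : p ≤ 1)
    (hE : ∀ ω ω', ω ⊆ ω' → E ω' → E ω) {h : Finset ℕ → ℝ} (hh : DependsOnInter W h)
    (hh1 : ∀ ω, |h ω| ≤ 1) {j : ℕ} {a : ℕ × ℕ} (ha : a ∈ apSet n k)
    (haW : Disjoint (apInit a k) W) {U : Finset ℕ} (hU : apInit a j ⊆ U) :
    |apCorrelation n k p E W h j a| ≤ p ^ (k - 1 - j) *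
      ∑ ω ∈ (Finset.Icc 1 n).powerset, restrictedWeight (Finset.Icc 1 n) p E ω *
        ((if apInit a j ⊆ ω then 1 else 0) *
          |condMarginal (Finset.Icc 1 n) p E (W ∪ U) (apTerm a j) ω -
            condMarginal (Finset.Icc 1 n) p E W (apTerm a j) ω|) := by
  have hμ0 : ∀ ω ∈ (Finset.Icc 1 n).powerset, 0 ≤ restrictedWeight (Finset.Icc 1 n) p E ω :=
    restrictedWeight_nonneg hp0 hp1
  set μ := restrictedWeight (Finset.Icc 1 n) p E with hμ
  set q := condMarginal (Finset.Icc 1 n) p E with hq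
  have hqdep : ∀ W v, DependsOnInter W (q W v) := fun W v => dependsOnInter_condExpInter _ _ _ _
  set g : Finset ℕ → ℝ := fun ω => h ω *
    (∏ i ∈ Finset.range j, if apTerm a i ∈ ω then (1 : ℝ) else 0) *
      ∏ i ∈ Finset.Ico (j + 1) k, q W (apTerm a i) ω with hg
  have hgdep : DependsOnInter (W ∪ U) g := by
    refine ((hh.mono Finset.subset_union_left).mul ?_).mul ?_
    · exact DependsOnInter.prod fun i hi => dependsOnInter_mem
        (Finset.mem_union_right _ (apInit_subset_iff.1 hU i hi))
    · exact DependsOnInter.prod fun i _ => (hqdep W _).mono Finset.subset_union_left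
  have c1 := sum_condExpInter_mul hμ0 (W ∪ U)
    (fun ω => if apTerm a j ∈ ω then (1 : ℝ) else 0) hgdep
  have e1 : apCorrelation n k p E W h j a = ∑ ω ∈ (Finset.Icc 1 n).powerset, μ ω *
      ((q (W ∪ U) (apTerm a j) ω - q W (apTerm a j) ω) * g ω) := by
    rw [apCorrelation]
    have s1 : ∀ ω ∈ (Finset.Icc 1 n).powerset, μ ω *
        ((q (W ∪ U) (apTerm a j) ω - q W (apTerm a j) ω) * g ω) =
        μ ω * (q (W ∪ U) (apTerm a j) ω * g ω) - μ ω * (q W (apTerm a j) ω * g ω) := by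
      intro ω _
      ring
    rw [Finset.sum_congr rfl s1, Finset.sum_sub_distrib]
    have c1' : ∑ ω ∈ (Finset.Icc 1 n).powerset, μ ω * (q (W ∪ U) (apTerm a j) ω * g ω) =
      ∑ ω ∈ (Finset.Icc 1 n).powerset, μ ω * ((if apTerm a j ∈ ω then (1 : ℝ) else 0) * g ω) := c1
    rw [c1', ← Finset.sum_sub_distrib]
    refine Finset.sum_congr rfl fun ω _ => ?_
    simp only [hg]
    ring
  have hgle : ∀ ω, |g ω| ≤ p ^ (k - 1 - j) * (if apInit a j ⊆ ω then 1 else 0) := by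
    intro ω
    simp only [hg]
    rw [prod_ite_apTerm_mem, abs_mul, abs_mul]
    have i1 : |if apInit a j ⊆ ω then (1 : ℝ) else 0| = if apInit a j ⊆ ω then 1 else 0 := by
      split_ifs <;> simp
    have i2 : |∏ i ∈ Finset.Ico (j + 1) k, q W (apTerm a i) ω| ≤ p ^ (k - 1 - j) := by
      rw [Finset.abs_prod]
      have : k - 1 - j = (Finset.Ico (j + 1) k).card := by
        rw [Nat.card_Ico]
        omega
      rw [this, ← Finset.prod_const]
      refine Finset.prod_le_prod (fun _ _ => abs_nonneg _) fun i hi => ?_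
      have hik := (Finset.mem_Ico.1 hi).2
      rw [abs_of_nonneg (condMarginal_nonneg hp0 hp1 _ _ _)]
      refine condMarginal_le hp0 hp1 hE (apTerm_mem ha hik) ?_ ω
      exact Finset.disjoint_left.1 haW (Finset.mem_image_of_mem _ (Finset.mem_range.2 hik))
    rw [i1]
    have i3 : (0 : ℝ) ≤ if apInit a j ⊆ ω then 1 else 0 := by split_ifs <;> norm_num
    calc |h ω| * (if apInit a j ⊆ ω then (1 : ℝ) else 0) *
          |∏ i ∈ Finset.Ico (j + 1) k, q W (apTerm a i) ω|
        ≤ 1 * (if apInit a j ⊆ ω then (1 : ℝ) else 0) * p ^ (k - 1 - j) := by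
          gcongr
          exact hh1 ω
      _ = _ := by ring
  rw [e1, Finset.mul_sum]
  refine (Finset.abs_sum_le_sum_abs _ _).trans (Finset.sum_le_sum fun ω hω => ?_)
  rw [abs_mul, abs_mul, abs_of_nonneg (hμ0 ω hω)]
  have := mul_le_mul_of_nonneg_left (mul_le_mul_of_nonneg_left (hgle ω)
    (abs_nonneg (q (W ∪ U) (apTerm a j) ω - q W (apTerm a j) ω))) (hμ0 ω hω)
  refine this.trans (le_of_eq ?_)
  ring

/-- The second moment of the number of progressions whose `j`-th term is `v` and whose first
`j` terms lie in both a `δ`-random set and the conditioned random set. -/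
theorem sum_sq_card_le (hp0 : 0 ≤ p) (hp1 : p ≤ 1) (hE : ∀ ω ω', ω ⊆ ω' → E ω' → E ω)
    {δ : ℝ} (hδ0 : 0 ≤ δ) (hδ1 : δ ≤ 1) {j v : ℕ} (hj : j < k) (hn : 1 ≤ n * (δ * p) ^ j) :
    ∑ U ∈ (Finset.Icc 1 n).powerset, ∑ ω ∈ (Finset.Icc 1 n).powerset,
      prodWeight (Finset.Icc 1 n) (fun _ => δ) U * restrictedWeight (Finset.Icc 1 n) p E ω *
        (∑ a ∈ (apSet n k).filter (fun a => apTerm a j = v),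
          (if apInit a j ⊆ U then 1 else 0) * (if apInit a j ⊆ ω then 1 else 0)) ^ 2 ≤
      (1 + (k : ℝ) ^ 2) * (n * (δ * p) ^ j) ^ 2 *
        ∑ ω ∈ (Finset.Icc 1 n).powerset, restrictedWeight (Finset.Icc 1 n) p E ω := by
  set V := Finset.Icc 1 n with hV
  set μ := restrictedWeight V p E with hμ
  set w := prodWeight V (fun _ => δ) with hw
  set A := (apSet n k).filter (fun a => apTerm a j = v) with hA
  have hAV : ∀ a ∈ A, apInit a j ⊆ V := fun a ha =>
    apInit_subset (Finset.mem_filter.1 ha).1 hj.le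
  have e1 : ∀ U ω : Finset ℕ, w U * μ ω * (∑ a ∈ A,
      (if apInit a j ⊆ U then (1 : ℝ) else 0) * (if apInit a j ⊆ ω then 1 else 0)) ^ 2 =
      ∑ a ∈ A, ∑ b ∈ A, (w U * (if apInit a j ∪ apInit b j ⊆ U then 1 else 0)) *
        (μ ω * (if apInit a j ∪ apInit b j ⊆ ω then 1 else 0)) := by
    intro U ω
    rw [sq, Finset.sum_mul_sum, Finset.mul_sum]
    refine Finset.sum_congr rfl fun a _ => ?_
    rw [Finset.mul_sum]
    refine Finset.sum_congr rfl fun b _ => ?_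
    by_cases h1 : apInit a j ⊆ U <;> by_cases h2 : apInit b j ⊆ U <;>
      by_cases h3 : apInit a j ⊆ ω <;> by_cases h4 : apInit b j ⊆ ω <;>
      simp [Finset.union_subset_iff, h1, h2, h3, h4]
  calc _ = ∑ a ∈ A, ∑ b ∈ A,
        (∑ U ∈ V.powerset, w U * (if apInit a j ∪ apInit b j ⊆ U then 1 else 0)) *
        ∑ ω ∈ V.powerset, μ ω * (if apInit a j ∪ apInit b j ⊆ ω then 1 else 0) := by
        simp only [e1, Finset.sum_mul_sum]
        exact sum_sum_comm_sum_sum _ _ _ _ _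
    _ ≤ ∑ a ∈ A, ∑ b ∈ A, (δ * p) ^ (apInit a j ∪ apInit b j).card * ∑ ω ∈ V.powerset, μ ω := by
        refine Finset.sum_le_sum fun a ha => Finset.sum_le_sum fun b hb => ?_
        have hS := Finset.union_subset (hAV a ha) (hAV b hb)
        rw [sum_prodWeight_subset _ hS, Finset.prod_const, mul_pow, mul_assoc]
        exact mul_le_mul_of_nonneg_left (sum_restrictedWeight_subset_le hp0 hp1 hE hS)
          (pow_nonneg hδ0 _)
    _ = (∑ a ∈ A, ∑ b ∈ A, (δ * p) ^ (apInit a j ∪ apInit b j).card) *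
          ∑ ω ∈ V.powerset, μ ω := by
        simp only [Finset.sum_mul]
    _ ≤ _ := by
        refine mul_le_mul_of_nonneg_right ?_
          (Finset.sum_nonneg (restrictedWeight_nonneg hp0 hp1))
        exact sum_pow_card_union_apInit_le (mul_nonneg hδ0 hp0) (mul_le_one₀ hδ1 hp0 hp1) hj hn

end

section
variable {n k : ℕ} {p : ℝ} {E : Finset ℕ → Prop} {W : Finset ℕ}

theorem sum_prodWeight_mul_card {V : Finset ℕ} (δ : ℝ) :
    ∑ U ∈ V.powerset, prodWeight V (fun _ => δ) U * (U.card : ℝ) = V.card * δ := by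
  have e : ∀ U ∈ V.powerset, prodWeight V (fun _ => δ) U * (U.card : ℝ) =
      ∑ v ∈ V, prodWeight V (fun _ => δ) U * (if {v} ⊆ U then 1 else 0) := by
    intro U hU
    rw [← Finset.mul_sum, Finset.sum_boole]
    simp only [Finset.singleton_subset_iff]
    rw [Finset.filter_mem_eq_inter, Finset.inter_eq_right.2 (Finset.mem_powerset.1 hU)]
  rw [Finset.sum_congr rfl e, Finset.sum_comm]
  rw [Finset.sum_congr rfl fun v hv =>
    sum_prodWeight_subset (fun _ => δ) (Finset.singleton_subset_iff.2 hv)]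
  simp

theorem le_two_mul_of_mul_one_sub_mul_le {δ x y κ N P Z : ℝ} (hδ1 : δ ≤ 1 / 2) (hx : 0 < x)
    (hy : 0 ≤ y) (h : x * (1 - δ) * y ≤ κ * x * N * P * Z) : y ≤ 2 * κ * N * P * Z := by
  have h2 : x * ((1 - δ) * y) ≤ x * (κ * N * P * Z) := by linarith
  have h3 := le_of_mul_le_mul_left h2 hx
  nlinarith

set_option maxHeartbeats 1000000 in
theorem sum_abs_apCorrelation_le (hp0 : 0 < p) (hp1 : p ≤ 1)
    (hE : ∀ ω ω', ω ⊆ ω' → E ω' → E ω) {h : Finset ℕ → ℝ} (hh : DependsOnInter W h)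
    (hh1 : ∀ ω, |h ω| ≤ 1) {lam δ κ : ℝ} (hδ0 : 0 < δ) (hδ1 : δ ≤ 1 / 2)
    (hκ0 : 0 ≤ κ) (hκ : (1 + (k : ℝ) ^ 2) * (1 + lam) * δ ≤ κ ^ 2)
    (hW : ∀ U ⊆ Finset.Icc 1 n,
      ∑ v ∈ Finset.Icc 1 n \ (W ∪ U), ∑ ω ∈ (Finset.Icc 1 n).powerset,
        restrictedWeight (Finset.Icc 1 n) p E ω *
        (condMarginal (Finset.Icc 1 n) p E (W ∪ U) v ω -
          condMarginal (Finset.Icc 1 n) p E W v ω) ^ 2 ≤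
      (1 + lam) * p ^ 2 *
        (∑ ω ∈ (Finset.Icc 1 n).powerset, restrictedWeight (Finset.Icc 1 n) p E ω) * U.card)
    {j : ℕ} (hj : j < k) (hn : 1 ≤ n * (δ * p) ^ j) :
    ∑ a ∈ (apSet n k).filter (fun a => Disjoint (apInit a k) W), |apCorrelation n k p E W h j a| ≤
      2 * κ * n ^ 2 * p ^ k *
        ∑ ω ∈ (Finset.Icc 1 n).powerset, restrictedWeight (Finset.Icc 1 n) p E ω := by
  have hμ0 : ∀ ω ∈ (Finset.Icc 1 n).powerset, 0 ≤ restrictedWeight (Finset.Icc 1 n) p E ω :=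
    restrictedWeight_nonneg hp0.le hp1
  have hw0 : ∀ U ∈ (Finset.Icc 1 n).powerset, 0 ≤ prodWeight (Finset.Icc 1 n) (fun _ => δ) U :=
    fun U hU => prodWeight_nonneg (fun _ _ => ⟨hδ0.le, by linarith⟩) (Finset.mem_powerset.1 hU)
  have hsm := fun v => sum_sq_card_le (n := n) (k := k) (v := v) hp0.le hp1 hE hδ0.le
    (by linarith) hj hn
  have hcorr := fun a (ha : a ∈ apSet n k) (haW : Disjoint (apInit a k) W) U hU =>
    abs_apCorrelation_le hp0.le hp1 hE hh hh1 (j := j) ha haW (U := U) hU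
  have hcard : ((Finset.Icc 1 n).card : ℝ) = n := by simp
  have hmemV := fun a (ha : a ∈ apSet n k) => apTerm_mem ha hj
  have hsubV := fun a (ha : a ∈ apSet n k) => apInit_subset ha hj.le
  set V := Finset.Icc 1 n with hV
  set μ := restrictedWeight V p E with hμ
  set w := prodWeight V (fun _ => δ) with hw
  set q := condMarginal V p E with hq
  set Z := ∑ ω ∈ V.powerset, μ ω with hZ
  set T := apCorrelation n k p E W h j with hT
  have hZ0 : 0 ≤ Z := Finset.sum_nonneg hμ0
  set D : Finset ℕ → Finset ℕ → ℕ → ℝ := fun U ω v =>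
    if v ∈ U then 0 else |q (W ∪ U) v ω - q W v ω| with hD
  have hD0 : ∀ U ω v, 0 ≤ D U ω v := by
    intro U ω v
    simp only [hD]
    split_ifs
    · exact le_rfl
    · exact abs_nonneg _
  set I : ℕ × ℕ → Finset ℕ → Finset ℕ → ℝ := fun a U ω =>
    (if apInit a j ⊆ U then 1 else 0) * (if apInit a j ⊆ ω then 1 else 0) with hI
  have hI0 : ∀ a U ω, 0 ≤ I a U ω := fun a U ω =>
    mul_nonneg (by split_ifs <;> norm_num) (by split_ifs <;> norm_num)
  set G : ℕ × ℕ → ℕ → ℝ := fun a v => ∑ U ∈ V.powerset, ∑ ω ∈ V.powerset,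
    w U * μ ω * (I a U ω * D U ω v) with hG
  have hG0 : ∀ a v, 0 ≤ G a v := fun a v => Finset.sum_nonneg fun U hU =>
    Finset.sum_nonneg fun ω hω => mul_nonneg (mul_nonneg (hw0 U hU) (hμ0 ω hω))
      (mul_nonneg (hI0 a U ω) (hD0 U ω v))
  have step1 : ∀ a ∈ apSet n k, Disjoint (apInit a k) W →
      δ ^ j * (1 - δ) * |T a| ≤ p ^ (k - 1 - j) * G a (apTerm a j) := by
    intro a ha haW
    have hdisj : Disjoint (apInit a j) {apTerm a j} := by
      rw [Finset.disjoint_singleton_right]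
      intro hmem
      obtain ⟨i, hi, hij⟩ := Finset.mem_image.1 hmem
      have := apTerm_injective ha hij
      have := Finset.mem_range.1 hi
      omega
    have hprob := sum_prodWeight_subset_disjoint (fun _ => δ) (hsubV a ha)
      (Finset.singleton_subset_iff.2 (hmemV a ha)) hdisj
    rw [Finset.prod_const, card_apInit ha, Finset.prod_singleton] at hprob
    rw [← hprob, Finset.sum_mul, hG, Finset.mul_sum]
    refine Finset.sum_le_sum fun U hU => ?_
    by_cases hc : apInit a j ⊆ U ∧ Disjoint {apTerm a j} U
    · have hnot : apTerm a j ∉ U := Finset.disjoint_singleton_left.1 hc.2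
      rw [if_pos hc, mul_one]
      refine (mul_le_mul_of_nonneg_left (hcorr a ha haW U hc.1) (hw0 U hU)).trans (le_of_eq ?_)
      rw [mul_left_comm, Finset.mul_sum]
      congr 1
      refine Finset.sum_congr rfl fun ω _ => ?_
      simp only [hI, hD, if_pos hc.1, if_neg hnot]
      ring
    · rw [if_neg hc, mul_zero, zero_mul]
      exact mul_nonneg (pow_nonneg hp0.le _) (Finset.sum_nonneg fun ω hω =>
        mul_nonneg (mul_nonneg (hw0 U hU) (hμ0 ω hω)) (mul_nonneg (hI0 a U ω) (hD0 U ω _)))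
  set N : Finset ℕ → Finset ℕ → ℕ → ℝ := fun U ω v =>
    ∑ a ∈ (apSet n k).filter (fun a => apTerm a j = v), I a U ω with hN
  set S := V.powerset ×ˢ V.powerset ×ˢ (V \ W) with hS
  set X := ∑ x ∈ S, w x.1 * μ x.2.1 * (N x.1 x.2.1 x.2.2 * D x.1 x.2.1 x.2.2) with hX
  have step2 : ∑ a ∈ (apSet n k).filter (fun a => Disjoint (apInit a k) W), G a (apTerm a j) ≤
      X := by
    have hmaps : ∀ a ∈ (apSet n k).filter (fun a => Disjoint (apInit a k) W),
        apTerm a j ∈ V \ W := by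
      intro a ha
      obtain ⟨ha1, ha2⟩ := Finset.mem_filter.1 ha
      exact Finset.mem_sdiff.2 ⟨hmemV a ha1, Finset.disjoint_left.1 ha2
        (Finset.mem_image_of_mem _ (Finset.mem_range.2 hj))⟩
    rw [← Finset.sum_fiberwise_of_maps_to hmaps]
    calc _ ≤ ∑ v ∈ V \ W, ∑ a ∈ (apSet n k).filter (fun a => apTerm a j = v), G a v := by
          refine Finset.sum_le_sum fun v _ => ?_
          calc _ = ∑ a ∈ ((apSet n k).filter (fun a => Disjoint (apInit a k) W)).filter
                (fun a => apTerm a j = v), G a v :=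
                Finset.sum_congr rfl fun a ha => by rw [(Finset.mem_filter.1 ha).2]
            _ ≤ _ := Finset.sum_le_sum_of_subset_of_nonneg
                (Finset.filter_subset_filter _ (Finset.filter_subset _ _)) fun a _ _ => hG0 a v
      _ = X := by
          rw [hX, hS, Finset.sum_product, Finset.sum_congr rfl fun U _ => Finset.sum_product _ _ _,
            Finset.sum_congr rfl fun U _ => Finset.sum_comm, Finset.sum_comm]
          refine Finset.sum_congr rfl fun v _ => ?_
          simp only [hN, Finset.sum_mul, Finset.mul_sum]
          rw [Finset.sum_comm]
          refine Finset.sum_congr rfl fun U _ => ?_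
          rw [Finset.sum_comm]
  have hX0 : 0 ≤ X := Finset.sum_nonneg fun x hx => by
    simp only [hS, Finset.mem_product] at hx
    exact mul_nonneg (mul_nonneg (hw0 _ hx.1) (hμ0 _ hx.2.1))
      (mul_nonneg (Finset.sum_nonneg fun a _ => hI0 a _ _) (hD0 _ _ _))
  have hcs := weighted_cauchy_schwarz S (c := fun x => w x.1 * μ x.2.1) (fun x hx => by
    simp only [hS, Finset.mem_product] at hx
    exact mul_nonneg (hw0 _ hx.1) (hμ0 _ hx.2.1)) (fun x => N x.1 x.2.1 x.2.2)
    (fun x => D x.1 x.2.1 x.2.2)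
  have b1 : ∑ x ∈ S, w x.1 * μ x.2.1 * N x.1 x.2.1 x.2.2 ^ 2 ≤
      n * ((1 + (k : ℝ) ^ 2) * (n * (δ * p) ^ j) ^ 2 * Z) := by
    rw [hS, Finset.sum_product, Finset.sum_congr rfl fun U _ => Finset.sum_product _ _ _,
      Finset.sum_congr rfl fun U _ => Finset.sum_comm, Finset.sum_comm]
    refine (Finset.sum_le_card_nsmul _ _ _ fun v _ => hsm v).trans ?_
    rw [nsmul_eq_mul]
    refine mul_le_mul_of_nonneg_right ?_ (by positivity)
    rw [← hcard]
    exact_mod_cast Finset.card_le_card Finset.sdiff_subset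
  have b2 : ∑ x ∈ S, w x.1 * μ x.2.1 * D x.1 x.2.1 x.2.2 ^ 2 ≤
      (1 + lam) * p ^ 2 * Z * (n * δ) := by
    rw [hS, Finset.sum_product, ← hcard, ← sum_prodWeight_mul_card, Finset.mul_sum]
    refine Finset.sum_le_sum fun U hU => ?_
    rw [Finset.sum_product, Finset.sum_comm]
    have hsub : V \ (W ∪ U) ⊆ V \ W := Finset.sdiff_subset_sdiff le_rfl Finset.subset_union_left
    rw [← Finset.sum_subset hsub]
    · have := mul_le_mul_of_nonneg_left (hW U (Finset.mem_powerset.1 hU)) (hw0 U hU)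
      refine le_trans (le_of_eq ?_) (this.trans (le_of_eq ?_))
      · rw [Finset.mul_sum]
        refine Finset.sum_congr rfl fun v hv => ?_
        rw [Finset.mul_sum]
        refine Finset.sum_congr rfl fun ω _ => ?_
        have : v ∉ U := fun h => (Finset.mem_sdiff.1 hv).2 (Finset.mem_union_right _ h)
        simp only [hD, if_neg this, sq_abs]
        ring
      · ring
    · intro v hv hv'
      have : v ∈ U := by
        simp only [Finset.mem_sdiff, Finset.mem_union] at hv hv'
        tauto
      refine Finset.sum_eq_zero fun ω _ => ?_
      simp [hD, this]
  have hpk : p ^ (k - 1 - j) * p ^ j * p = p ^ k := by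
    rw [← pow_add, ← pow_succ]
    congr 1
    omega
  have hXle : p ^ (k - 1 - j) * X ≤ κ * δ ^ j * n ^ 2 * p ^ k * Z := by
    refine le_of_sq_le_sq ?_ (by positivity)
    have b2' : 0 ≤ ∑ x ∈ S, w x.1 * μ x.2.1 * D x.1 x.2.1 x.2.2 ^ 2 :=
      Finset.sum_nonneg fun x hx => by
        simp only [hS, Finset.mem_product] at hx
        exact mul_nonneg (mul_nonneg (hw0 _ hx.1) (hμ0 _ hx.2.1)) (sq_nonneg _)
    calc (p ^ (k - 1 - j) * X) ^ 2 = (p ^ (k - 1 - j)) ^ 2 * X ^ 2 := by ring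
      _ ≤ (p ^ (k - 1 - j)) ^ 2 * (n * ((1 + (k : ℝ) ^ 2) * (n * (δ * p) ^ j) ^ 2 * Z) *
          ((1 + lam) * p ^ 2 * Z * (n * δ))) := by
          refine mul_le_mul_of_nonneg_left (hcs.trans ?_) (by positivity)
          exact mul_le_mul b1 b2 b2' (by positivity)
      _ = ((1 + (k : ℝ) ^ 2) * (1 + lam) * δ) *
          (δ ^ j * n ^ 2 * (p ^ (k - 1 - j) * p ^ j * p) * Z) ^ 2 := by
          rw [mul_pow δ p j]
          ring
      _ ≤ κ ^ 2 * (δ ^ j * n ^ 2 * (p ^ (k - 1 - j) * p ^ j * p) * Z) ^ 2 :=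
          mul_le_mul_of_nonneg_right hκ (sq_nonneg _)
      _ = _ := by
          rw [hpk]
          ring
  have hfin : δ ^ j * (1 - δ) * ∑ a ∈ (apSet n k).filter (fun a => Disjoint (apInit a k) W),
      |T a| ≤ κ * δ ^ j * n ^ 2 * p ^ k * Z := by
    refine le_trans ?_ hXle
    refine le_trans ?_ (mul_le_mul_of_nonneg_left step2 (pow_nonneg hp0.le _))
    rw [Finset.mul_sum, Finset.mul_sum]
    exact Finset.sum_le_sum fun a ha =>
      step1 a (Finset.mem_filter.1 ha).1 (Finset.mem_filter.1 ha).2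
  exact le_two_mul_of_mul_one_sub_mul_le hδ1 (pow_pos hδ0 j)
    (Finset.sum_nonneg fun a _ => abs_nonneg _) hfin

/-- For typical traces on `W`, the product measure given by the conditional marginals has few
progressions outside `W`, compared with the conditioned random set itself. -/
theorem sum_mul_prod_condMarginal_sub_le (hp0 : 0 < p) (hp1 : p ≤ 1)
    (hE : ∀ ω ω', ω ⊆ ω' → E ω' → E ω) {h : Finset ℕ → ℝ} (hh : DependsOnInter W h)
    (hh1 : ∀ ω, |h ω| ≤ 1) {lam δ κ : ℝ} (hδ0 : 0 < δ) (hδ1 : δ ≤ 1 / 2)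
    (hκ0 : 0 ≤ κ) (hκ : (1 + (k : ℝ) ^ 2) * (1 + lam) * δ ≤ κ ^ 2)
    (hW : ∀ U ⊆ Finset.Icc 1 n,
      ∑ v ∈ Finset.Icc 1 n \ (W ∪ U), ∑ ω ∈ (Finset.Icc 1 n).powerset,
        restrictedWeight (Finset.Icc 1 n) p E ω *
        (condMarginal (Finset.Icc 1 n) p E (W ∪ U) v ω -
          condMarginal (Finset.Icc 1 n) p E W v ω) ^ 2 ≤
      (1 + lam) * p ^ 2 *
        (∑ ω ∈ (Finset.Icc 1 n).powerset, restrictedWeight (Finset.Icc 1 n) p E ω) * U.card)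
    (hn : 1 ≤ n * (δ * p) ^ (k - 1)) :
    ∑ ω ∈ (Finset.Icc 1 n).powerset, restrictedWeight (Finset.Icc 1 n) p E ω * (h ω *
      (∑ a ∈ (apSet n k).filter (fun a => Disjoint (apInit a k) W),
        ∏ i ∈ Finset.range k, condMarginal (Finset.Icc 1 n) p E W (apTerm a i) ω -
      ∑ a ∈ (apSet n k).filter (fun a => Disjoint (apInit a k) W),
        if apInit a k ⊆ ω then (1 : ℝ) else 0)) ≤
      k * (2 * κ * n ^ 2 * p ^ k *
        ∑ ω ∈ (Finset.Icc 1 n).powerset, restrictedWeight (Finset.Icc 1 n) p E ω) := by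
  have key : ∀ j ∈ Finset.range k, ∑ a ∈ (apSet n k).filter (fun a => Disjoint (apInit a k) W),
      -apCorrelation n k p E W h j a ≤ 2 * κ * n ^ 2 * p ^ k *
        ∑ ω ∈ (Finset.Icc 1 n).powerset, restrictedWeight (Finset.Icc 1 n) p E ω := by
    intro j hj
    rw [Finset.mem_range] at hj
    refine le_trans (Finset.sum_le_sum fun a _ => neg_le_abs _)
      (sum_abs_apCorrelation_le hp0 hp1 hE hh hh1 hδ0 hδ1 hκ0 hκ hW hj (hn.trans ?_))
    refine mul_le_mul_of_nonneg_left ?_ (Nat.cast_nonneg n)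
    exact pow_le_pow_of_le_one (by positivity) (mul_le_one₀ (by linarith) hp0.le hp1) (by omega)
  have hsum := Finset.sum_le_card_nsmul _ _ _ key
  rw [Finset.card_range, nsmul_eq_mul] at hsum
  refine le_trans (le_of_eq ?_) hsum
  rw [Finset.sum_comm, Finset.sum_congr rfl fun a _ => Finset.sum_neg_distrib _]
  simp only [apCorrelation]
  rw [Finset.sum_congr rfl fun a _ => congrArg Neg.neg Finset.sum_comm]
  simp only [← Finset.sum_neg_distrib]
  rw [Finset.sum_comm]
  refine Finset.sum_congr rfl fun ω _ => ?_
  rw [← Finset.sum_sub_distrib, Finset.mul_sum, Finset.mul_sum]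
  refine Finset.sum_congr rfl fun a _ => ?_
  rw [← prod_ite_apTerm_mem, ← neg_sub, prod_range_sub_prod_range, Finset.sum_neg_distrib]
  simp only [Finset.mul_sum, mul_neg]

end

theorem sub_le_mul_log_div {p q : ℝ} (hp : 0 < p) (hq : 0 ≤ q) : q - p ≤ q * Real.log (q / p) := by
  rcases hq.eq_or_lt with rfl | hq
  · simpa using hp.le
  · have h := Real.one_sub_inv_le_log_of_pos (div_pos hq hp)
    have h2 := mul_le_mul_of_nonneg_left h hq.le
    rw [inv_div] at h2
    have e : q * (1 - p / q) = q - p := by field_simp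
    linarith

theorem ip_nonneg {p q : ℝ} (hp0 : 0 < p) (hp1 : p < 1) (hq : q ∈ Set.Icc (0 : ℝ) 1) :
    0 ≤ ip p q := by
  have h1 := sub_le_mul_log_div hp0 hq.1
  have h2 := sub_le_mul_log_div (p := 1 - p) (q := 1 - q) (by linarith) (by linarith [hq.2])
  rw [ip]
  linarith

theorem ip_self (p : ℝ) : ip p p = 0 := by
  have : ∀ x : ℝ, Real.log (x / x) = 0 := by
    intro x
    rcases eq_or_ne x 0 with rfl | hx
    · simp
    · simp [div_self hx]
  simp [ip, this]

section
variable {n k : ℕ} {p η : ℝ}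

theorem sum_ip_nonneg (hp0 : 0 < p) (hp1 : p < 1) {q : ℕ → ℝ}
    (hq : ∀ i ∈ Finset.Icc 1 n, q i ∈ Set.Icc (0 : ℝ) 1) :
    0 ≤ ∑ i ∈ Finset.Icc 1 n, ip p (q i) :=
  Finset.sum_nonneg fun i hi => ip_nonneg hp0 hp1 (hq i hi)

theorem PhiAP_le (hp0 : 0 < p) (hp1 : p < 1) {q : ℕ → ℝ}
    (hq : ∀ i ∈ Finset.Icc 1 n, q i ∈ Set.Icc (0 : ℝ) 1)
    (hA : expAP n k q ≤ η * expAP n k (fun _ => p)) :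
    PhiAP n k p η ≤ ∑ i ∈ Finset.Icc 1 n, ip p (q i) :=
  csInf_le ⟨0, by
    rintro x ⟨q, hq, -, rfl⟩
    exact sum_ip_nonneg hp0 hp1 hq⟩ ⟨q, hq, hA, rfl⟩

theorem PhiAP_nonneg (hp0 : 0 < p) (hp1 : p < 1) : 0 ≤ PhiAP n k p η := by
  refine Real.sInf_nonneg ?_
  rintro x ⟨q, hq, -, rfl⟩
  exact sum_ip_nonneg hp0 hp1 hq

theorem apCount_mono {ω ω' : Finset ℕ} (h : ω ⊆ ω') : apCount n k ω ≤ apCount n k ω' :=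
  Finset.card_le_card fun a ha => by
    rw [Finset.mem_filter] at ha ⊢
    exact ⟨ha.1, ha.2.1, fun i hi => h (ha.2.2 i hi)⟩

theorem apCount_empty (hk : 1 ≤ k) : apCount n k ∅ = 0 := by
  rw [apCount, Finset.card_eq_zero, Finset.filter_eq_empty_iff]
  rintro a - ⟨-, h⟩
  exact Finset.notMem_empty _ (h 0 (Finset.mem_range.2 hk))

theorem expAP_const_nonneg (hp0 : 0 ≤ p) : 0 ≤ expAP n k (fun _ => p) := by
  rw [expAP_const]
  positivity

theorem PrAP_eq_sum_restrictedWeight :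
    PrAP n k p η = ∑ ω ∈ (Finset.Icc 1 n).powerset, restrictedWeight (Finset.Icc 1 n) p
      (fun ω => (apCount n k ω : ℝ) ≤ η * expAP n k (fun _ => p)) ω := by
  simp only [PrAP, restrictedWeight, pwI_eq_prodWeight, mul_ite, mul_one, mul_zero]

theorem PrAP_pos (hk : 1 ≤ k) (hp0 : 0 < p) (hp1 : p < 1) (hη : 0 ≤ η) : 0 < PrAP n k p η := by
  rw [PrAP_eq_sum_restrictedWeight]
  refine lt_of_lt_of_le ?_ (Finset.single_le_sum (restrictedWeight_nonneg hp0.le hp1.le)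
    (Finset.empty_mem_powerset _))
  rw [restrictedWeight, if_pos]
  · have : 0 < 1 - p := by linarith
    rw [prodWeight]
    simp only [Finset.prod_const, Finset.card_empty, pow_zero, one_mul, mul_one]
    positivity
  · rw [apCount_empty hk, Nat.cast_zero]
    exact mul_nonneg hη (expAP_const_nonneg hp0.le)

theorem le_expAP_const (hk : 1 ≤ k) (hn : 2 * k ≤ n) (hp0 : 0 ≤ p) :
    n ^ 2 * p ^ k / (16 * k) ≤ expAP n k (fun _ => p) := by
  rw [expAP_const]
  have := mul_le_mul_of_nonneg_right (le_card_apSet hk hn) (pow_nonneg hp0 k)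
  refine le_trans (le_of_eq ?_) this
  ring

theorem expAP_ite_mem_le {W : Finset ℕ} {q : ℕ → ℝ} (hp0 : 0 ≤ p)
    (hq : ∀ v ∈ Finset.Icc 1 n, v ∉ W → q v ∈ Set.Icc 0 p) :
    expAP n k (fun v => if v ∈ W then p else q v) ≤
      ∑ a ∈ (apSet n k).filter (fun a => Disjoint (apInit a k) W),
        ∏ i ∈ Finset.range k, q (apTerm a i) + W.card * k * n * p ^ k := by
  rw [expAP_eq_sum, ← Finset.sum_filter_add_sum_filter_not _ (fun a => Disjoint (apInit a k) W)]
  refine add_le_add (le_of_eq ?_) ?_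
  · refine Finset.sum_congr rfl fun a ha => Finset.prod_congr rfl fun i hi => ?_
    rw [if_neg]
    exact Finset.disjoint_left.1 (Finset.mem_filter.1 ha).2 (Finset.mem_image_of_mem _ hi)
  · refine (Finset.sum_le_card_nsmul _ _ (p ^ k) fun a ha => ?_).trans ?_
    · have hmem : ∀ i ∈ Finset.range k,
          (if apTerm a i ∈ W then p else q (apTerm a i)) ∈ Set.Icc 0 p := by
        intro i hi
        split_ifs with h
        · exact ⟨hp0, le_rfl⟩
        · exact hq _ (apTerm_mem (Finset.mem_filter.1 ha).1 (Finset.mem_range.1 hi)) h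
      refine (Finset.prod_le_prod (fun i hi => (hmem i hi).1) fun i hi => (hmem i hi).2).trans ?_
      simp
    · rw [nsmul_eq_mul]
      refine mul_le_mul_of_nonneg_right ?_ (pow_nonneg hp0 k)
      exact_mod_cast card_apSet_not_disjoint_le n k W

theorem one_sub_mul_PhiAP_le (hk : 2 ≤ k) (hp0 : 0 < p) (hp1 : p < 1) {ε δ : ℝ} (hε0 : 0 < ε)
    (hη : 0 ≤ η) (hδ0 : 0 < δ) (hδ1 : δ ≤ 1 / 2)
    (hδ : (1 + (k : ℝ) ^ 2) * (1 + 32 * k ^ 2 / ε) * δ ≤ (ε ^ 2 / (64 * k ^ 2)) ^ 2)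
    (hn : 2 * k ≤ n) (hnp : 1 ≤ n * (δ * p) ^ (k - 1)) :
    (1 - ε) * PhiAP n k p (η + ε) ≤ - Real.log (PrAP n k p η) := by
  have hk0 : (0 : ℝ) < k := by exact_mod_cast (by omega : 0 < k)
  have hn0 : (0 : ℝ) < n := by exact_mod_cast (by omega : 0 < n)
  have hm := le_expAP_const (p := p) (by omega : 1 ≤ k) hn hp0.le
  have hZpos := PrAP_pos (n := n) (k := k) (by omega) hp0 hp1 hη
  have hm0 := expAP_const_nonneg (n := n) (k := k) hp0.le
  have hΦ0 := PhiAP_nonneg (n := n) (k := k) (η := η + ε) hp0 hp1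
  have hΦ := fun q => PhiAP_le (n := n) (k := k) (η := η + ε) (q := q) hp0 hp1
  rw [PrAP_eq_sum_restrictedWeight] at hZpos ⊢
  set m := expAP n k (fun _ => p) with hmdef
  set Φ := PhiAP n k p (η + ε) with hΦdef
  set E : Finset ℕ → Prop := fun ω => (apCount n k ω : ℝ) ≤ η * m with hEdef
  have hE : ∀ ω ω', ω ⊆ ω' → E ω' → E ω := fun ω ω' h h' =>
    le_trans (by exact_mod_cast apCount_mono h) h'
  obtain ⟨W, hWV, hWcard, hW⟩ := exists_small_increment (lam := 32 * k ^ 2 / ε) hp0 hp1.le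
    (by positivity) hE hZpos
  set V := Finset.Icc 1 n with hV
  have hVcard : (V.card : ℝ) = n := by simp [hV]
  set F : Finset ℕ → ℝ := fun ω => ∑ a ∈ (apSet n k).filter (fun a => Disjoint (apInit a k) W),
    ∏ i ∈ Finset.range k, condMarginal V p E W (apTerm a i) ω with hF
  set h : Finset ℕ → ℝ := fun ω => if (η + ε / 2) * m < F ω then 1 else 0 with hh
  have hdep : DependsOnInter W h := by
    have hFdep : DependsOnInter W F := fun ω ω' e =>
      Finset.sum_congr rfl fun a _ => Finset.prod_congr rfl fun i _ =>
        dependsOnInter_condExpInter _ _ _ _ ω ω' e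
    exact hFdep.comp fun x => if (η + ε / 2) * m < x then 1 else 0
  have hh0 : ∀ ω, 0 ≤ h ω := fun ω => by
    simp only [hh]
    split_ifs <;> norm_num
  have hkey := sum_mul_prod_condMarginal_sub_le hp0 hp1.le hE hdep
    (fun ω => by simp only [hh]; split_ifs <;> simp) hδ0 hδ1 (by positivity) hδ hW hnp
  have hent := sum_ip_condMarginal_le hp0 hp1 hE hWV hZpos
  have hμ0 := restrictedWeight_nonneg (V := V) (E := E) hp0.le hp1.le
  have hq0 := condMarginal_nonneg (V := V) (E := E) hp0.le hp1.le W
  have hqp := fun v (hv : v ∈ V) (hvW : v ∉ W) => condMarginal_le hp0.le hp1.le hE hv hvW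
  have hμE : ∀ ω, ¬ E ω → restrictedWeight V p E ω = 0 := fun ω hω => by
    rw [restrictedWeight, if_neg hω, mul_zero]
  set μ := restrictedWeight V p E with hμ
  set Z := ∑ ω ∈ V.powerset, μ ω with hZ
  set q := condMarginal V p E W with hq
  have hbad : ε / 2 * m * ∑ ω ∈ V.powerset, μ ω * h ω ≤
      k * (2 * (ε ^ 2 / (64 * k ^ 2)) * n ^ 2 * p ^ k * Z) := by
    refine le_trans ?_ hkey
    rw [Finset.mul_sum]
    refine Finset.sum_le_sum fun ω hω => ?_
    by_cases hω' : E ω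
    · have hcount : ∑ a ∈ (apSet n k).filter (fun a => Disjoint (apInit a k) W),
          (if apInit a k ⊆ ω then (1 : ℝ) else 0) ≤ η * m := by
        refine le_trans ?_ hω'
        rw [apCount_eq_sum]
        exact Finset.sum_le_sum_of_subset_of_nonneg (Finset.filter_subset _ _) fun a _ _ => by
          split_ifs <;> norm_num
      rw [mul_left_comm]
      refine mul_le_mul_of_nonneg_left ?_ (hμ0 ω hω)
      rw [mul_comm]
      by_cases hb : (η + ε / 2) * m < F ω
      · refine mul_le_mul_of_nonneg_left ?_ (hh0 ω)
        have : (η + ε / 2) * m < ∑ a ∈ (apSet n k).filter (fun a => Disjoint (apInit a k) W),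
          ∏ i ∈ Finset.range k, q (apTerm a i) ω := hb
        linarith
      · simp only [hh, if_neg hb, zero_mul, le_refl]
    · rw [hμE ω hω', zero_mul, mul_zero, zero_mul]
  set B := ∑ ω ∈ V.powerset, μ ω * h ω with hB
  have hB0 : 0 ≤ B := Finset.sum_nonneg fun ω hω => mul_nonneg (hμ0 ω hω) (hh0 ω)
  have hN : 0 < (n : ℝ) ^ 2 * p ^ k := by positivity
  have hBZ : B ≤ ε * Z := by
    have h1 : ε / 2 * (n ^ 2 * p ^ k / (16 * k)) * B ≤
        k * (2 * (ε ^ 2 / (64 * k ^ 2)) * n ^ 2 * p ^ k * Z) :=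
      le_trans (by gcongr) hbad
    have e1 : ε / 2 * (n ^ 2 * p ^ k / (16 * k)) * B = ε * (n ^ 2 * p ^ k) / (32 * k) * B := by
      ring
    have e2 : k * (2 * (ε ^ 2 / (64 * k ^ 2)) * n ^ 2 * p ^ k * Z) =
        ε * (n ^ 2 * p ^ k) / (32 * k) * (ε * Z) := by
      field_simp
      ring
    rw [e1, e2] at h1
    exact le_of_mul_le_mul_left h1 (by positivity)
  have hgood : ∀ ω, ¬ (η + ε / 2) * m < F ω → Φ ≤ ∑ v ∈ V \ W, ip p (q v ω) := by
    intro ω hω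
    have hA : expAP n k (fun v => if v ∈ W then p else q v ω) ≤ (η + ε) * m := by
      refine (expAP_ite_mem_le hp0.le fun v hv hvW => ⟨hq0 v ω, hqp v hv hvW ω⟩).trans ?_
      have h1 : (W.card : ℝ) * k * n * p ^ k ≤ ε / 2 * m := by
        rw [hVcard] at hWcard
        refine le_trans ?_ (mul_le_mul_of_nonneg_left hm (by positivity))
        have h2 := mul_le_mul_of_nonneg_right hWcard
          (by positivity : 0 ≤ ε / (32 * k) * (n * p ^ k))
        refine (le_of_eq ?_).trans (h2.trans (le_of_eq ?_))
        · field_simp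
        · ring
      have h2 := not_lt.1 hω
      simp only [hF] at h2
      linarith
    refine (hΦ _ (fun v hv => ?_) hA).trans (le_of_eq ?_)
    · split_ifs with hvW
      · exact ⟨hp0.le, hp1.le⟩
      · exact ⟨hq0 v ω, (hqp v hv hvW ω).trans hp1.le⟩
    · rw [← Finset.sum_sdiff hWV, Finset.sum_congr rfl fun v hv => by
        rw [if_neg (Finset.mem_sdiff.1 hv).2], add_eq_left]
      exact Finset.sum_eq_zero fun v hv => by rw [if_pos hv, ip_self]
  have hlow : (Z - B) * Φ ≤ ∑ ω ∈ V.powerset, μ ω * ∑ v ∈ V \ W, ip p (q v ω) := by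
    rw [hZ, hB, ← Finset.sum_sub_distrib, Finset.sum_mul]
    refine Finset.sum_le_sum fun ω hω => ?_
    rw [← mul_one_sub, mul_assoc]
    refine mul_le_mul_of_nonneg_left ?_ (hμ0 ω hω)
    by_cases hb : (η + ε / 2) * m < F ω
    · simp only [hh, if_pos hb, sub_self, zero_mul]
      exact Finset.sum_nonneg fun v hv => ip_nonneg hp0 hp1
        ⟨hq0 v ω, (hqp v (Finset.mem_sdiff.1 hv).1 (Finset.mem_sdiff.1 hv).2 ω).trans hp1.le⟩
    · simp only [hh, if_neg hb, sub_zero, one_mul]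
      exact hgood ω hb
  have hfin : Z * ((1 - ε) * Φ) ≤ Z * -Real.log Z := by
    refine le_trans ?_ (hlow.trans hent)
    have := mul_le_mul_of_nonneg_right (by linarith : Z - ε * Z ≤ Z - B) hΦ0
    linarith
  exact le_of_mul_le_mul_left hfin hZpos

end

theorem two_mul_le_mul_log_div {p q : ℝ} (hp : 0 < p) (hq : 0 ≤ q) :
    2 * (q - √p * √q) ≤ q * Real.log (q / p) := by
  rcases hq.eq_or_lt with rfl | hq
  · simp
  · have h := Real.one_sub_inv_le_log_of_pos (Real.sqrt_pos.2 (div_pos hq hp))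
    rw [Real.log_sqrt (div_pos hq hp).le] at h
    have h2 := mul_le_mul_of_nonneg_left h (by positivity : 0 ≤ 2 * q)
    have e : 2 * q * (1 - (√(q / p))⁻¹) = 2 * (q - √p * √q) := by
      rw [Real.sqrt_div hq.le, inv_div]
      have h3 : 0 < √q := Real.sqrt_pos.2 hq
      field_simp
      have := Real.mul_self_sqrt hq.le
      linear_combination (√p) * this
    linarith

theorem sq_sub_le_ip {p q : ℝ} (hp1 : p < 1) (hp0 : 0 < p) (hq0 : 0 ≤ q) (hqp : q ≤ p) :
    (p - q) ^ 2 ≤ 4 * p * ip p q := by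
  have h1 := two_mul_le_mul_log_div hp0 hq0
  have h2 := sub_le_mul_log_div (p := 1 - p) (q := 1 - q) (by linarith) (by linarith)
  have h3 : (√p - √q) ^ 2 ≤ ip p q := by
    have e1 := Real.sq_sqrt hp0.le
    have e2 := Real.sq_sqrt hq0
    rw [ip]
    linarith
  have h4 : (√p + √q) ^ 2 ≤ 4 * p := by
    have e1 := Real.sq_sqrt hp0.le
    have := pow_le_pow_left₀ (by positivity) (add_le_add_right (Real.sqrt_le_sqrt hqp) √p) 2
    linarith
  calc (p - q) ^ 2 = (√p + √q) ^ 2 * (√p - √q) ^ 2 := by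
        have e1 := Real.sq_sqrt hp0.le
        have e2 := Real.sq_sqrt hq0
        rw [← mul_pow, ← sq_sub_sq, e1, e2]
    _ ≤ _ := mul_le_mul h4 h3 (sq_nonneg _) (by linarith)

theorem log_sq_le {R : ℝ} (hR : 1 ≤ R) : R * Real.log R ^ 2 ≤ 4 * (R - 1) ^ 2 := by
  have hR0 : 0 < R := by linarith
  have h1 := Real.log_le_sub_one_of_pos (Real.sqrt_pos.2 hR0)
  rw [Real.log_sqrt hR0.le] at h1
  have h2 := Real.log_nonneg hR
  have h3 := pow_le_pow_left₀ h2 (by linarith : Real.log R ≤ 2 * (√R - 1)) 2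
  have hs := Real.sq_sqrt hR0.le
  have hs1 : 1 ≤ √R := Real.one_le_sqrt.2 hR
  calc R * Real.log R ^ 2 ≤ R * (2 * (√R - 1)) ^ 2 := mul_le_mul_of_nonneg_left h3 hR0.le
    _ = 4 * (√R * (√R - 1)) ^ 2 := by
        rw [mul_pow √R, hs]
        ring
    _ ≤ 4 * ((√R + 1) * (√R - 1)) ^ 2 := by
        have : 0 ≤ √R - 1 := by linarith
        gcongr
        linarith
    _ = _ := by rw [← sq_sub_sq, hs, one_pow]

theorem mul_sq_log_sub_log_le {p q : ℝ} (hp1 : p < 1) (hp0 : 0 < p) (hq0 : 0 ≤ q) (hqp : q ≤ p) :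
    (1 - p) * (q * (1 - q) * (Real.log (q / p) - Real.log ((1 - q) / (1 - p))) ^ 2) ≤
      16 * ip p q := by
  have hip := sq_sub_le_ip hp1 hp0 hq0 hqp
  rcases hq0.eq_or_lt with rfl | hq0
  · simp only [zero_mul, mul_zero]
    nlinarith
  have hp' : 0 < 1 - p := by linarith
  have hq' : 0 < 1 - q := by linarith
  set R := p * (1 - q) / (q * (1 - p)) with hR
  have e1 : Real.log (q / p) - Real.log ((1 - q) / (1 - p)) = - Real.log R := by
    rw [hR, Real.log_div hq0.ne' hp0.ne', Real.log_div hq'.ne' hp'.ne',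
      Real.log_div (by positivity) (by positivity), Real.log_mul hp0.ne' hq'.ne',
      Real.log_mul hq0.ne' hp'.ne']
    ring
  have hR1 : 1 ≤ R := by
    rw [hR, le_div_iff₀ (by positivity)]
    linarith
  have h := log_sq_le hR1
  have e2 : R - 1 = (p - q) / (q * (1 - p)) := by
    rw [hR]
    field_simp
    ring
  rw [e2, div_pow, hR, ← mul_div_assoc, div_mul_eq_mul_div, div_le_div_iff₀ (by positivity)
    (by positivity), ← hR] at h
  rw [e1, neg_sq]
  refine le_of_mul_le_mul_left ?_ hp0
  refine le_trans (b := 4 * (p - q) ^ 2) ?_ (by linarith)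
  refine le_of_mul_le_mul_left ?_ (by positivity : 0 < q * (1 - p))
  linarith

section
variable {V : Finset ℕ} {q : ℕ → ℝ}

theorem sum_prodWeight_mul_mem {v : ℕ} (hv : v ∈ V) :
    ∑ ω ∈ V.powerset, prodWeight V q ω * (if v ∈ ω then 1 else 0) = q v := by
  have := sum_prodWeight_subset q (Finset.singleton_subset_iff.2 hv)
  simpa using this

theorem sum_prodWeight_mul_mem_mul_mem {v w : ℕ} (hv : v ∈ V) (hw : w ∈ V) (hvw : v ≠ w) :
    ∑ ω ∈ V.powerset, prodWeight V q ω * ((if v ∈ ω then 1 else 0) * (if w ∈ ω then 1 else 0)) =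
      q v * q w := by
  have := sum_prodWeight_subset q (S := {v, w}) (Finset.insert_subset hv
    (Finset.singleton_subset_iff.2 hw))
  rw [Finset.prod_pair hvw] at this
  rw [← this]
  refine Finset.sum_congr rfl fun ω _ => ?_
  simp only [Finset.insert_subset_iff, Finset.singleton_subset_iff, ite_and, ite_mul, one_mul,
    zero_mul]

theorem sum_prodWeight_mul_sub_mul_sub {v w : ℕ} (hv : v ∈ V) (hw : w ∈ V) :
    ∑ ω ∈ V.powerset, prodWeight V q ω *
      (((if v ∈ ω then 1 else 0) - q v) * ((if w ∈ ω then 1 else 0) - q w)) =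
      if v = w then q v * (1 - q v) else 0 := by
  have e : ∀ ω, prodWeight V q ω *
      (((if v ∈ ω then 1 else 0) - q v) * ((if w ∈ ω then 1 else 0) - q w)) =
      prodWeight V q ω * ((if v ∈ ω then 1 else 0) * (if w ∈ ω then 1 else 0)) -
      q w * (prodWeight V q ω * (if v ∈ ω then 1 else 0)) -
      q v * (prodWeight V q ω * (if w ∈ ω then 1 else 0)) + q v * q w * prodWeight V q ω :=
    fun ω => by ring
  rw [Finset.sum_congr rfl fun ω _ => e ω, Finset.sum_add_distrib, Finset.sum_sub_distrib,
    Finset.sum_sub_distrib, ← Finset.mul_sum, ← Finset.mul_sum, ← Finset.mul_sum,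
    sum_prodWeight_mul_mem hv, sum_prodWeight_mul_mem hw, sum_prodWeight]
  split_ifs with h
  · subst h
    have : ∀ ω : Finset ℕ, ((if v ∈ ω then 1 else 0) * (if v ∈ ω then 1 else 0) : ℝ) =
        if v ∈ ω then 1 else 0 := fun ω => by split_ifs <;> simp
    simp only [this]
    rw [sum_prodWeight_mul_mem hv]
    ring
  · rw [sum_prodWeight_mul_mem_mul_mem hv hw h]
    ring

theorem sum_prodWeight_mul_sq (u : ℕ → ℝ) :
    ∑ ω ∈ V.powerset, prodWeight V q ω *
      (∑ v ∈ V, ((if v ∈ ω then 1 else 0) - q v) * u v) ^ 2 =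
      ∑ v ∈ V, q v * (1 - q v) * u v ^ 2 := by
  have e : ∀ ω, prodWeight V q ω * (∑ v ∈ V, ((if v ∈ ω then 1 else 0) - q v) * u v) ^ 2 =
      ∑ v ∈ V, ∑ w ∈ V, u v * u w * (prodWeight V q ω *
      (((if v ∈ ω then 1 else 0) - q v) * ((if w ∈ ω then 1 else 0) - q w))) := fun ω => by
    rw [sq, Finset.sum_mul_sum, Finset.mul_sum]
    refine Finset.sum_congr rfl fun v _ => ?_
    rw [Finset.mul_sum]
    exact Finset.sum_congr rfl fun w _ => by ring
  rw [Finset.sum_congr rfl fun ω _ => e ω, Finset.sum_comm]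
  refine Finset.sum_congr rfl fun v hv => ?_
  rw [Finset.sum_comm, Finset.sum_congr rfl fun w hw => by
    rw [← Finset.mul_sum, sum_prodWeight_mul_sub_mul_sub hv hw]]
  simp only [mul_ite, mul_zero, Finset.sum_ite_eq, if_pos hv]
  ring

/-- The logarithm of the likelihood ratio of the product measures given by `q` and `p`. -/
def logLikelihood (V : Finset ℕ) (p : ℝ) (q : ℕ → ℝ) (ω : Finset ℕ) : ℝ :=
  ∑ v ∈ ω, Real.log (q v / p) + ∑ v ∈ V \ ω, Real.log ((1 - q v) / (1 - p))

theorem mul_exp_neg_log_div_le {p q : ℝ} (hp : 0 < p) (hq : 0 ≤ q) :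
    q * Real.exp (- Real.log (q / p)) ≤ p := by
  rcases hq.eq_or_lt with rfl | hq
  · simpa using hp.le
  · rw [Real.exp_neg, Real.exp_log (div_pos hq hp), inv_div]
    field_simp
    exact le_rfl

theorem prodWeight_mul_exp_neg_le {p : ℝ} (hp0 : 0 < p) (hp1 : p < 1)
    (hq : ∀ i ∈ V, q i ∈ Set.Icc (0 : ℝ) 1) {ω : Finset ℕ} (hω : ω ⊆ V) :
    prodWeight V q ω * Real.exp (- logLikelihood V p q ω) ≤ prodWeight V (fun _ => p) ω := by
  rw [logLikelihood, neg_add, Real.exp_add, ← Finset.sum_neg_distrib, ← Finset.sum_neg_distrib,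
    Real.exp_sum, Real.exp_sum, prodWeight, prodWeight, mul_mul_mul_comm,
    ← Finset.prod_mul_distrib, ← Finset.prod_mul_distrib]
  have h1 : ∀ v ∈ V, 0 ≤ 1 - q v := fun v hv => by linarith [(hq v hv).2]
  refine mul_le_mul (Finset.prod_le_prod (fun v hv => ?_) fun v hv => ?_)
    (Finset.prod_le_prod (fun v hv => ?_) fun v hv => ?_)
    (Finset.prod_nonneg fun v hv => ?_) (Finset.prod_nonneg fun _ _ => hp0.le)
  · exact mul_nonneg (hq v (hω hv)).1 (Real.exp_pos _).le
  · exact mul_exp_neg_log_div_le hp0 (hq v (hω hv)).1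
  · exact mul_nonneg (h1 v (Finset.mem_sdiff.1 hv).1) (Real.exp_pos _).le
  · exact mul_exp_neg_log_div_le (by linarith) (h1 v (Finset.mem_sdiff.1 hv).1)
  · exact mul_nonneg (h1 v (Finset.mem_sdiff.1 hv).1) (Real.exp_pos _).le

theorem logLikelihood_sub_sum_ip (p : ℝ) {ω : Finset ℕ} (hω : ω ⊆ V) :
    logLikelihood V p q ω - ∑ v ∈ V, ip p (q v) =
      ∑ v ∈ V, ((if v ∈ ω then 1 else 0) - q v) *
        (Real.log (q v / p) - Real.log ((1 - q v) / (1 - p))) := by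
  have e : logLikelihood V p q ω = ∑ v ∈ V,
      if v ∈ ω then Real.log (q v / p) else Real.log ((1 - q v) / (1 - p)) := by
    rw [logLikelihood, ← Finset.sum_sdiff hω, add_comm]
    congr 1
    · exact Finset.sum_congr rfl fun v hv => by rw [if_neg (Finset.mem_sdiff.1 hv).2]
    · exact Finset.sum_congr rfl fun v hv => by rw [if_pos hv]
  rw [e, ← Finset.sum_sub_distrib]
  refine Finset.sum_congr rfl fun v _ => ?_
  rw [ip]
  split_ifs <;> ring

/-- A change of measure bound: if `E` is not too unlikely under the product measure given by `q`,
its probability is controlled by the relative entropy. -/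
theorem neg_log_sum_restrictedWeight_le {p ε : ℝ} (hp0 : 0 < p) (hp1 : p < 1)
    (hq : ∀ i ∈ V, q i ∈ Set.Icc (0 : ℝ) p) (hε0 : 0 < ε) (hε1 : ε ≤ 1)
    (hD : 128 / ((1 - p) * ε ^ 3) ≤ ∑ v ∈ V, ip p (q v)) {E : Finset ℕ → Prop} {M : Finset ℕ → ℝ}
    (hM0 : ∀ ω, 0 ≤ M ω) (hM1 : ∀ ω, ¬ E ω → 1 ≤ M ω)
    (hM : ∑ ω ∈ V.powerset, prodWeight V q ω * M ω ≤ 1 - ε)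
    (hZ : 0 < ∑ ω ∈ V.powerset, restrictedWeight V p E ω) :
    - Real.log (∑ ω ∈ V.powerset, restrictedWeight V p E ω) ≤ (1 + ε) * ∑ v ∈ V, ip p (q v) := by
  have hp' : 0 < 1 - p := by linarith
  have hq1 : ∀ i ∈ V, q i ∈ Set.Icc (0 : ℝ) 1 := fun i hi => ⟨(hq i hi).1, (hq i hi).2.trans hp1.le⟩
  have hD0 : 0 < ∑ v ∈ V, ip p (q v) := lt_of_lt_of_le (by positivity) hD
  have hvar : (1 - p) * ∑ ω ∈ V.powerset, prodWeight V q ω *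
      (logLikelihood V p q ω - ∑ v ∈ V, ip p (q v)) ^ 2 ≤ 16 * ∑ v ∈ V, ip p (q v) := by
    rw [Finset.sum_congr rfl fun ω hω => by
      rw [logLikelihood_sub_sum_ip p (Finset.mem_powerset.1 hω)], sum_prodWeight_mul_sq,
      Finset.mul_sum, Finset.mul_sum]
    exact Finset.sum_le_sum fun v hv =>
      mul_sq_log_sub_log_le hp1 hp0 (hq v hv).1 (hq v hv).2
  have hZ0 := restrictedWeight_nonneg (V := V) (E := E) hp0.le hp1.le
  have hchange := fun ω hω => prodWeight_mul_exp_neg_le (ω := ω) hp0 hp1 hq1 hω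
  have hQ0 := fun ω hω => prodWeight_nonneg (ω := ω) hq1 hω
  have hQ1 := sum_prodWeight V q
  set D := ∑ v ∈ V, ip p (q v) with hDdef
  set Q := prodWeight V q with hQ
  set ℓ := logLikelihood V p q with hℓ
  have hpt : ∀ ω ∈ V.powerset, Q ω * (1 - M ω - (ℓ ω - D) ^ 2 / (ε / 2 * D) ^ 2) ≤
      Real.exp ((1 + ε / 2) * D) * restrictedWeight V p E ω := by
    intro ω hω
    have hωV := Finset.mem_powerset.1 hω
    have hr : 0 ≤ Real.exp ((1 + ε / 2) * D) * restrictedWeight V p E ω :=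
      mul_nonneg (Real.exp_pos _).le (hZ0 ω hω)
    have hs0 : 0 ≤ (ℓ ω - D) ^ 2 / (ε / 2 * D) ^ 2 := by positivity
    by_cases hE : E ω
    · by_cases hl : ℓ ω ≤ (1 + ε / 2) * D
      · calc _ ≤ Q ω * 1 := mul_le_mul_of_nonneg_left (by linarith [hM0 ω]) (hQ0 ω hωV)
          _ = Real.exp (ℓ ω) * (Q ω * Real.exp (-ℓ ω)) := by
              rw [mul_left_comm, ← Real.exp_add, add_neg_cancel, Real.exp_zero]
          _ ≤ Real.exp ((1 + ε / 2) * D) * prodWeight V (fun _ => p) ω :=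
              mul_le_mul (Real.exp_le_exp.2 hl) (hchange ω hωV)
                (mul_nonneg (hQ0 ω hωV) (Real.exp_pos _).le) (Real.exp_pos _).le
          _ = _ := by rw [restrictedWeight, if_pos hE, mul_one]
      · refine le_trans (mul_nonpos_of_nonneg_of_nonpos (hQ0 ω hωV) ?_) hr
        have : 1 ≤ (ℓ ω - D) ^ 2 / (ε / 2 * D) ^ 2 := by
          rw [one_le_div (by positivity)]
          exact pow_le_pow_left₀ (by positivity) (by linarith) 2
        linarith [hM0 ω]
    · refine le_trans (mul_nonpos_of_nonneg_of_nonpos (hQ0 ω hωV) ?_) hr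
      linarith [hM1 ω hE]
  have hsum := Finset.sum_le_sum hpt
  rw [← Finset.mul_sum] at hsum
  simp only [mul_sub, mul_one, Finset.sum_sub_distrib, ← mul_div_assoc] at hsum
  rw [hQ1, ← Finset.sum_div] at hsum
  set Z := ∑ ω ∈ V.powerset, restrictedWeight V p E ω with hZdef
  set S := ∑ ω ∈ V.powerset, Q ω * (ℓ ω - D) ^ 2 with hS
  have hDε : 128 ≤ (1 - p) * ε ^ 3 * D := by
    rw [div_le_iff₀ (by positivity)] at hD
    linarith
  have hS2 : S / (ε / 2 * D) ^ 2 ≤ ε / 2 := by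
    rw [div_le_iff₀ (by positivity)]
    refine le_of_mul_le_mul_left (hvar.trans ?_) hp'
    have := mul_le_mul_of_nonneg_right hDε hD0.le
    linarith
  have hmain : ε / 2 ≤ Real.exp ((1 + ε / 2) * D) * Z := by linarith
  have hlog := Real.log_le_log (by positivity) hmain
  rw [Real.log_mul (Real.exp_pos _).ne' hZ.ne', Real.log_exp] at hlog
  have hinv := Real.one_sub_inv_le_log_of_pos (by positivity : 0 < ε / 2)
  have h2 : (ε / 2)⁻¹ ≤ ε / 2 * D := by
    rw [inv_le_iff_one_le_mul₀ (by positivity)]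
    have h3 : (1 - p) * ε ^ 3 * D ≤ 1 * ε ^ 2 * D := by
      refine mul_le_mul_of_nonneg_right ?_ hD0.le
      refine mul_le_mul (by linarith) ?_ (by positivity) zero_le_one
      exact pow_le_pow_of_le_one hε0.le hε1 (by norm_num)
    linarith
  linarith

end

section
variable {n k : ℕ} {p : ℝ} {q : ℕ → ℝ}

theorem expAP_const_sub_expAP_le (hp0 : 0 ≤ p)
    (hq : ∀ i ∈ Finset.Icc 1 n, q i ∈ Set.Icc (0 : ℝ) p) :
    expAP n k (fun _ => p) - expAP n k q ≤
      k * (n * (p ^ (k - 1) * ∑ v ∈ Finset.Icc 1 n, (p - q v))) := by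
  rw [expAP_eq_sum, expAP_eq_sum, ← Finset.sum_sub_distrib,
    Finset.sum_congr rfl fun a _ => prod_range_sub_prod_range _ _ _, Finset.sum_comm]
  refine (Finset.sum_le_card_nsmul _ _ _ fun j hj => ?_).trans
    (le_of_eq (by rw [nsmul_eq_mul, Finset.card_range]))
  have hjk := Finset.mem_range.1 hj
  have hterm : ∀ a ∈ apSet n k, (∏ i ∈ Finset.range j, p) * (p - q (apTerm a j)) *
      ∏ i ∈ Finset.Ico (j + 1) k, q (apTerm a i) ≤ p ^ (k - 1) * (p - q (apTerm a j)) := by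
    intro a ha
    have hmem : ∀ i < k, q (apTerm a i) ∈ Set.Icc 0 p := fun i hi => hq _ (apTerm_mem ha hi)
    have h1 : ∏ i ∈ Finset.Ico (j + 1) k, q (apTerm a i) ≤ p ^ (k - (j + 1)) := by
      refine (Finset.prod_le_prod (fun i hi => (hmem i (Finset.mem_Ico.1 hi).2).1)
        fun i hi => (hmem i (Finset.mem_Ico.1 hi).2).2).trans ?_
      simp
    have h2 : 0 ≤ p - q (apTerm a j) := by linarith [(hmem j hjk).2]
    rw [Finset.prod_const, Finset.card_range]
    calc _ ≤ p ^ j * (p - q (apTerm a j)) * p ^ (k - (j + 1)) :=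
          mul_le_mul_of_nonneg_left h1 (by positivity)
      _ = p ^ (j + (k - (j + 1))) * (p - q (apTerm a j)) := by
          rw [pow_add]
          ring
      _ = _ := by
          congr 2
          omega
  refine (Finset.sum_le_sum hterm).trans ?_
  rw [← Finset.mul_sum, mul_left_comm]
  refine mul_le_mul_of_nonneg_left ?_ (pow_nonneg hp0 _)
  rw [← Finset.sum_fiberwise_of_maps_to (fun a ha => apTerm_mem ha hjk), Finset.mul_sum]
  refine Finset.sum_le_sum fun v hv => ?_
  rw [Finset.sum_congr rfl fun a ha => by rw [(Finset.mem_filter.1 ha).2], Finset.sum_const,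
    nsmul_eq_mul]
  exact mul_le_mul_of_nonneg_right (by exact_mod_cast card_apSet_term_le n k j v)
    (by linarith [(hq v hv).2])

theorem le_sum_ip (hk : 1 ≤ k) (hn : 2 * k ≤ n) (hp0 : 0 < p) (hp1 : p < 1) {ε : ℝ} (hε0 : 0 < ε)
    (hq : ∀ i ∈ Finset.Icc 1 n, q i ∈ Set.Icc (0 : ℝ) p)
    (hA : expAP n k q ≤ (1 - ε) * expAP n k (fun _ => p)) :
    ε ^ 2 * (n * p) / (1024 * k ^ 4) ≤ ∑ v ∈ Finset.Icc 1 n, ip p (q v) := by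
  have hk0 : (0 : ℝ) < k := by exact_mod_cast hk
  have hn0 : (0 : ℝ) < n := by exact_mod_cast (by omega : 0 < n)
  have hcard : ((Finset.Icc 1 n).card : ℝ) = n := by simp
  have h1 := expAP_const_sub_expAP_le (k := k) hp0.le hq
  have h2 := mul_le_mul_of_nonneg_left (le_expAP_const hk hn hp0.le) hε0.le
  set S := ∑ v ∈ Finset.Icc 1 n, (p - q v) with hS
  have hS1 : ε * (n * p) / (16 * k ^ 2) ≤ S := by
    have hpk : p ^ k = p ^ (k - 1) * p := by
      rw [← pow_succ]
      congr 1
      omega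
    have hpos : 0 < k * (n * p ^ (k - 1)) := by positivity
    refine le_of_mul_le_mul_left ?_ hpos
    have h3 : ε * (n ^ 2 * p ^ k / (16 * k)) ≤ k * (n * (p ^ (k - 1) * S)) := by linarith
    refine (le_of_eq ?_).trans (h3.trans (le_of_eq ?_))
    · rw [hpk]
      field_simp
    · ring
  have hS2 : S ^ 2 ≤ n * ∑ v ∈ Finset.Icc 1 n, (p - q v) ^ 2 := by
    rw [← hcard]
    exact sq_sum_le_card_mul_sum_sq
  have hS3 : ∑ v ∈ Finset.Icc 1 n, (p - q v) ^ 2 ≤ 4 * p * ∑ v ∈ Finset.Icc 1 n, ip p (q v) := by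
    rw [Finset.mul_sum]
    exact Finset.sum_le_sum fun v hv => sq_sub_le_ip hp1 hp0 (hq v hv).1 (hq v hv).2
  have hS4 := pow_le_pow_left₀ (by positivity) hS1 2
  have hS5 := hS4.trans (hS2.trans (mul_le_mul_of_nonneg_left hS3 hn0.le))
  refine le_of_mul_le_mul_left ?_ (by positivity : 0 < 4 * (n * p))
  refine (le_of_eq ?_).trans (hS5.trans (le_of_eq ?_))
  · field_simp
    norm_num
  · ring

theorem expAP_mono {r : ℕ → ℝ} (h0 : ∀ i ∈ Finset.Icc 1 n, 0 ≤ q i)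
    (h : ∀ i ∈ Finset.Icc 1 n, q i ≤ r i) : expAP n k q ≤ expAP n k r := by
  rw [expAP_eq_sum, expAP_eq_sum]
  exact Finset.sum_le_sum fun a ha => Finset.prod_le_prod
    (fun i hi => h0 _ (apTerm_mem ha (Finset.mem_range.1 hi)))
    fun i hi => h _ (apTerm_mem ha (Finset.mem_range.1 hi))

/-- Markov's inequality for the number of progressions, including the degenerate case `t = 0`. -/
theorem exists_markov {t ε : ℝ} (ht : 0 ≤ t)
    (hε : ε ≤ 1) (hA : expAP n k q ≤ (1 - ε) * t) :
    ∃ M : Finset ℕ → ℝ, (∀ ω, 0 ≤ M ω) ∧ (∀ ω, ¬ (apCount n k ω : ℝ) ≤ t → 1 ≤ M ω) ∧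
      ∑ ω ∈ (Finset.Icc 1 n).powerset, prodWeight (Finset.Icc 1 n) q ω * M ω ≤ 1 - ε := by
  rcases ht.eq_or_lt with rfl | ht
  · refine ⟨fun ω => apCount n k ω, fun ω => Nat.cast_nonneg _, fun ω h => ?_, ?_⟩
    · rw [not_le, Nat.cast_pos] at h
      exact Nat.one_le_cast.2 h
    · refine le_trans ?_ (by linarith : (0 : ℝ) ≤ 1 - ε)
      rw [mul_zero] at hA
      exact hA
  · refine ⟨fun ω => apCount n k ω / t, fun ω => by positivity, fun ω h => ?_, ?_⟩
    · rw [one_le_div ht]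
      exact (not_le.1 h).le
    · simp only [← mul_div_assoc]
      rw [← Finset.sum_div, div_le_iff₀ ht]
      exact hA

theorem neg_log_PrAP_le (hk : 1 ≤ k) (hn : 2 * k ≤ n) (hp0 : 0 < p) (hp1 : p < 1) {ε η : ℝ}
    (hε0 : 0 < ε) (hε1 : ε ≤ 1) (hη0 : 0 ≤ η) (hη1 : η ≤ 1)
    (hnp : 131072 * k ^ 4 ≤ (1 - p) * ε ^ 5 * (n * p))
    (hq : ∀ i ∈ Finset.Icc 1 n, q i ∈ Set.Icc (0 : ℝ) 1)
    (hA : expAP n k q ≤ (1 - ε) * η * expAP n k (fun _ => p)) :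
    - Real.log (PrAP n k p η) ≤ (1 + ε) * ∑ i ∈ Finset.Icc 1 n, ip p (q i) := by
  have hk0 : (0 : ℝ) < k := by exact_mod_cast hk
  have hp' : 0 < 1 - p := by linarith
  have hm0 := expAP_const_nonneg (n := n) (k := k) hp0.le
  have hq' : ∀ i ∈ Finset.Icc 1 n, min (q i) p ∈ Set.Icc (0 : ℝ) p := fun i hi =>
    ⟨le_min (hq i hi).1 hp0.le, min_le_right _ _⟩
  have hA' : expAP n k (fun i => min (q i) p) ≤ (1 - ε) * (η * expAP n k (fun _ => p)) := by
    rw [← mul_assoc]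
    exact (expAP_mono (fun i hi => (hq' i hi).1) fun i _ => min_le_left _ _).trans hA
  have hA'' : expAP n k (fun i => min (q i) p) ≤ (1 - ε) * expAP n k (fun _ => p) :=
    hA'.trans (mul_le_mul_of_nonneg_left (mul_le_of_le_one_left hm0 hη1) (by linarith))
  obtain ⟨M, hM0, hM1, hM⟩ := exists_markov (mul_nonneg hη0 hm0) hε1 hA'
  have hZ := PrAP_pos (n := n) hk hp0 hp1 hη0
  rw [PrAP_eq_sum_restrictedWeight] at hZ ⊢
  refine (neg_log_sum_restrictedWeight_le hp0 hp1 hq' hε0 hε1 (le_trans ?_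
    (le_sum_ip hk hn hp0 hp1 hε0 hq' hA'')) hM0 hM1 hM hZ).trans ?_
  · rw [div_le_div_iff₀ (by positivity) (by positivity)]
    linarith
  · refine mul_le_mul_of_nonneg_left (Finset.sum_le_sum fun i hi => ?_) (by linarith)
    rcases le_total (q i) p with h | h
    · rw [min_eq_left h]
    · rw [min_eq_right h, ip_self]
      exact ip_nonneg hp0 hp1 (hq i hi)

end

theorem PhiAP_antitone {n k : ℕ} {p : ℝ} (hk : 1 ≤ k) (hp0 : 0 < p) (hp1 : p < 1) {η η' : ℝ}
    (hη : 0 ≤ η) (h : η ≤ η') : PhiAP n k p η' ≤ PhiAP n k p η := by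
  have hm0 := expAP_const_nonneg (n := n) (k := k) hp0.le
  refine le_csInf ⟨_, fun _ => 0, fun _ _ => ⟨le_rfl, zero_le_one⟩, ?_, rfl⟩ ?_
  · rw [expAP_const, zero_pow (by omega), mul_zero]
    exact mul_nonneg hη hm0
  · rintro x ⟨q, hq, hA, rfl⟩
    exact PhiAP_le hp0 hp1 hq (hA.trans (mul_le_mul_of_nonneg_right h hm0))

theorem expAP_zero_left (k : ℕ) (q : ℕ → ℝ) : expAP 0 k q = 0 := by
  simp [expAP, apCount]

theorem PrAP_zero_left (k : ℕ) (p η : ℝ) : PrAP 0 k p η = 1 := by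
  simp [PrAP, apCount, expAP_zero_left, pwI]

theorem PhiAP_zero_left (k : ℕ) (p η : ℝ) : PhiAP 0 k p η = 0 := by
  simp [PhiAP, expAP_zero_left]

theorem pow_le_mul_pow_of_mul_rpow_le {n k : ℕ} {p L : ℝ} (hk : 2 ≤ k) (hn : 0 < n) (hL : 0 ≤ L)
    (h : L * (n : ℝ) ^ (-(1 / ((k : ℝ) - 1))) ≤ p) : L ^ (k - 1) ≤ n * p ^ (k - 1) := by
  have hn0 : (0 : ℝ) < n := by exact_mod_cast hn
  have h1 := pow_le_pow_left₀ (by positivity) h (k - 1)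
  have hk1 : (k : ℝ) - 1 ≠ 0 := by
    have : (2 : ℝ) ≤ k := by exact_mod_cast hk
    linarith
  have e : ((n : ℝ) ^ (-(1 / ((k : ℝ) - 1)))) ^ (k - 1) = (n : ℝ)⁻¹ := by
    rw [← Real.rpow_natCast, ← Real.rpow_mul hn0.le, Nat.cast_sub (by omega), Nat.cast_one,
      neg_mul, one_div_mul_cancel hk1, Real.rpow_neg_one]
  rw [mul_pow, e] at h1
  have h2 := mul_le_mul_of_nonneg_left h1 hn0.le
  rwa [mul_left_comm, mul_inv_cancel₀ hn0.ne', mul_one] at h2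

/-- Theorem `thm:APs`: for every positive integer `k`, all `p₀ < 1` and every `ε > 0`
there is a constant `L` such that whenever `L n^{−1/(k−1)} ≤ p ≤ p₀` and
`X = A_k([n]_p)`, for every `η ∈ [0,1]`,
`(1−ε) Φ_{n,p}^k(η+ε) ≤ − log Pr(X ≤ η E[X]) ≤ (1+ε) Φ_{n,p}^k((1−ε)η)`.
(The upper bound is rendered by quantifying over all product measures `q` feasible for
the parameter `(1−ε)η`, which is the correct reading of `(1+ε)·min{…}` also when the
feasible set is empty and the minimum is `+∞`.) -/
theorem aps_lower_tail (k : ℕ) (hk : 0 < k) (p₀ ε : ℝ) (hp₀ : p₀ < 1) (hε : 0 < ε) :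
    ∃ L : ℝ, 0 < L ∧ ∀ (n : ℕ) (p : ℝ),
      L * (n : ℝ) ^ (-(1 / ((k : ℝ) - 1))) ≤ p → p ≤ p₀ →
      ∀ η : ℝ, 0 ≤ η → η ≤ 1 →
        (1 - ε) * PhiAP n k p (η + ε) ≤ - Real.log (PrAP n k p η) ∧
        ∀ q : ℕ → ℝ, (∀ i ∈ Finset.Icc 1 n, q i ∈ Set.Icc (0 : ℝ) 1) →
          expAP n k q ≤ (1 - ε) * η * expAP n k (fun _ => p) →
          - Real.log (PrAP n k p η) ≤ (1 + ε) * ∑ i ∈ Finset.Icc 1 n, ip p (q i) := by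
  rcases (by omega : k = 1 ∨ 2 ≤ k) with rfl | hk2
  · refine ⟨1, one_pos, fun n p h1 h2 => ?_⟩
    simp only [Nat.cast_one, sub_self, div_zero, neg_zero, Real.rpow_zero, mul_one] at h1
    linarith
  have hk0 : (2 : ℝ) ≤ k := by exact_mod_cast hk2
  obtain ⟨e, he0, he1, heε⟩ : ∃ e : ℝ, 0 < e ∧ e ≤ 1 ∧ e ≤ ε :=
    ⟨min ε 1, lt_min hε one_pos, min_le_right _ _, min_le_left _ _⟩
  obtain ⟨δ, hδ0, hδ1, hδ⟩ : ∃ δ : ℝ, 0 < δ ∧ δ ≤ 1 / 2 ∧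
      (1 + (k : ℝ) ^ 2) * (1 + 32 * k ^ 2 / e) * δ ≤ (e ^ 2 / (64 * k ^ 2)) ^ 2 := by
    have hpos : 0 < (1 + (k : ℝ) ^ 2) * (1 + 32 * k ^ 2 / e) := by positivity
    refine ⟨min (1 / 2) ((e ^ 2 / (64 * k ^ 2)) ^ 2 / ((1 + (k : ℝ) ^ 2) * (1 + 32 * k ^ 2 / e))),
      lt_min (by norm_num) (by positivity), min_le_left _ _, ?_⟩
    rw [mul_comm, ← le_div_iff₀ hpos]
    exact min_le_right _ _
  have hp₀' : 0 < 1 - p₀ := by linarith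
  have hC : 0 < 131072 * (k : ℝ) ^ 4 / ((1 - p₀) * e ^ 5) := by positivity
  have hδ' : 0 < 1 / δ := by positivity
  refine ⟨1 / δ + 2 * k + 131072 * k ^ 4 / ((1 - p₀) * e ^ 5), by positivity, ?_⟩
  intro n p hLp hpp η hη0 hη1
  rcases n.eq_zero_or_pos with rfl | hn
  · simp [PrAP_zero_left, PhiAP_zero_left]
  have hn0 : (0 : ℝ) < n := by exact_mod_cast hn
  set L := 1 / δ + 2 * k + 131072 * k ^ 4 / ((1 - p₀) * e ^ 5) with hL
  have hL1 : 1 ≤ L := by linarith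
  have hp0 : 0 < p := lt_of_lt_of_le (by positivity) hLp
  have hp1 : p < 1 := by linarith
  have hpow := pow_le_mul_pow_of_mul_rpow_le hk2 hn (by linarith) hLp
  have hnp : L ≤ n * p := by
    refine (le_self_pow₀ hL1 (by omega : k - 1 ≠ 0)).trans (hpow.trans ?_)
    exact mul_le_mul_of_nonneg_left (pow_le_of_le_one hp0.le hp1.le (by omega)) hn0.le
  have hn2 : 2 * k ≤ n := by
    have h1 : (n : ℝ) * p ≤ n := mul_le_of_le_one_right hn0.le hp1.le
    have h2 : (2 : ℝ) * k ≤ n := by linarith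
    exact_mod_cast h2
  constructor
  · have hδL : 1 ≤ δ * L := by
      have h1 : δ * (1 / δ) ≤ δ * L := mul_le_mul_of_nonneg_left (by linarith) hδ0.le
      rwa [mul_one_div_cancel hδ0.ne'] at h1
    have hδp : 1 ≤ n * (δ * p) ^ (k - 1) := by
      refine (one_le_pow₀ hδL (n := k - 1)).trans ?_
      rw [mul_pow, mul_pow, mul_left_comm]
      exact mul_le_mul_of_nonneg_left hpow (by positivity)
    refine le_trans ?_ (one_sub_mul_PhiAP_le hk2 hp0 hp1 he0 hη0 hδ0 hδ1 hδ hn2 hδp)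
    exact (mul_le_mul_of_nonneg_right (by linarith) (PhiAP_nonneg hp0 hp1)).trans
      (mul_le_mul_of_nonneg_left (PhiAP_antitone hk hp0 hp1 (by linarith) (by linarith))
        (by linarith))
  · intro q hq hA
    have hm0 := expAP_const_nonneg (n := n) (k := k) hp0.le
    have hnp' : 131072 * (k : ℝ) ^ 4 ≤ (1 - p) * e ^ 5 * (n * p) := by
      have h1 : 131072 * (k : ℝ) ^ 4 / ((1 - p₀) * e ^ 5) ≤ n * p := by linarith
      rw [div_le_iff₀ (by positivity), mul_comm (n * p : ℝ)] at h1
      refine h1.trans (mul_le_mul_of_nonneg_right ?_ (by positivity))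
      exact mul_le_mul_of_nonneg_right (by linarith) (by positivity)
    refine (neg_log_PrAP_le hk hn2 hp0 hp1 he0 he1 hη0 hη1 hnp' hq (hA.trans ?_)).trans ?_
    · exact mul_le_mul_of_nonneg_right (mul_le_mul_of_nonneg_right (by linarith) hη0) hm0
    · exact mul_le_mul_of_nonneg_right (by linarith) (sum_ip_nonneg hp0 hp1 hq)

end
end

section
/- Let n be a positive integer, let t ≥ 0, and let Y = (Y_e)_{e∈E(K_n)} be the random graph G(n,1/2) conditioned on having at most t triangles. Then there exists a subgraph F ⊆ K_n with at most n^{3/2} edges such that for every triple {i,j,k} of distinct vertices in {1,…,n}, setting S := (Y_f)_{f∈F} and d_{ijk}^S := d_TV((Y_{ij}^S, Y_{ik}^S, Y_{jk}^S), Y_{ij}^S × Y_{ik}^S × Y_{jk}^S), one has E[d_{ijk}^S] ≤ 2·n^{−1/4}. -/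
open Classical

noncomputable section

/-- The edges of the complete graph `K_n`: two-element subsets of `{1,…,n}`. -/
abbrev Edge (n : ℕ) := {e : Finset (Fin n) // e.card = 2}

/-- The probability of the graph (configuration) `ω` under the product measure in which
each edge `e` is retained independently with probability `q e`. -/
def pw {V : Type*} [Fintype V] [DecidableEq V] (q : V → ℝ) (ω : Finset V) : ℝ :=
  (∏ e ∈ ω, q e) * ∏ e ∈ ωᶜ, (1 - q e)

/-- The number of triangles of the graph `ω`. -/
def triCount (n : ℕ) (ω : Finset (Edge n)) : ℕ :=
  (((Finset.univ : Finset (Fin n)).powersetCard 3).filter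
    (fun t => ∀ e : Edge n, e.1 ⊆ t → e ∈ ω)).card

/-- The probability of the event `P` for `G(n, 1/2)` conditioned on having at most `t`
triangles. -/
def muPr (n : ℕ) (t : ℝ) (P : Finset (Edge n) → Prop) : ℝ :=
  (∑ ω : Finset (Edge n),
      if P ω ∧ (triCount n ω : ℝ) ≤ t then pw (fun _ => (1 / 2 : ℝ)) ω else 0) /
    ∑ ω : Finset (Edge n),
      if (triCount n ω : ℝ) ≤ t then pw (fun _ => (1 / 2 : ℝ)) ω else 0

/-- The (conditional) law of the Boolean variable `Y_e^S` given `S = (Y_f)_{f ∈ F} = 𝟙_s`: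
the probability that `Y_e = b` given that the conditioned random graph agrees with `s`
on `F`. -/
def margin (n : ℕ) (t : ℝ) (F s : Finset (Edge n)) (e : Edge n) (b : Bool) : ℝ :=
  muPr n t (fun ω => ω ∩ F = s ∧ ((e ∈ ω) ↔ b = true)) / muPr n t (fun ω => ω ∩ F = s)

/-- The joint (conditional) law of `(Y_{e₁}^S, Y_{e₂}^S, Y_{e₃}^S)` given
`(Y_f)_{f ∈ F} = 𝟙_s`. -/
def joint (n : ℕ) (t : ℝ) (F s : Finset (Edge n)) (e₁ e₂ e₃ : Edge n)
    (b : Bool × Bool × Bool) : ℝ :=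
  muPr n t (fun ω => ω ∩ F = s ∧ ((e₁ ∈ ω) ↔ b.1 = true) ∧ ((e₂ ∈ ω) ↔ b.2.1 = true) ∧
      ((e₃ ∈ ω) ↔ b.2.2 = true)) /
    muPr n t (fun ω => ω ∩ F = s)

/-- Total variation distance between two (laws of) `Bool × Bool × Bool`-valued random
variables, given by their probability mass functions. -/
def dTV3 (P Q : Bool × Bool × Bool → ℝ) : ℝ :=
  (1 / 2) * ∑ b, |P b - Q b|

/-- `d_{ijk}^S` for a given value `s` of `S`: the total variation distance between the
conditional law of the triple `(Y_{e₁}^S, Y_{e₂}^S, Y_{e₃}^S)` and the product of its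
marginals `Y_{e₁}^S × Y_{e₂}^S × Y_{e₃}^S`. -/
def dS (n : ℕ) (t : ℝ) (F s : Finset (Edge n)) (e₁ e₂ e₃ : Edge n) : ℝ :=
  dTV3 (joint n t F s e₁ e₂ e₃)
    (fun b => margin n t F s e₁ b.1 * margin n t F s e₂ b.2.1 * margin n t F s e₃ b.2.2)

section Pinning

variable {V : Type*} [Fintype V]

/-- The total weight of the configurations satisfying `P`. -/
def weight (μ : Finset V → ℝ) (P : Finset V → Prop) : ℝ :=
  ∑ ω, if P ω then μ ω else 0

lemma weight_eq_add {μ : Finset V → ℝ} {A B C : Finset V → Prop}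
    (h : ∀ ω, (A ω ↔ B ω ∨ C ω) ∧ ¬ (B ω ∧ C ω)) :
    weight μ A = weight μ B + weight μ C := by
  unfold weight
  rw [← Finset.sum_add_distrib]
  refine Finset.sum_congr rfl fun ω _ => ?_
  obtain ⟨h1, h2⟩ := h ω
  by_cases hB : B ω <;> by_cases hC : C ω <;> simp_all

lemma weight_nonneg {μ : Finset V → ℝ} (hμ : ∀ ω, 0 ≤ μ ω) (P : Finset V → Prop) :
    0 ≤ weight μ P :=
  Finset.sum_nonneg fun ω _ => by split_ifs <;> simp [hμ]

lemma weight_mono {μ : Finset V → ℝ} (hμ : ∀ ω, 0 ≤ μ ω) {P Q : Finset V → Prop}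
    (h : ∀ ω, P ω → Q ω) : weight μ P ≤ weight μ Q :=
  Finset.sum_le_sum fun ω _ => by
    by_cases hP : P ω
    · simp [hP, h ω hP]
    · by_cases hQ : Q ω <;> simp [hP, hQ, hμ]

lemma weight_map {μ : Finset V → ℝ} (τ : Equiv.Perm V)
    (hτ : ∀ ω, μ (ω.map τ.toEmbedding) = μ ω) (P : Finset V → Prop) :
    weight μ P = weight μ (fun ω => P (ω.map τ.toEmbedding)) := by
  unfold weight
  rw [← Equiv.sum_comp τ.finsetCongr]
  exact Finset.sum_congr rfl fun ω _ => by simp [Equiv.finsetCongr_apply, hτ]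

variable [DecidableEq V]

/-- The conditional probability of `e ∈ ω` given `ω ∩ F = s`. -/
def condProb (μ : Finset V → ℝ) (F s : Finset V) (e : V) : ℝ :=
  weight μ (fun ω => ω ∩ F = s ∧ e ∈ ω) / weight μ (fun ω => ω ∩ F = s)

/-- The second moment of the conditional probability of `e ∈ ω` given `ω ∩ F`. -/
def energy (μ : Finset V → ℝ) (F : Finset V) (e : V) : ℝ :=
  ∑ ω, μ ω * condProb μ F (ω ∩ F) e ^ 2

/-- The weighted change in the conditional probability of `e ∈ ω` when the revealed set
grows from `F` to `G`. -/
def shift (μ : Finset V → ℝ) (F G : Finset V) (e : V) (ω : Finset V) : ℝ :=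
  μ ω * |condProb μ G (ω ∩ G) e - condProb μ F (ω ∩ F) e|

lemma condProb_nonneg {μ : Finset V → ℝ} (hμ : ∀ ω, 0 ≤ μ ω) (F s : Finset V) (e : V) :
    0 ≤ condProb μ F s e :=
  div_nonneg (weight_nonneg hμ _) (weight_nonneg hμ _)

lemma condProb_le_one {μ : Finset V → ℝ} (hμ : ∀ ω, 0 ≤ μ ω) (F s : Finset V) (e : V) :
    condProb μ F s e ≤ 1 :=
  div_le_one_of_le₀ (weight_mono hμ fun _ h => h.1) (weight_nonneg hμ _)

lemma sum_condProb_mul {μ : Finset V → ℝ} (hμ : ∀ ω, 0 ≤ μ ω) (F : Finset V) (e : V)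
    (h : Finset V → ℝ) :
    ∑ ω, μ ω * condProb μ F (ω ∩ F) e * h (ω ∩ F) =
      ∑ ω, if e ∈ ω then μ ω * h (ω ∩ F) else 0 := by
  rw [← Finset.sum_fiberwise (s := Finset.univ) (g := fun ω => ω ∩ F),
    ← Finset.sum_fiberwise (s := Finset.univ) (g := fun ω => ω ∩ F)
      (f := fun ω => if e ∈ ω then μ ω * h (ω ∩ F) else 0)]
  refine Finset.sum_congr rfl fun s _ => ?_
  have h1 : ∑ ω with ω ∩ F = s, μ ω * condProb μ F (ω ∩ F) e * h (ω ∩ F) =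
      weight μ (fun ω => ω ∩ F = s) * condProb μ F s e * h s := by
    rw [weight, Finset.sum_mul, Finset.sum_mul, Finset.sum_filter]
    refine Finset.sum_congr rfl fun ω _ => ?_
    by_cases hs : ω ∩ F = s <;> simp [hs]
  have h2 : (∑ ω with ω ∩ F = s, if e ∈ ω then μ ω * h (ω ∩ F) else 0) =
      weight μ (fun ω => ω ∩ F = s ∧ e ∈ ω) * h s := by
    rw [weight, Finset.sum_mul, Finset.sum_filter]
    refine Finset.sum_congr rfl fun ω _ => ?_
    by_cases hs : ω ∩ F = s <;> simp [hs]
  rw [h1, h2]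
  congr 1
  by_cases hp : weight μ (fun ω => ω ∩ F = s) = 0
  · have := weight_mono hμ (P := fun ω => ω ∩ F = s ∧ e ∈ ω) (Q := fun ω => ω ∩ F = s)
      fun _ h => h.1
    have := weight_nonneg hμ (fun ω => ω ∩ F = s ∧ e ∈ ω)
    rw [hp, zero_mul]
    linarith
  · exact mul_div_cancel₀ _ hp

lemma sum_condProb_sub_sq {μ : Finset V → ℝ} (hμ : ∀ ω, 0 ≤ μ ω) {F G : Finset V}
    (hFG : F ⊆ G) (e : V) :
    ∑ ω, μ ω * (condProb μ G (ω ∩ G) e - condProb μ F (ω ∩ F) e) ^ 2 =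
      energy μ G e - energy μ F e := by
  have hr (ω : Finset V) : ω ∩ G ∩ F = ω ∩ F := by
    rw [Finset.inter_assoc, Finset.inter_eq_right.2 hFG]
  have h1 := sum_condProb_mul hμ F e fun s => condProb μ F s e
  have h2 := sum_condProb_mul hμ G e fun s => condProb μ F (s ∩ F) e
  simp only [hr] at h2
  have h3 : ∑ ω, μ ω * (condProb μ G (ω ∩ G) e - condProb μ F (ω ∩ F) e) ^ 2 =
      energy μ G e + energy μ F e
        - 2 * ∑ ω, μ ω * condProb μ G (ω ∩ G) e * condProb μ F (ω ∩ F) e := by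
    rw [energy, energy, Finset.mul_sum, ← Finset.sum_add_distrib, ← Finset.sum_sub_distrib]
    exact Finset.sum_congr rfl fun ω _ => by ring
  have h4 : energy μ F e =
      ∑ ω, μ ω * condProb μ F (ω ∩ F) e * condProb μ F (ω ∩ F) e :=
    Finset.sum_congr rfl fun ω _ => by ring
  rw [h3, h2, ← h1, ← h4]
  ring

lemma energy_mono {μ : Finset V → ℝ} (hμ : ∀ ω, 0 ≤ μ ω) {F G : Finset V}
    (hFG : F ⊆ G) (e : V) : energy μ F e ≤ energy μ G e := by
  rw [← sub_nonneg, ← sum_condProb_sub_sq hμ hFG]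
  exact Finset.sum_nonneg fun ω _ => mul_nonneg (hμ ω) (sq_nonneg _)

lemma energy_nonneg {μ : Finset V → ℝ} (hμ : ∀ ω, 0 ≤ μ ω) (F : Finset V) (e : V) :
    0 ≤ energy μ F e :=
  Finset.sum_nonneg fun ω _ => mul_nonneg (hμ ω) (sq_nonneg _)

lemma energy_le_one {μ : Finset V → ℝ} (hμ : ∀ ω, 0 ≤ μ ω) (hsum : ∑ ω, μ ω = 1)
    (F : Finset V) (e : V) : energy μ F e ≤ 1 := by
  rw [← hsum]
  refine Finset.sum_le_sum fun ω _ => mul_le_of_le_one_right (hμ ω) ?_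
  exact pow_le_one₀ (condProb_nonneg hμ _ _ _) (condProb_le_one hμ _ _ _)

lemma energy_eq_of_mem {μ : Finset V → ℝ} (hμ : ∀ ω, 0 ≤ μ ω) {F : Finset V} {e : V}
    (he : e ∈ F) : energy μ F e = ∑ ω, if e ∈ ω then μ ω else 0 := by
  have h := sum_condProb_mul hμ F e fun s => condProb μ F s e
  have h' := sum_condProb_mul hμ F e fun s => if e ∈ s then 1 else 0
  simp only [Finset.mem_inter, he, and_true] at h'
  calc energy μ F e = ∑ ω, μ ω * condProb μ F (ω ∩ F) e * condProb μ F (ω ∩ F) e :=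
        Finset.sum_congr rfl fun ω _ => by ring
    _ = ∑ ω, μ ω * condProb μ F (ω ∩ F) e * (if e ∈ ω then 1 else 0) := by
        rw [h]
        refine Finset.sum_congr rfl fun ω _ => ?_
        split_ifs <;> simp
    _ = ∑ ω, if e ∈ ω then μ ω else 0 := by
        rw [h']
        refine Finset.sum_congr rfl fun ω _ => ?_
        split_ifs <;> simp

lemma sum_shift_le {μ : Finset V → ℝ} (hμ : ∀ ω, 0 ≤ μ ω) (hsum : ∑ ω, μ ω = 1)
    {F G : Finset V} (hFG : F ⊆ G) (e : V) :
    ∑ ω, shift μ F G e ω ≤ √(energy μ G e - energy μ F e) := by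
  apply Real.le_sqrt_of_sq_le
  rw [← sum_condProb_sub_sq hμ hFG]
  have h := Finset.sum_sq_le_sum_mul_sum_of_sq_le_mul (Finset.univ : Finset (Finset V))
    (r := shift μ F G e) (f := μ)
    (g := fun ω => μ ω * (condProb μ G (ω ∩ G) e - condProb μ F (ω ∩ F) e) ^ 2)
    (fun ω _ => hμ ω) (fun ω _ => mul_nonneg (hμ ω) (sq_nonneg _))
    (fun ω _ => by rw [shift, mul_pow, sq_abs]; exact le_of_eq (by ring))
  rwa [hsum, one_mul] at h

/-- On an event `Q` determined by `ω ∩ G`, within a fibre of `ω ↦ ω ∩ F`. -/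
lemma abs_weight_sub_le {μ : Finset V → ℝ} (hμ : ∀ ω, 0 ≤ μ ω) {F G : Finset V}
    (s : Finset V) (e : V) {Q : Finset V → Prop} (hQ : ∀ ω, Q (ω ∩ G) ↔ Q ω)
    (hs : ∀ ω, Q ω → ω ∩ F = s) :
    |weight μ (fun ω => Q ω ∧ e ∈ ω) - condProb μ F s e * weight μ Q| ≤
      weight (shift μ F G e) Q := by
  have h := sum_condProb_mul hμ G e fun σ => if Q σ then 1 else 0
  simp only [hQ] at h
  have h1 : weight μ (fun ω => Q ω ∧ e ∈ ω) =
      ∑ ω, μ ω * condProb μ G (ω ∩ G) e * (if Q ω then 1 else 0) := by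
    rw [h, weight]
    refine Finset.sum_congr rfl fun ω _ => ?_
    by_cases h1 : Q ω <;> by_cases h2 : e ∈ ω <;> simp [h1, h2]
  rw [h1, weight, weight, Finset.mul_sum, ← Finset.sum_sub_distrib]
  refine (Finset.abs_sum_le_sum_abs _ _).trans (Finset.sum_le_sum fun ω _ => ?_)
  by_cases hq : Q ω
  · simp only [hq, if_true, shift, hs ω hq]
    rw [mul_one, mul_comm (condProb μ F s e), ← mul_sub, abs_mul, abs_of_nonneg (hμ ω)]
  · simp [hq]

lemma mul_dTV3_le {p : ℝ} (hp : 0 ≤ p) {x : Bool → Bool → Bool → ℝ} {q : Bool → Bool → ℝ}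
    {y₁ y₂ y₃ : Bool → ℝ} (hy₁ : ∀ a, 0 ≤ y₁ a)
    (hq : ∀ b c, q b c = x true b c + x false b c)
    (hy₃ : ∀ c, y₃ c = q true c + q false c)
    (hp₁ : p = y₁ true + y₁ false) (hp₂ : p = y₂ true + y₂ false) :
    p * dTV3 (fun b => x b.1 b.2.1 b.2.2 / p)
        (fun b => y₁ b.1 / p * (y₂ b.2.1 / p) * (y₃ b.2.2 / p)) ≤
      (∑ b, ∑ c, |x true b c - y₁ true / p * q b c|) +
        ∑ c, |q true c - y₂ true / p * y₃ c| := by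
  rcases hp.eq_or_lt with h0 | h0
  · rw [← h0, zero_mul]
    positivity
  have hp0 := h0.ne'
  have e₁ : y₁ false / p = 1 - y₁ true / p := by rw [hp₁] at hp0 ⊢; field_simp; ring
  have e₂ : y₂ false / p = 1 - y₂ true / p := by rw [hp₂] at hp0 ⊢; field_simp; ring
  have key₁ (a b c : Bool) : |x a b c - y₁ a / p * q b c| =
      |x true b c - y₁ true / p * q b c| := by
    cases a
    · rw [e₁, ← abs_neg]
      congr 1
      rw [hq]
      ring
    · rfl
  have key₂ (b c : Bool) : |q b c - y₂ b / p * y₃ c| = |q true c - y₂ true / p * y₃ c| := by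
    cases b
    · rw [e₂, ← abs_neg]
      congr 1
      rw [hy₃]
      ring
    · rfl
  have key (a b c : Bool) : p * |x a b c / p - y₁ a / p * (y₂ b / p) * (y₃ c / p)| ≤
      |x true b c - y₁ true / p * q b c| + y₁ a / p * |q true c - y₂ true / p * y₃ c| := by
    have h1 : 0 ≤ y₁ a / p := div_nonneg (hy₁ a) hp
    rw [← key₁ a, ← key₂ b]
    have h2 (z : ℝ) : p * |z| = |p * z| := by rw [abs_mul, abs_of_pos h0]
    have h3 (z : ℝ) : y₁ a / p * |z| = |y₁ a / p * z| := by rw [abs_mul, abs_of_nonneg h1]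
    rw [h2, h3]
    refine le_trans (le_of_eq ?_) (abs_add_le _ _)
    congr 1
    field_simp
    ring
  have ht : y₁ true / p + y₁ false / p = 1 := by rw [e₁]; ring
  have hsum : p * ∑ b : Bool × Bool × Bool,
      |x b.1 b.2.1 b.2.2 / p - y₁ b.1 / p * (y₂ b.2.1 / p) * (y₃ b.2.2 / p)| ≤
      ∑ b : Bool × Bool × Bool, (|x true b.2.1 b.2.2 - y₁ true / p * q b.2.1 b.2.2| +
        y₁ b.1 / p * |q true b.2.2 - y₂ true / p * y₃ b.2.2|) := by
    rw [Finset.mul_sum]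
    exact Finset.sum_le_sum fun b _ => key _ _ _
  unfold dTV3
  simp only [Fintype.sum_prod_type, Fintype.sum_bool] at hsum ⊢
  have hz (z : ℝ) : y₁ true / p * z + y₁ false / p * z = z := by rw [← add_mul, ht, one_mul]
  have hz₁ := hz |q true true - y₂ true / p * y₃ true|
  have hz₂ := hz |q true false - y₂ true / p * y₃ false|
  linarith

lemma sum_weight_mul_dTV3_le {μ : Finset V → ℝ} (hμ : ∀ ω, 0 ≤ μ ω) (hsum : ∑ ω, μ ω = 1)
    (F : Finset V) (e₁ e₂ e₃ : V) :
    ∑ s ∈ F.powerset, weight μ (fun ω => ω ∩ F = s) *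
        dTV3 (fun b => weight μ (fun ω => ω ∩ F = s ∧ ((e₁ ∈ ω) ↔ b.1 = true) ∧
            ((e₂ ∈ ω) ↔ b.2.1 = true) ∧ ((e₃ ∈ ω) ↔ b.2.2 = true)) /
              weight μ (fun ω => ω ∩ F = s))
          (fun b =>
            weight μ (fun ω => ω ∩ F = s ∧ ((e₁ ∈ ω) ↔ b.1 = true)) /
              weight μ (fun ω => ω ∩ F = s) *
            (weight μ (fun ω => ω ∩ F = s ∧ ((e₂ ∈ ω) ↔ b.2.1 = true)) /
              weight μ (fun ω => ω ∩ F = s)) *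
            (weight μ (fun ω => ω ∩ F = s ∧ ((e₃ ∈ ω) ↔ b.2.2 = true)) /
              weight μ (fun ω => ω ∩ F = s))) ≤
      √(energy μ (F ∪ {e₂, e₃}) e₁ - energy μ F e₁) +
        √(energy μ (F ∪ {e₃}) e₂ - energy μ F e₂) := by
  refine le_trans ?_ (add_le_add (sum_shift_le hμ hsum Finset.subset_union_left e₁)
    (sum_shift_le hμ hsum Finset.subset_union_left e₂))
  have hfib (f : Finset V → ℝ) : ∑ ω, f ω = ∑ s ∈ F.powerset, weight f (fun ω => ω ∩ F = s) := by
    rw [← Finset.sum_fiberwise_of_maps_to (t := F.powerset) (g := fun ω => ω ∩ F)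
      (fun ω _ => Finset.mem_powerset.2 Finset.inter_subset_right)]
    exact Finset.sum_congr rfl fun s _ => by
      rw [weight, Finset.sum_filter]
      exact Finset.sum_congr rfl fun ω _ => by congr
  rw [hfib, hfib, ← Finset.sum_add_distrib]
  refine Finset.sum_le_sum fun s _ => ?_
  have hc (e : V) : weight μ (fun ω => ω ∩ F = s ∧ ((e ∈ ω) ↔ true = true)) /
      weight μ (fun ω => ω ∩ F = s) = condProb μ F s e := by
    simp [condProb]
  refine (mul_dTV3_le (weight_nonneg hμ _)
    (x := fun a b c => weight μ (fun ω => ω ∩ F = s ∧ ((e₁ ∈ ω) ↔ a = true) ∧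
            ((e₂ ∈ ω) ↔ b = true) ∧ ((e₃ ∈ ω) ↔ c = true)))
    (q := fun b c => weight μ (fun ω => ω ∩ F = s ∧
            ((e₂ ∈ ω) ↔ b = true) ∧ ((e₃ ∈ ω) ↔ c = true)))
    (y₁ := fun a => weight μ (fun ω => ω ∩ F = s ∧ ((e₁ ∈ ω) ↔ a = true)))
    (y₂ := fun a => weight μ (fun ω => ω ∩ F = s ∧ ((e₂ ∈ ω) ↔ a = true)))
    (y₃ := fun a => weight μ (fun ω => ω ∩ F = s ∧ ((e₃ ∈ ω) ↔ a = true)))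
    (fun a => weight_nonneg hμ _)
    (fun b c => weight_eq_add fun ω => by simp only [Bool.false_eq_true]; tauto)
    (fun c => weight_eq_add fun ω => by simp only [Bool.false_eq_true]; tauto)
    (weight_eq_add fun ω => by simp only [Bool.false_eq_true]; tauto)
    (weight_eq_add fun ω => by simp only [Bool.false_eq_true]; tauto)).trans ?_
  rw [hc, hc]
  have hr (ω G : Finset V) : ω ∩ (F ∪ G) ∩ F = ω ∩ F := by
    rw [Finset.inter_assoc, Finset.inter_eq_right.2 Finset.subset_union_left]
  refine add_le_add ?_ ?_
  · have hsplit : weight (shift μ F (F ∪ {e₂, e₃}) e₁) (fun ω => ω ∩ F = s) =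
        ∑ b, ∑ c, weight (shift μ F (F ∪ {e₂, e₃}) e₁) (fun ω => ω ∩ F = s ∧
            ((e₂ ∈ ω) ↔ b = true) ∧ ((e₃ ∈ ω) ↔ c = true)) := by
      simp only [Fintype.sum_bool]
      rw [weight_eq_add (B := fun ω => ω ∩ F = s ∧ e₂ ∈ ω) (C := fun ω => ω ∩ F = s ∧ e₂ ∉ ω)
        (fun ω => by tauto)]
      congr 1 <;> exact weight_eq_add fun ω => by simp only [Bool.false_eq_true]; tauto
    rw [hsplit]
    refine Finset.sum_le_sum fun b _ => Finset.sum_le_sum fun c _ => ?_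
    refine le_trans (le_of_eq ?_) (abs_weight_sub_le hμ s e₁
      (Q := fun ω => ω ∩ F = s ∧ ((e₂ ∈ ω) ↔ b = true) ∧ ((e₃ ∈ ω) ↔ c = true))
      (fun ω => by rw [hr]; simp) (fun ω h => h.1))
    congr 3
    ext ω
    tauto
  · have hsplit : weight (shift μ F (F ∪ {e₃}) e₂) (fun ω => ω ∩ F = s) =
        ∑ c, weight (shift μ F (F ∪ {e₃}) e₂) (fun ω => ω ∩ F = s ∧ ((e₃ ∈ ω) ↔ c = true)) := by
      simp only [Fintype.sum_bool]
      exact weight_eq_add fun ω => by simp only [Bool.false_eq_true]; tauto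
    rw [hsplit]
    refine Finset.sum_le_sum fun c _ => ?_
    refine le_trans (le_of_eq ?_) (abs_weight_sub_le hμ s e₂
      (Q := fun ω => ω ∩ F = s ∧ ((e₃ ∈ ω) ↔ c = true))
      (fun ω => by rw [hr]; simp) (fun ω h => h.1))
    congr 3
    ext ω
    tauto

lemma energy_map {μ : Finset V → ℝ} (τ : Equiv.Perm V)
    (hτ : ∀ ω, μ (ω.map τ.toEmbedding) = μ ω) (F : Finset V) (e : V) :
    energy μ (F.map τ.toEmbedding) (τ e) = energy μ F e := by
  have hi (ω : Finset V) : ω.map τ.toEmbedding ∩ F.map τ.toEmbedding =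
      (ω ∩ F).map τ.toEmbedding := (Finset.map_inter _ _).symm
  have hc (s : Finset V) : condProb μ (F.map τ.toEmbedding) (s.map τ.toEmbedding) (τ e) =
      condProb μ F s e := by
    unfold condProb
    rw [weight_map τ hτ, weight_map τ hτ (fun ω => ω ∩ F.map τ.toEmbedding = _)]
    simp [hi]
  unfold energy
  rw [← Equiv.sum_comp τ.finsetCongr]
  refine Finset.sum_congr rfl fun ω _ => ?_
  rw [Equiv.finsetCongr_apply, hτ, hi, hc]

end Pinning

/-- The probability mass function of `G(n, 1/2)` conditioned on at most `t` triangles. -/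
def triMass (n : ℕ) (t : ℝ) (ω : Finset (Edge n)) : ℝ :=
  (if (triCount n ω : ℝ) ≤ t then pw (fun _ => (1 / 2 : ℝ)) ω else 0) /
    ∑ ω : Finset (Edge n),
      if (triCount n ω : ℝ) ≤ t then pw (fun _ => (1 / 2 : ℝ)) ω else 0

lemma pw_half {V : Type*} [Fintype V] [DecidableEq V] (ω : Finset V) :
    pw (fun _ => (1 / 2 : ℝ)) ω = (1 / 2) ^ Fintype.card V := by
  simp only [pw, Finset.prod_const]
  rw [show (1 - 1 / 2 : ℝ) = 1 / 2 by norm_num, ← pow_add, Finset.card_add_card_compl]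

lemma muPr_eq_weight (n : ℕ) (t : ℝ) (P : Finset (Edge n) → Prop) :
    muPr n t P = weight (triMass n t) P := by
  rw [muPr, weight, Finset.sum_div]
  refine Finset.sum_congr rfl fun ω _ => ?_
  by_cases h : P ω <;> simp [h, triMass]

lemma triMass_nonneg (n : ℕ) (t : ℝ) (ω : Finset (Edge n)) : 0 ≤ triMass n t ω := by
  unfold triMass
  simp only [pw_half]
  positivity

lemma triCount_empty (n : ℕ) : triCount n ∅ = 0 := by
  rw [triCount, Finset.card_eq_zero, Finset.filter_eq_empty_iff]
  intro T hT h
  obtain ⟨e, he, hc⟩ := Finset.exists_subset_card_eq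
    (show 2 ≤ T.card by rw [(Finset.mem_powersetCard.1 hT).2]; norm_num)
  exact Finset.notMem_empty _ (h ⟨e, hc⟩ he)

lemma sum_triMass (n : ℕ) {t : ℝ} (ht : 0 ≤ t) : ∑ ω, triMass n t ω = 1 := by
  unfold triMass
  rw [← Finset.sum_div]
  refine div_self (ne_of_gt ?_)
  refine Finset.sum_pos' (fun ω _ => ?_) ⟨∅, Finset.mem_univ _, ?_⟩
  · simp only [pw_half]
    positivity
  · rw [triCount_empty, Nat.cast_zero, if_pos ht, pw_half]
    positivity

/-- The permutation of the edges induced by a permutation of the vertices. -/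
def edgePerm {n : ℕ} (σ : Equiv.Perm (Fin n)) : Equiv.Perm (Edge n) :=
  σ.finsetCongr.subtypeEquiv fun s => by simp [Equiv.finsetCongr_apply]

@[simp]
lemma coe_edgePerm {n : ℕ} (σ : Equiv.Perm (Fin n)) (e : Edge n) :
    (edgePerm σ e).1 = e.1.map σ.toEmbedding := rfl

lemma triCount_map {n : ℕ} (σ : Equiv.Perm (Fin n)) (ω : Finset (Edge n)) :
    triCount n (ω.map (edgePerm σ).toEmbedding) = triCount n ω := by
  unfold triCount
  symm
  refine Finset.card_equiv σ.finsetCongr fun T => ?_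
  simp only [Finset.mem_filter, Finset.mem_powersetCard, Finset.subset_univ, true_and,
    Equiv.finsetCongr_apply, Finset.card_map]
  refine and_congr_right fun _ => ?_
  rw [← (edgePerm σ).forall_congr_right (q := fun e : Edge n => e.1 ⊆ T.map σ.toEmbedding → _)]
  simp only [coe_edgePerm, Finset.map_subset_map]
  simp

lemma triMass_map {n : ℕ} (t : ℝ) (σ : Equiv.Perm (Fin n)) (ω : Finset (Edge n)) :
    triMass n t (ω.map (edgePerm σ).toEmbedding) = triMass n t ω := by
  simp only [triMass, triCount_map, pw_half]

/-- The edges with an endpoint in `U`. -/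
def edgesMeeting {n : ℕ} (U : Finset (Fin n)) : Finset (Edge n) :=
  Finset.univ.filter fun e => ∃ v ∈ U, v ∈ e.1

lemma mem_edgesMeeting {n : ℕ} {U : Finset (Fin n)} {e : Edge n} :
    e ∈ edgesMeeting U ↔ ∃ v ∈ U, v ∈ e.1 := by
  simp [edgesMeeting]

lemma edgesMeeting_mono {n : ℕ} {U W : Finset (Fin n)} (h : U ⊆ W) :
    edgesMeeting U ⊆ edgesMeeting W := fun e he => by
  obtain ⟨v, hv, hve⟩ := mem_edgesMeeting.1 he
  exact mem_edgesMeeting.2 ⟨v, h hv, hve⟩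

lemma edgesMeeting_map {n : ℕ} (σ : Equiv.Perm (Fin n)) (U : Finset (Fin n)) :
    (edgesMeeting U).map (edgePerm σ).toEmbedding = edgesMeeting (U.map σ.toEmbedding) := by
  ext e
  obtain ⟨e, rfl⟩ := (edgePerm σ).surjective e
  refine (Finset.mem_map' (edgePerm σ).toEmbedding).trans ?_
  simp only [mem_edgesMeeting]
  rw [← σ.exists_congr_right (q := fun v => v ∈ U.map σ.toEmbedding ∧ _)]
  simp only [coe_edgePerm]
  exact exists_congr fun v => by
    rw [← Equiv.coe_toEmbedding, Finset.mem_map', Finset.mem_map']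

lemma card_edgesMeeting_le {n : ℕ} (U : Finset (Fin n)) :
    (edgesMeeting U).card ≤ U.card * n := by
  have h : edgesMeeting U ⊆ U.biUnion fun v => Finset.univ.filter fun e : Edge n => v ∈ e.1 :=
    fun e he => by simpa [mem_edgesMeeting] using he
  refine (Finset.card_le_card h).trans (Finset.card_biUnion_le_card_mul _ _ _ fun v _ => ?_)
  have h2 : ((Finset.univ.filter fun e : Edge n => v ∈ e.1).map (Function.Embedding.subtype _)) ⊆
      Finset.univ.image fun w : Fin n => ({v, w} : Finset (Fin n)) := by
    intro e he
    simp only [Finset.mem_map, Finset.mem_filter, Finset.mem_univ, true_and,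
      Function.Embedding.subtype_apply] at he
    obtain ⟨⟨e, hc⟩, hv, rfl⟩ := he
    obtain ⟨x, y, -, rfl⟩ := Finset.card_eq_two.1 hc
    simp only [Finset.mem_insert, Finset.mem_singleton] at hv
    simp only [Finset.mem_image, Finset.mem_univ, true_and]
    rcases hv with rfl | rfl
    · exact ⟨y, rfl⟩
    · exact ⟨x, Finset.pair_comm _ _⟩
  have h3 := (Finset.card_le_card h2).trans Finset.card_image_le
  rwa [Finset.card_map, Finset.card_univ, Fintype.card_fin] at h3

lemma exists_perm_map_eq {α : Type*} [Fintype α] [DecidableEq α] {U U' A A' : Finset α}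
    (hU : U.card = U'.card) (hA : A.card = A'.card) (h : Disjoint U A) (h' : Disjoint U' A') :
    ∃ σ : Equiv.Perm α, U.map σ.toEmbedding = U' ∧ A.map σ.toEmbedding = A' := by
  let f : α → Bool × Bool := fun x => (decide (x ∈ U), decide (x ∈ A))
  let g : α → Bool × Bool := fun x => (decide (x ∈ U'), decide (x ∈ A'))
  have hcard (c : Bool × Bool) : Fintype.card {x // f x = c} = Fintype.card {x // g x = c} := by
    rw [Fintype.card_subtype, Fintype.card_subtype]
    have aux (B C : Finset α) (hBC : Disjoint B C) :
        (Finset.univ.filter fun x => x ∉ B ∧ x ∉ C).card = Fintype.card α - (B.card + C.card) ∧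
        (Finset.univ.filter fun x => x ∉ B ∧ x ∈ C).card = C.card ∧
        (Finset.univ.filter fun x => x ∈ B ∧ x ∉ C).card = B.card ∧
        (Finset.univ.filter fun x => x ∈ B ∧ x ∈ C).card = 0 := by
      rw [Finset.disjoint_left] at hBC
      refine ⟨?_, ?_, ?_, ?_⟩
      · rw [← Finset.card_union_of_disjoint (Finset.disjoint_left.2 hBC), ← Finset.card_compl]
        congr 1
        ext x
        simp
      · congr 1
        ext x
        simp only [Finset.mem_filter, Finset.mem_univ, true_and]
        exact ⟨fun h => h.2, fun h => ⟨fun hB => hBC hB h, h⟩⟩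
      · congr 1
        ext x
        simp only [Finset.mem_filter, Finset.mem_univ, true_and]
        exact ⟨fun h => h.1, fun h => ⟨h, hBC h⟩⟩
      · rw [Finset.card_eq_zero, Finset.filter_eq_empty_iff]
        exact fun x _ h => hBC h.1 h.2
    obtain ⟨a1, a2, a3, a4⟩ := aux U A h
    obtain ⟨b1, b2, b3, b4⟩ := aux U' A' h'
    rcases c with ⟨_ | _, _ | _⟩ <;> simp only [f, g, Prod.mk.injEq, decide_eq_true_eq,
      decide_eq_false_iff_not] <;> omega
  let σ : Equiv.Perm α := (Equiv.sigmaFiberEquiv f).symm.trans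
    ((Equiv.sigmaCongrRight fun c => Fintype.equivOfCardEq (hcard c)).trans
      (Equiv.sigmaFiberEquiv g))
  have hσ (x : α) : g (σ x) = f x :=
    (Fintype.equivOfCardEq (hcard (f x)) ⟨x, rfl⟩).2
  have hσ' (x : α) : (σ x ∈ U' ↔ x ∈ U) ∧ (σ x ∈ A' ↔ x ∈ A) := by
    simpa [f, g] using hσ x
  refine ⟨σ, ?_, ?_⟩ <;> ext y <;> obtain ⟨x, rfl⟩ := σ.surjective y <;> simp [hσ']

lemma energy_edgesMeeting_eq {n : ℕ} (t : ℝ) {U U' : Finset (Fin n)} {e e' : Edge n}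
    (hU : U.card = U'.card) (h : Disjoint U e.1) (h' : Disjoint U' e'.1) :
    energy (triMass n t) (edgesMeeting U) e = energy (triMass n t) (edgesMeeting U') e' := by
  obtain ⟨σ, rfl, hσ⟩ := exists_perm_map_eq hU (e.2.trans e'.2.symm) h h'
  have he : e' = edgePerm σ e := Subtype.ext hσ.symm
  rw [he, ← edgesMeeting_map, energy_map _ (triMass_map t σ)]

lemma exists_le_sub_le {a : ℕ → ℝ} (h0 : 0 ≤ a 0) (N : ℕ) (hN : a (N + 1) ≤ 1) :
    ∃ m ≤ N, a (m + 1) - a m ≤ 1 / (N + 1) := by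
  by_contra! h
  have h1 : ∑ m ∈ Finset.range (N + 1), (1 / (N + 1) : ℝ) <
      ∑ m ∈ Finset.range (N + 1), (a (m + 1) - a m) :=
    Finset.sum_lt_sum_of_nonempty ⟨0, by simp⟩ fun m hm =>
      h m (Nat.lt_succ_iff.1 (Finset.mem_range.1 hm))
  rw [Finset.sum_range_sub, Finset.sum_const, Finset.card_range, nsmul_eq_mul] at h1
  have : ((N + 1 : ℕ) : ℝ) * (1 / (N + 1)) = 1 := by push_cast; field_simp
  linarith

lemma energy_gain_le {n : ℕ} (t : ℝ) {m : ℕ} {δ : ℝ} (hδ : 0 ≤ δ) {e₀ : Edge n}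
    (he₀ : ∀ v ∈ e₀.1, n - 2 ≤ v.val)
    (hm : energy (triMass n t) (edgesMeeting (Finset.univ.filter fun v => v.val < m + 1)) e₀ -
      energy (triMass n t) (edgesMeeting (Finset.univ.filter fun v => v.val < m)) e₀ ≤ δ)
    {x y z : Fin n} (hxy : x ≠ y) (hxz : x ≠ z) (hyz : y ≠ z) {e : Edge n} (he : e.1 = {x, y})
    {G : Finset (Edge n)} (hG : ∀ f ∈ G, z ∈ f.1) :
    energy (triMass n t) (edgesMeeting (Finset.univ.filter fun v => v.val < m) ∪ G) e -
      energy (triMass n t) (edgesMeeting (Finset.univ.filter fun v => v.val < m)) e ≤ δ := by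
  set U : Finset (Fin n) := Finset.univ.filter fun v => v.val < m with hU
  have hmemU (v : Fin n) : v ∈ U ↔ v.val < m := by simp [hU]
  have hμ := triMass_nonneg n t
  by_cases h : x.val < m ∨ y.val < m
  · have heU : e ∈ edgesMeeting U := by
      rw [mem_edgesMeeting, he]
      rcases h with h | h
      · exact ⟨x, (hmemU x).2 h, by simp⟩
      · exact ⟨y, (hmemU y).2 h, by simp⟩
    rwa [energy_eq_of_mem hμ heU, energy_eq_of_mem hμ (Finset.mem_union_left _ heU), sub_self]
  by_cases hz : z.val < m
  · rwa [Finset.union_eq_left.2 fun f hf => mem_edgesMeeting.2 ⟨z, (hmemU z).2 hz, hG f hf⟩,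
      sub_self]
  rw [← Fin.val_ne_iff] at hxy hxz hyz
  have hmn : m + 3 ≤ n := by omega
  have hzU : z ∉ U := by rwa [hmemU]
  have hcard : U.card = m := by
    rw [hU, Fin.card_filter_val_lt]
    omega
  have hcard' : (Finset.univ.filter fun v : Fin n => v.val < m + 1).card = m + 1 := by
    rw [Fin.card_filter_val_lt]
    omega
  have hdisj : Disjoint (insert z U) e.1 := by
    rw [he, Finset.disjoint_left]
    intro v hv hv'
    simp only [Finset.mem_insert, Finset.mem_singleton, hmemU] at hv hv'
    omega
  have hdisj' : Disjoint (Finset.univ.filter fun v : Fin n => v.val < m + 1) e₀.1 := by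
    rw [Finset.disjoint_left]
    intro v hv hv'
    have := he₀ v hv'
    simp only [Finset.mem_filter, Finset.mem_univ, true_and] at hv
    omega
  have h1 : energy (triMass n t) (edgesMeeting U) e =
      energy (triMass n t) (edgesMeeting U) e₀ :=
    energy_edgesMeeting_eq t rfl (hdisj.mono_left (Finset.subset_insert _ _))
      (hdisj'.mono_left fun v hv => by
        simp only [Finset.mem_filter, Finset.mem_univ, true_and]
        exact ((hmemU v).1 hv).trans m.lt_succ_self)
  have h2 := energy_edgesMeeting_eq t
    (show (insert z U).card = _ by rw [hcard', Finset.card_insert_of_notMem hzU, hcard])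
    hdisj hdisj'
  have h3 : edgesMeeting U ∪ G ⊆ edgesMeeting (insert z U) :=
    Finset.union_subset (edgesMeeting_mono (Finset.subset_insert _ _)) fun f hf =>
      mem_edgesMeeting.2 ⟨z, Finset.mem_insert_self _ _, hG f hf⟩
  have h4 := energy_mono hμ h3 e
  linarith

/-- Lemma `claim:triangles`: if `Y` is `G(n, 1/2)` conditioned on having at most `t`
triangles, then there is a subgraph `F ⊆ K_n` with at most `n^{3/2}` edges such that for
every triple `{i,j,k}` of distinct vertices, setting `S := (Y_f)_{f ∈ F}`, the expectation
(over the values of `S`) of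
`d_{ijk}^S = d_TV((Y_{ij}^S, Y_{ik}^S, Y_{jk}^S), Y_{ij}^S × Y_{ik}^S × Y_{jk}^S)`
is at most `2 n^{-1/4}`. -/
theorem conditional_approximate_independence (n : ℕ) (hn : 0 < n) (t : ℝ) (ht : 0 ≤ t) :
    ∃ F : Finset (Edge n), (F.card : ℝ) ≤ (n : ℝ) ^ ((3 : ℝ) / 2) ∧
      ∀ i j k : Fin n, ∀ hij : i ≠ j, ∀ hik : i ≠ k, ∀ hjk : j ≠ k,
        (∑ s ∈ F.powerset, muPr n t (fun ω => ω ∩ F = s) *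
            dS n t F s ⟨{i, j}, Finset.card_pair hij⟩ ⟨{i, k}, Finset.card_pair hik⟩
              ⟨{j, k}, Finset.card_pair hjk⟩)
          ≤ 2 * (n : ℝ) ^ (-(1 / 4) : ℝ) := by
  rcases Nat.lt_or_ge n 2 with h2 | h2
  · refine ⟨∅, by simp only [Finset.card_empty, Nat.cast_zero]; positivity, fun i j _ hij => ?_⟩
    exact absurd (Fin.ext (by omega)) hij
  have hμ := triMass_nonneg n t
  have hsum := sum_triMass n ht
  let e₀ : Edge n := ⟨{⟨n - 2, by omega⟩, ⟨n - 1, by omega⟩},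
    Finset.card_pair (by rw [Ne, Fin.mk.injEq]; omega)⟩
  have he₀ : ∀ v ∈ e₀.1, n - 2 ≤ v.val := by
    intro v hv
    simp only [e₀, Finset.mem_insert, Finset.mem_singleton] at hv
    rcases hv with rfl | rfl
    · exact le_rfl
    · exact Nat.sub_le_sub_left one_le_two n
  obtain ⟨m, hm, hgain⟩ := exists_le_sub_le
    (a := fun m => energy (triMass n t) (edgesMeeting (Finset.univ.filter fun v => v.val < m)) e₀)
    (energy_nonneg hμ _ _) n.sqrt (energy_le_one hμ hsum _ _)
  have hn' : (0 : ℝ) < n := by exact_mod_cast hn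
  refine ⟨edgesMeeting (Finset.univ.filter fun v => v.val < m), ?_, fun i j k hij hik hjk => ?_⟩
  · have hcard : (Finset.univ.filter fun v : Fin n => v.val < m).card ≤ n.sqrt := by
      rw [Fin.card_filter_val_lt]
      omega
    have h1 : ((edgesMeeting (Finset.univ.filter fun v : Fin n => v.val < m)).card : ℝ) ≤
        n.sqrt * n := by
      exact_mod_cast (card_edgesMeeting_le _).trans (Nat.mul_le_mul_right n hcard)
    refine h1.trans ((mul_le_mul_of_nonneg_right Real.nat_sqrt_le_real_sqrt hn'.le).trans_eq ?_)
    rw [Real.sqrt_eq_rpow, ← Real.rpow_add_one hn'.ne']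
    norm_num
  · have hδ : (0 : ℝ) ≤ 1 / (n.sqrt + 1) := by positivity
    have hroot : √(1 / (n.sqrt + 1) : ℝ) ≤ (n : ℝ) ^ (-(1 / 4) : ℝ) := by
      have h1 : (1 / (n.sqrt + 1) : ℝ) ≤ (n : ℝ) ^ (-(1 / 2) : ℝ) := by
        rw [Real.rpow_neg hn'.le, ← Real.sqrt_eq_rpow, ← one_div]
        exact one_div_le_one_div_of_le (Real.sqrt_pos.2 hn') Real.real_sqrt_le_nat_sqrt_succ
      refine (Real.sqrt_le_sqrt h1).trans_eq ?_
      rw [Real.sqrt_eq_rpow, ← Real.rpow_mul hn'.le]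
      norm_num
    have key := sum_weight_mul_dTV3_le hμ hsum
      (edgesMeeting (Finset.univ.filter fun v => v.val < m)) ⟨{i, j}, Finset.card_pair hij⟩
      ⟨{i, k}, Finset.card_pair hik⟩ ⟨{j, k}, Finset.card_pair hjk⟩
    have g₁ := energy_gain_le t hδ he₀ hgain hij hik hjk
      (e := ⟨{i, j}, Finset.card_pair hij⟩) rfl
      (G := {⟨{i, k}, Finset.card_pair hik⟩, ⟨{j, k}, Finset.card_pair hjk⟩})
      (fun f hf => by
        simp only [Finset.mem_insert, Finset.mem_singleton] at hf
        rcases hf with rfl | rfl <;> simp)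
    have g₂ := energy_gain_le t hδ he₀ hgain hik hij hjk.symm
      (e := ⟨{i, k}, Finset.card_pair hik⟩) rfl
      (G := {⟨{j, k}, Finset.card_pair hjk⟩})
      (fun f hf => by
        rw [Finset.mem_singleton] at hf
        subst hf
        simp)
    have g₁' := (Real.sqrt_le_sqrt g₁).trans hroot
    have g₂' := (Real.sqrt_le_sqrt g₂).trans hroot
    unfold dS joint margin
    simp only [muPr_eq_weight]
    refine key.trans ?_
    linarith

end
end

section
/- Let p ∈ (0,1), let Y be a {0,1}-valued random variable, let Z be a random variable on the same finite probability space, and let E_1, …, E_m be Z-measurable events, each of positive probability. Suppose that E[Y | Z] ≤ p' almost surely for some p' > 0. Then, setting μ := E[Y], I_p(Y | Z) − I_p(Y) ≥ (1/(2p'))·∑_{i=1}^m (Pr(Y=1 | E_i) − μ)²·Pr(E_i) − (p'/2)·∑_{1≤i<j≤m} Pr(E_i ∩ E_j). -/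
open Classical

noncomputable section

/-- The probability of the event `P` under the probability mass function `μ` on the
finite sample space `Ω`. -/
def PrE {Ω : Type*} [Fintype Ω] (μ : Ω → ℝ) (P : Ω → Prop) : ℝ :=
  ∑ ω, if P ω then μ ω else 0

open Finset in
/-- The probability of an event that constrains `Z` is the sum over the values of `Z`. -/
theorem PrE_and_mem {Ω ZT : Type*} [Fintype Ω] [Fintype ZT] (μ : Ω → ℝ) (P : Ω → Prop)
    (Z : Ω → ZT) (S : Set ZT) :
    PrE μ (fun ω => P ω ∧ Z ω ∈ S) = ∑ z, if z ∈ S then PrE μ (fun ω => P ω ∧ Z ω = z) else 0 := by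
  have h : ∀ z, (if z ∈ S then PrE μ (fun ω => P ω ∧ Z ω = z) else 0)
      = ∑ ω, if z = Z ω then (if P ω ∧ Z ω ∈ S then μ ω else 0) else 0 := by
    intro z
    unfold PrE
    split_ifs with hz
    · refine sum_congr rfl fun ω _ => ?_
      by_cases hzω : z = Z ω
      · subst hzω; simp [hz]
      · simp [hzω, Ne.symm hzω]
    · symm
      refine sum_eq_zero fun ω _ => ?_
      by_cases hzω : z = Z ω
      · subst hzω; simp [hz]
      · simp [hzω]
  rw [sum_congr rfl fun z _ => h z, sum_comm]
  simp only [PrE, sum_ite_eq', mem_univ, if_true]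
  congr!

theorem PrE_mem {Ω ZT : Type*} [Fintype Ω] [Fintype ZT] (μ : Ω → ℝ)
    (Z : Ω → ZT) (S : Set ZT) :
    PrE μ (fun ω => Z ω ∈ S) = ∑ z, if z ∈ S then PrE μ (fun ω => Z ω = z) else 0 := by
  simpa using PrE_and_mem μ (fun _ => True) Z S

theorem PrE_nonneg {Ω : Type*} [Fintype Ω] {μ : Ω → ℝ} (hμ : ∀ ω, 0 ≤ μ ω) (P : Ω → Prop) :
    0 ≤ PrE μ P :=
  Finset.sum_nonneg fun ω _ => by split_ifs; exacts [hμ ω, le_rfl]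

theorem PrE_mono {Ω : Type*} [Fintype Ω] {μ : Ω → ℝ} (hμ : ∀ ω, 0 ≤ μ ω) {P Q : Ω → Prop}
    (h : ∀ ω, P ω → Q ω) : PrE μ P ≤ PrE μ Q := by
  refine Finset.sum_le_sum fun ω _ => ?_
  by_cases hP : P ω
  · simp [hP, h ω hP]
  · by_cases hQ : Q ω <;> simp [hP, hQ, hμ ω]

theorem sub_one_add_sq_div_two_le_mul_log {x : ℝ} (hx : 0 < x) (hx1 : x ≤ 1) :
    x - 1 + (x - 1) ^ 2 / 2 ≤ x * Real.log x := by
  have h := Real.self_le_sinh_iff.mpr (neg_nonneg.mpr (Real.log_nonpos hx.le hx1))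
  rw [Real.sinh_eq, neg_neg, Real.exp_neg, Real.exp_log hx] at h
  have h2 := mul_le_mul_of_nonneg_left h hx.le
  have h3 : x * ((x⁻¹ - x) / 2) = (1 - x ^ 2) / 2 := by field_simp
  nlinarith

theorem add_sq_div_two_le_neg_log {y : ℝ} (hy : 0 ≤ y) (hy1 : y < 1) :
    y + y ^ 2 / 2 ≤ -Real.log (1 - y) := by
  have h := Real.hasSum_pow_div_log_of_abs_lt_one (by rwa [abs_of_nonneg hy] : |y| < 1)
  have h2 := sum_le_hasSum (Finset.range 2) (fun i _ => by positivity) h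
  norm_num [Finset.sum_range_succ] at h2
  linarith

/-- A quadratic lower bound for one term of the relative entropy. -/
theorem sub_add_sq_div_le_mul_log {a b c : ℝ} (ha : 0 ≤ a) (hb : 0 < b) (hac : a ≤ c)
    (hbc : b ≤ c) :
    a - b + (a - b) ^ 2 / (2 * c) ≤ a * Real.log a - a * Real.log b := by
  have hc : 0 < c := hb.trans_le hbc
  rcases ha.eq_or_lt with rfl | ha'
  · have : (0 - b) ^ 2 / (2 * c) ≤ b := by
      rw [div_le_iff₀ (by positivity)]; nlinarith
    simp only [zero_mul]; linarith
  rcases le_total a b with hab | hab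
  · have h := mul_le_mul_of_nonneg_left
      (sub_one_add_sq_div_two_le_mul_log (div_pos ha' hb) ((div_le_one hb).mpr hab)) hb.le
    rw [Real.log_div ha'.ne' hb.ne'] at h
    have h1 : b * (a / b - 1 + (a / b - 1) ^ 2 / 2) = a - b + (a - b) ^ 2 / (2 * b) := by
      field_simp
    have h2 : b * (a / b * (Real.log a - Real.log b)) = a * Real.log a - a * Real.log b := by
      field_simp
    have h3 : (a - b) ^ 2 / (2 * c) ≤ (a - b) ^ 2 / (2 * b) := by gcongr
    linarith
  · have hy1 : b / a ≤ 1 := (div_le_one ha').mpr hab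
    have hy0 : 0 < b / a := div_pos hb ha'
    have h := mul_le_mul_of_nonneg_left
      (add_sq_div_two_le_neg_log (y := 1 - b / a) (by linarith) (by linarith)) ha
    rw [sub_sub_cancel, Real.log_div hb.ne' ha'.ne'] at h
    have h1 : a * (1 - b / a + (1 - b / a) ^ 2 / 2) = a - b + (a - b) ^ 2 / (2 * a) := by
      field_simp
    have h3 : (a - b) ^ 2 / (2 * c) ≤ (a - b) ^ 2 / (2 * a) := by gcongr
    linarith

theorem ip_eq {p : ℝ} (hp0 : 0 < p) (hp1 : p < 1) (q : ℝ) :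
    ip p q = q * Real.log q + (1 - q) * Real.log (1 - q)
      - (q * Real.log p + (1 - q) * Real.log (1 - p)) := by
  have key : ∀ a b : ℝ, b ≠ 0 → a * Real.log (a / b) = a * Real.log a - a * Real.log b := by
    intro a b hb
    rcases eq_or_ne a 0 with rfl | ha
    · simp
    · rw [Real.log_div ha hb]; ring
  rw [ip, key q p hp0.ne', key (1 - q) (1 - p) (by linarith)]
  ring

open Finset in
/-- The information gain dominates the variance, scaled by an upper bound on the means. -/
theorem sum_sq_le_sum_ip_sub_ip {ι : Type*} [Fintype ι] {p c M : ℝ} (hp0 : 0 < p) (hp1 : p < 1)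
    {w q : ι → ℝ} (hw : ∀ i, 0 ≤ w i) (hw1 : ∑ i, w i = 1) (hM : ∑ i, w i * q i = M)
    (hq0 : ∀ i, 0 ≤ q i) (hq1 : ∀ i, q i ≤ 1) (hqc : ∀ i, q i ≤ c) (hMc : M ≤ c) :
    ∑ i, w i * ((q i - M) ^ 2 / (2 * c)) ≤ ∑ i, w i * ip p (q i) - ip p M := by
  have hwq : ∀ i, 0 ≤ w i * q i := fun i => mul_nonneg (hw i) (hq0 i)
  have hM0 : 0 ≤ M := hM ▸ sum_nonneg fun i _ => hwq i
  have hM' : ∑ i, w i * (1 - q i) = 1 - M := by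
    simp only [mul_sub, mul_one, sum_sub_distrib, hw1, hM]
  have hwq' : ∀ i, 0 ≤ w i * (1 - q i) := fun i => mul_nonneg (hw i) (by linarith [hq1 i])
  have hM1 : 0 ≤ 1 - M := hM' ▸ sum_nonneg fun i _ => hwq' i
  have hpt : ∀ i, w i * ((q i - M) ^ 2 / (2 * c)) ≤
      w i * ip p (q i) + (w i * q i) * (Real.log p - Real.log M)
        + (w i * (1 - q i)) * (Real.log (1 - p) - Real.log (1 - M)) := by
    intro i
    rcases (hw i).eq_or_lt with h0 | hpos
    · simp [← h0]
    have h1 : q i - M + (q i - M) ^ 2 / (2 * c)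
        ≤ q i * Real.log (q i) - q i * Real.log M := by
      rcases hM0.eq_or_lt with h | h
      · have : w i * q i ≤ 0 := by
          rw [h, ← hM]; exact single_le_sum (fun j _ => hwq j) (mem_univ i)
        have hq : q i = 0 := by nlinarith [hq0 i]
        simp [hq, ← h]
      · exact sub_add_sq_div_le_mul_log (hq0 i) h (hqc i) hMc
    have h2 : M - q i ≤ (1 - q i) * Real.log (1 - q i) - (1 - q i) * Real.log (1 - M) := by
      rcases hM1.eq_or_lt with h | h
      · have : w i * (1 - q i) ≤ 0 := by
          rw [h, ← hM']; exact single_le_sum (fun j _ => hwq' j) (mem_univ i)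
        have hq : q i = 1 := by nlinarith [hq1 i]
        simp [hq]; linarith
      · have h3 := sub_add_sq_div_le_mul_log (by linarith [hq1 i] : 0 ≤ 1 - q i) h
          (le_max_left _ _) (le_max_right _ _)
        have h4 : 0 ≤ (1 - q i - (1 - M)) ^ 2 / (2 * max (1 - q i) (1 - M)) :=
          div_nonneg (sq_nonneg _) (by linarith [le_max_right (1 - q i) (1 - M)])
        linarith
    rw [ip_eq hp0 hp1]
    have := mul_le_mul_of_nonneg_left (add_le_add h1 h2) hpos.le
    linarith
  have hsum := sum_le_sum fun i (_ : i ∈ univ) => hpt i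
  rw [sum_add_distrib, sum_add_distrib, ← sum_mul, ← sum_mul, hM, hM'] at hsum
  rw [ip_eq hp0 hp1 M]
  linarith

open Finset in
/-- The number of pairs of indices satisfying a predicate is at least the number of such indices
minus one. -/
theorem sum_sub_one_le_sum_pairs {m : ℕ} (P : Fin m → Prop) :
    (∑ i, if P i then (1 : ℝ) else 0) - 1 ≤
      ∑ i, ∑ j, if i < j then (if P i ∧ P j then (1 : ℝ) else 0) else 0 := by
  have hnn : ∀ i j : Fin m,
      0 ≤ (if i < j then (if P i ∧ P j then (1 : ℝ) else 0) else 0) := by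
    intro i j; split_ifs <;> norm_num
  by_cases hP : ∃ i, P i
  · obtain ⟨k, hk, hmin⟩ := WellFounded.has_min (wellFounded_lt (α := Fin m)) {i | P i} hP
    refine le_trans ?_ (single_le_sum (fun i _ => sum_nonneg fun j _ => hnn i j) (mem_univ k))
    have h1 : (1 : ℝ) = ∑ j, if k = j then (1 : ℝ) else 0 := by simp
    nth_rw 2 [h1]
    rw [← sum_sub_distrib]
    refine sum_le_sum fun j _ => ?_
    have hk' : P k := hk
    by_cases hj : P j
    · rcases (not_lt.mp (hmin j hj)).eq_or_lt with h | h
      · simp [h, hj]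
      · simp [h, hj, hk', h.ne]
    · have : (0:ℝ) ≤ if k = j then (1 : ℝ) else 0 := by split_ifs <;> norm_num
      simp only [hj, and_false, if_false, ite_self]
      linarith
  · push Not at hP
    simp [hP]

open Finset in
/-- Averages of a bounded function over almost disjoint sets: a truncated Bessel inequality. -/
theorem sum_sq_average_le {ι : Type*} [Fintype ι] {m : ℕ} {w f : ι → ℝ} {c : ℝ}
    (hw : ∀ z, 0 ≤ w z) (hf : ∀ z, f z ^ 2 ≤ c ^ 2) (T : Fin m → Set ι)
    (hT : ∀ i, 0 < ∑ z, if z ∈ T i then w z else 0) :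
    ∑ i, ((∑ z, if z ∈ T i then w z * f z else 0) / (∑ z, if z ∈ T i then w z else 0)) ^ 2
        * (∑ z, if z ∈ T i then w z else 0) ≤
      ∑ z, w z * f z ^ 2 + c ^ 2 * ∑ i, ∑ j,
        if i < j then (∑ z, if z ∈ T i ∧ z ∈ T j then w z else 0) else 0 := by
  have hcs : ∀ i, ((∑ z, if z ∈ T i then w z * f z else 0)
        / (∑ z, if z ∈ T i then w z else 0)) ^ 2 * (∑ z, if z ∈ T i then w z else 0)
      ≤ ∑ z, if z ∈ T i then w z * f z ^ 2 else 0 := by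
    intro i
    have h := sum_sq_le_sum_mul_sum_of_sq_le_mul (univ : Finset ι)
      (r := fun z => if z ∈ T i then w z * f z else 0)
      (f := fun z => if z ∈ T i then w z else 0)
      (g := fun z => if z ∈ T i then w z * f z ^ 2 else 0)
      (fun z _ => by split_ifs; exacts [hw z, le_rfl])
      (fun z _ => by split_ifs; exacts [mul_nonneg (hw z) (sq_nonneg _), le_rfl])
      (fun z _ => by split_ifs <;> apply le_of_eq <;> ring)
    rw [div_pow, div_mul_eq_mul_div, div_le_iff₀ (pow_pos (hT i) 2)]
    nlinarith [mul_le_mul_of_nonneg_right h (hT i).le]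
  have hpt : ∀ z, (∑ i, if z ∈ T i then w z * f z ^ 2 else 0) ≤ w z * f z ^ 2
      + c ^ 2 * ∑ i, ∑ j, if i < j then (if z ∈ T i ∧ z ∈ T j then w z else 0) else 0 := by
    intro z
    have h := sum_sub_one_le_sum_pairs fun i => z ∈ T i
    have e1 : (∑ i, if z ∈ T i then w z * f z ^ 2 else 0)
        = (w z * f z ^ 2) * ∑ i, if z ∈ T i then (1 : ℝ) else 0 := by
      simp only [mul_sum, mul_ite, mul_one, mul_zero]
    have e2 : (∑ i, ∑ j, if i < j then (if z ∈ T i ∧ z ∈ T j then w z else 0) else 0)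
        = w z * ∑ i, ∑ j,
            if i < j then (if z ∈ T i ∧ z ∈ T j then (1 : ℝ) else 0) else 0 := by
      simp only [mul_sum, mul_ite, mul_one, mul_zero]
    rw [e1, e2]
    have hN : 0 ≤ ∑ i, ∑ j,
        if i < j then (if z ∈ T i ∧ z ∈ T j then (1 : ℝ) else 0) else 0 :=
      sum_nonneg fun i _ => sum_nonneg fun j _ => by split_ifs <;> norm_num
    have h1 := mul_le_mul_of_nonneg_left h (mul_nonneg (hw z) (sq_nonneg (f z)))
    have h2 := mul_le_mul_of_nonneg_right (mul_le_mul_of_nonneg_left (hf z) (hw z)) hN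
    linarith
  calc _ ≤ ∑ i, ∑ z, (if z ∈ T i then w z * f z ^ 2 else 0) := sum_le_sum fun i _ => hcs i
    _ = ∑ z, ∑ i, (if z ∈ T i then w z * f z ^ 2 else 0) := sum_comm
    _ ≤ _ := sum_le_sum fun z _ => hpt z
    _ = _ := by
      rw [sum_add_distrib, ← mul_sum, sum_comm]
      congr 2
      refine sum_congr rfl fun i _ => ?_
      rw [sum_comm]
      refine sum_congr rfl fun j _ => ?_
      split_ifs <;> simp

/-- Lemma `lemma:main` (the key lemma): let `Y` be a `{0,1}`-valued random variable and
let `E₁, …, E_m` be `Z`-measurable events (`E_i = {Z ∈ T i}`) of positive probability,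
for some random variable `Z`.  If `E[Y ∣ Z] ≤ p'` (almost surely) for some `p' > 0`
then, with `μ = E[Y]`,
`I_p(Y ∣ Z) − I_p(Y) ≥ (1/(2p')) ∑_i (Pr(Y=1 ∣ E_i) − μ)² Pr(E_i)
  − (p'/2) ∑_{i<j} Pr(E_i ∩ E_j)`;
here `I_p(Y ∣ Z) = ∑_z Pr(Z=z) · i_p(Pr(Y=1 ∣ Z=z))` and `I_p(Y) = i_p(μ)`. -/
theorem key_lemma {Ω ZT : Type*} [Fintype Ω] [Fintype ZT] (μ : Ω → ℝ)
    (hμ0 : ∀ ω, 0 ≤ μ ω) (hμ1 : ∑ ω, μ ω = 1)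
    (Y : Ω → Bool) (Z : Ω → ZT) (p p' : ℝ) (hp0 : 0 < p) (hp1 : p < 1) (hp' : 0 < p')
    (m : ℕ) (T : Fin m → Set ZT)
    (hEpos : ∀ i, 0 < PrE μ (fun ω => Z ω ∈ T i))
    (hcond : ∀ z : ZT, PrE μ (fun ω => Z ω = z) ≠ 0 →
      PrE μ (fun ω => Y ω = true ∧ Z ω = z) / PrE μ (fun ω => Z ω = z) ≤ p') :
    (∑ z : ZT, PrE μ (fun ω => Z ω = z) *
          ip p (PrE μ (fun ω => Y ω = true ∧ Z ω = z) / PrE μ (fun ω => Z ω = z)))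
        - ip p (PrE μ (fun ω => Y ω = true)) ≥
      (1 / (2 * p')) *
          (∑ i : Fin m,
            (PrE μ (fun ω => Y ω = true ∧ Z ω ∈ T i) / PrE μ (fun ω => Z ω ∈ T i)
                - PrE μ (fun ω => Y ω = true)) ^ 2 * PrE μ (fun ω => Z ω ∈ T i))
        - (p' / 2) *
          ∑ i : Fin m, ∑ j : Fin m,
            if i < j then PrE μ (fun ω => Z ω ∈ T i ∧ Z ω ∈ T j) else 0 := by
  set w : ZT → ℝ := fun z => PrE μ (fun ω => Z ω = z) with hw_def
  set r : ZT → ℝ := fun z => PrE μ (fun ω => Y ω = true ∧ Z ω = z) with hr_def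
  set M : ℝ := PrE μ (fun ω => Y ω = true) with hM_def
  have hw : ∀ z, 0 ≤ w z := fun z => PrE_nonneg hμ0 _
  have hr : ∀ z, 0 ≤ r z := fun z => PrE_nonneg hμ0 _
  have hrw : ∀ z, r z ≤ w z := fun z => PrE_mono hμ0 fun ω h => h.2
  have hw1 : ∑ z, w z = 1 := by
    have h := PrE_mem μ Z Set.univ
    simp only [Set.mem_univ, if_true] at h
    rw [← h]
    simpa [PrE] using hμ1
  have hr1 : ∑ z, r z = M := by
    have h := PrE_and_mem μ (fun ω => Y ω = true) Z Set.univ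
    simp only [Set.mem_univ, if_true, and_true] at h
    exact h.symm
  have hmul : ∀ z, w z * (r z / w z) = r z := by
    intro z
    rcases eq_or_ne (w z) 0 with h | h
    · have : r z = 0 := le_antisymm (h ▸ hrw z) (hr z)
      simp [this]
    · field_simp
  have hq0 : ∀ z, 0 ≤ r z / w z := fun z => div_nonneg (hr z) (hw z)
  have hq1 : ∀ z, r z / w z ≤ 1 := fun z => div_le_one_of_le₀ (hrw z) (hw z)
  have hqc : ∀ z, r z / w z ≤ p' := by
    intro z
    rcases eq_or_ne (w z) 0 with h | h
    · simp [h, hp'.le]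
    · exact hcond z h
  have hM0 : 0 ≤ M := PrE_nonneg hμ0 _
  have hMc : M ≤ p' := by
    rw [← hr1, ← one_mul p', ← hw1, Finset.sum_mul]
    exact Finset.sum_le_sum fun z _ => hmul z ▸ mul_le_mul_of_nonneg_left (hqc z) (hw z)
  have hgain := sum_sq_le_sum_ip_sub_ip hp0 hp1 hw hw1
    ((Finset.sum_congr rfl fun z _ => hmul z).trans hr1) hq0 hq1 hqc hMc
  have hT : ∀ i, PrE μ (fun ω => Z ω ∈ T i) = ∑ z, if z ∈ T i then w z else 0 :=
    fun i => PrE_mem μ Z (T i)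
  have hYT : ∀ i, PrE μ (fun ω => Y ω = true ∧ Z ω ∈ T i) = ∑ z, if z ∈ T i then r z else 0 :=
    fun i => PrE_and_mem μ (fun ω => Y ω = true) Z (T i)
  have hTT : ∀ i j, PrE μ (fun ω => Z ω ∈ T i ∧ Z ω ∈ T j)
      = ∑ z, if z ∈ T i ∧ z ∈ T j then w z else 0 :=
    fun i j => by simpa only [Set.mem_inter_iff] using PrE_mem μ Z (T i ∩ T j)
  simp only [hT] at hEpos
  simp only [hT, hYT, hTT]
  have havg := sum_sq_average_le (f := fun z => r z / w z - M) (c := p') hw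
    (fun z => by
      refine sq_le_sq.mpr ?_
      rw [abs_of_pos hp', abs_le]
      constructor <;> linarith [hq0 z, hqc z]) T hEpos
  have hcentre : ∀ i, (∑ z, if z ∈ T i then w z * (r z / w z - M) else 0)
        / (∑ z, if z ∈ T i then w z else 0)
      = (∑ z, if z ∈ T i then r z else 0) / (∑ z, if z ∈ T i then w z else 0) - M := by
    intro i
    rw [div_sub' (hEpos i).ne', Finset.sum_mul, ← Finset.sum_sub_distrib]
    congr 1
    refine Finset.sum_congr rfl fun z _ => ?_
    split_ifs
    · rw [mul_sub, hmul]
    · simp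
  simp only [hcentre] at havg
  have hscale : ∑ z, w z * ((r z / w z - M) ^ 2 / (2 * p'))
      = 1 / (2 * p') * ∑ z, w z * (r z / w z - M) ^ 2 := by
    rw [Finset.mul_sum]
    exact Finset.sum_congr rfl fun z _ => by ring
  rw [hscale] at hgain
  have hfin := mul_le_mul_of_nonneg_left havg (by positivity : 0 ≤ 1 / (2 * p'))
  rw [mul_add, ← mul_assoc (1 / (2 * p')) (p' ^ 2),
    show 1 / (2 * p') * p' ^ 2 = p' / 2 by field_simp] at hfin
  linarith

end
end

section
/- For every nonempty finite set A and every function F : P(A) → ℝ defined on the power set of A, the following identity holds: F(A) − ∏_{a∈A} F({a}) = ∑_{B⊆A, |B|≥2} ∑_{b∈B} [1/(binom(|A|,|B|)·|B|)] · (F(B) − F(B\{b})·F({b})) · ∏_{a∈A\B} F({a}). -/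
open Finset in
/-- Pairs of a `(k + 1)`-subset and one of its elements correspond to pairs of a `k`-subset and an
element outside it. -/
theorem sum_powersetCard_sum_erase {α : Type*} [DecidableEq α] (A : Finset α) (k : ℕ)
    (g : Finset α → ℝ) :
    ∑ B ∈ A.powersetCard (k + 1), ∑ b ∈ B, g (B.erase b) =
      ((A.card - k : ℕ) : ℝ) * ∑ C ∈ A.powersetCard k, g C := by
  have h : ∑ B ∈ A.powersetCard (k + 1), ∑ b ∈ B, g (B.erase b) =
      ∑ C ∈ A.powersetCard k, ∑ _b ∈ A \ C, g C := by
    rw [sum_sigma', sum_sigma']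
    refine sum_bij' (fun x _ => ⟨x.1.erase x.2, x.2⟩) (fun x _ => ⟨insert x.2 x.1, x.2⟩)
      ?_ ?_ ?_ ?_ ?_
    · rintro ⟨B, b⟩ hx
      simp only [mem_sigma, mem_powersetCard, mem_sdiff] at hx ⊢
      obtain ⟨⟨hBA, hB⟩, hb⟩ := hx
      exact ⟨⟨(erase_subset _ _).trans hBA, by rw [card_erase_of_mem hb, hB]; rfl⟩, hBA hb,
        notMem_erase b B⟩
    · rintro ⟨C, b⟩ hx
      simp only [mem_sigma, mem_powersetCard, mem_sdiff] at hx ⊢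
      obtain ⟨⟨hCA, hC⟩, hbA, hb⟩ := hx
      exact ⟨⟨insert_subset hbA hCA, by rw [card_insert_of_notMem hb, hC]⟩, mem_insert_self _ _⟩
    · rintro ⟨B, b⟩ hx
      simp only [mem_sigma] at hx
      simp [insert_erase hx.2]
    · rintro ⟨C, b⟩ hx
      simp only [mem_sigma, mem_sdiff] at hx
      simp [erase_insert hx.2.2]
    · intro x _
      rfl
  rw [h, mul_sum]
  refine sum_congr rfl fun C hC => ?_
  obtain ⟨hCA, hC⟩ := mem_powersetCard.1 hC
  rw [sum_const, card_sdiff_of_subset hCA, hC, nsmul_eq_mul]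

/-- The average of `F B * ∏ a ∈ A \ B, F {a}` over the `k`-subsets `B` of `A`. -/
noncomputable def subsetAverage {α : Type*} [DecidableEq α] (A : Finset α) (F : Finset α → ℝ)
    (k : ℕ) : ℝ :=
  (∑ B ∈ A.powersetCard k, F B * ∏ a ∈ A \ B, F {a}) / (A.card.choose k : ℝ)

open Finset in
theorem subsetAverage_card {α : Type*} [DecidableEq α] (A : Finset α) (F : Finset α → ℝ) :
    subsetAverage A F A.card = F A := by
  simp [subsetAverage]

open Finset in
theorem subsetAverage_one {α : Type*} [DecidableEq α] (A : Finset α) (hA : A.Nonempty)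
    (F : Finset α → ℝ) : subsetAverage A F 1 = ∏ a ∈ A, F {a} := by
  have hn : (A.card : ℝ) ≠ 0 := by exact_mod_cast hA.card_pos.ne'
  have h : ∀ a ∈ A, F {a} * ∏ x ∈ A \ {a}, F {x} = ∏ x ∈ A, F {x} := fun a ha => by
    rw [sdiff_singleton_eq_erase, mul_prod_erase A (fun x => F {x}) ha]
  rw [subsetAverage, powersetCard_one, sum_map, Nat.choose_one_right]
  simp only [Function.Embedding.coeFn_mk]
  rw [sum_congr rfl h, sum_const, nsmul_eq_mul, mul_div_cancel_left₀ _ hn]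

open Finset in
theorem subsetAverage_succ_sub {α : Type*} [DecidableEq α] (A : Finset α) (F : Finset α → ℝ)
    {k : ℕ} (hk : k < A.card) :
    subsetAverage A F (k + 1) - subsetAverage A F k =
      ∑ B ∈ A.powersetCard (k + 1), ∑ b ∈ B,
        (1 / ((A.card.choose B.card : ℝ) * (B.card : ℝ))) *
          (F B - F (B.erase b) * F {b}) * ∏ a ∈ A \ B, F {a} := by
  set g : Finset α → ℝ := fun B => F B * ∏ a ∈ A \ B, F {a} with hg
  have hterm : ∀ B ∈ A.powersetCard (k + 1), ∑ b ∈ B,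
        (1 / ((A.card.choose B.card : ℝ) * (B.card : ℝ))) *
          (F B - F (B.erase b) * F {b}) * ∏ a ∈ A \ B, F {a} =
      (1 / ((A.card.choose (k + 1) : ℝ) * ((k + 1 : ℕ) : ℝ))) *
        (((k + 1 : ℕ) : ℝ) * g B - ∑ b ∈ B, g (B.erase b)) := by
    intro B hB
    obtain ⟨hBA, hB⟩ := mem_powersetCard.1 hB
    have hconst : ((k + 1 : ℕ) : ℝ) * g B = ∑ _b ∈ B, g B := by
      rw [sum_const, hB, nsmul_eq_mul]
    rw [hconst, ← sum_sub_distrib, mul_sum, hB]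
    refine sum_congr rfl fun b hb => ?_
    have hprod : ∏ a ∈ A \ B.erase b, F {a} = F {b} * ∏ a ∈ A \ B, F {a} := by
      rw [sdiff_erase (hBA hb), prod_insert (by simp [hb])]
    simp only [hg, hprod]
    ring
  rw [sum_congr rfl hterm, ← mul_sum, sum_sub_distrib, ← mul_sum, sum_powersetCard_sum_erase]
  have hc : (A.card.choose (k + 1) : ℝ) * ((k + 1 : ℕ) : ℝ) =
      (A.card.choose k : ℝ) * ((A.card - k : ℕ) : ℝ) := by
    exact_mod_cast Nat.choose_succ_right_eq A.card k
  have h1 : (A.card.choose (k + 1) : ℝ) ≠ 0 := by exact_mod_cast (Nat.choose_pos hk).ne'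
  have h2 : (A.card.choose k : ℝ) ≠ 0 := by exact_mod_cast (Nat.choose_pos hk.le).ne'
  have h3 : ((A.card - k : ℕ) : ℝ) ≠ 0 := by exact_mod_cast (Nat.sub_pos_of_lt hk).ne'
  have h4 : ((k + 1 : ℕ) : ℝ) ≠ 0 := by exact_mod_cast k.succ_ne_zero
  rw [mul_sub]
  congr 1
  · rw [subsetAverage]
    field_simp
    rfl
  · rw [hc, subsetAverage]
    field_simp
    rfl


/-- The combinatorial identity of Claim `clm:A prod a`: for every nonempty finite set `A`
and every function `F` on the power set of `A`,
`F(A) − ∏_{a∈A} F({a}) = ∑_{B⊆A, |B|≥2} ∑_{b∈B} (1/(C(|A|,|B|)·|B|)) ·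
  (F(B) − F(B∖{b})·F({b})) · ∏_{a∈A∖B} F({a})`. -/
theorem telescoping_identity {α : Type*} [DecidableEq α] (A : Finset α) (hA : A.Nonempty)
    (F : Finset α → ℝ) :
    F A - ∏ a ∈ A, F {a} =
      ∑ B ∈ A.powerset.filter (fun B => 2 ≤ B.card), ∑ b ∈ B,
        (1 / ((A.card.choose B.card : ℝ) * (B.card : ℝ))) *
          (F B - F (B.erase b) * F {b}) * ∏ a ∈ A \ B, F {a} := by
  obtain ⟨m, hm⟩ : ∃ m, A.card = m + 1 := Nat.exists_eq_add_one.2 hA.card_pos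
  have hmaps : ∀ B ∈ A.powerset.filter (fun B => 2 ≤ B.card), B.card - 2 ∈ Finset.range m := by
    intro B hB
    simp only [Finset.mem_filter, Finset.mem_powerset] at hB
    have := Finset.card_le_card hB.1
    rw [Finset.mem_range]
    omega
  have hfiber : ∀ j, (A.powerset.filter (fun B => 2 ≤ B.card)).filter (fun B => B.card - 2 = j) =
      A.powersetCard (j + 1 + 1) := by
    intro j
    ext B
    simp only [Finset.mem_filter, Finset.mem_powerset, Finset.mem_powersetCard, and_assoc]
    refine and_congr_right fun _ => ?_
    omega
  rw [← Finset.sum_fiberwise_of_maps_to hmaps, ← subsetAverage_one A hA F,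
    ← subsetAverage_card A F, hm, ← Finset.sum_range_sub (fun j => subsetAverage A F (j + 1)) m]
  refine Finset.sum_congr rfl fun j hj => ?_
  rw [Finset.mem_range] at hj
  rw [hfiber, subsetAverage_succ_sub A F (by omega), hm]
end
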